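/- (Existence of global kinematic formulas.) Let n ≥ 1 and let G be a closed subgroup of O(n) acting transitively on the unit sphere S^{n−1}; let γ be the Haar probability measure on G and λ the Lebesgue measure on ℝⁿ. Let φ ∈ Val^G, and extend φ to all compact convex sets by setting φ(∅) := 0. Then there exist finitely many valuations ψ_1, …, ψ_N, ρ_1, …, ρ_N ∈ Val^G such that for all nonempty compact convex K, L ⊆ ℝⁿ the function (g,x) ↦ φ(K ∩ (gL + x)) is integrable with respect to γ ⊗ λ on G × ℝⁿ and ∫_G ∫_{ℝⁿ} φ(K ∩ (gL + x)) dλ(x) dγ(g) = Σ_{i=1}^{N} ψ_i(K) ρ_i(L). -/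

import Mathlib

open MeasureTheory Pointwise
open scoped NNReal ENNReal

noncomputable section

/-- Euclidean `n`-space `ℝⁿ`. -/
abbrev Eucl (n : ℕ) : Type := EuclideanSpace ℝ (Fin n)

section Generic

variable {V : Type*} [NormedAddCommGroup V] [NormedSpace ℝ V]

/-- `μ` is a valuation: whenever the union of two convex bodies `K`, `L` is again a convex
body `M` (with intersection the convex body `I`), one has `μ M + μ I = μ K + μ L`. -/
def IsValuation (μ : ConvexBody V → ℝ) : Prop :=
  ∀ K L M I : ConvexBody V,
    (M : Set V) = (K : Set V) ∪ (L : Set V) → (I : Set V) = (K : Set V) ∩ (L : Set V) →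
      μ M + μ I = μ K + μ L

/-- The translate `K + x` of a convex body. -/
def ConvexBody.translate (K : ConvexBody V) (x : V) : ConvexBody V :=
  ⟨(K : Set V) + {x}, K.convex.add (convex_singleton x),
    K.isCompact.add isCompact_singleton, K.nonempty.add (Set.singleton_nonempty x)⟩

/-- Translation invariance of a valuation. -/
def TransInv (μ : ConvexBody V → ℝ) : Prop :=
  ∀ (K : ConvexBody V) (x : V), μ (K.translate x) = μ K

/-- The dilate `t • K` of a convex body. -/
def ConvexBody.dilate (t : ℝ) (K : ConvexBody V) : ConvexBody V :=
  ⟨t • (K : Set V), K.convex.smul t, K.isCompact.smul t, K.nonempty.smul_set⟩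

/-- Homogeneity of degree `k` of a valuation: `μ (t • K) = t ^ k * μ K` for `t > 0`. -/
def Homog (k : ℕ) (μ : ConvexBody V → ℝ) : Prop :=
  ∀ (K : ConvexBody V) (t : ℝ), 0 < t → μ (ConvexBody.dilate t K) = t ^ k * μ K

/-- The reflection `-K` of a convex body. -/
def ConvexBody.reflect (K : ConvexBody V) : ConvexBody V :=
  ⟨-(K : Set V), K.convex.neg, K.isCompact.neg, K.nonempty.neg⟩

/-- Even valuations: `μ (-K) = μ K`. -/
def EvenVal (μ : ConvexBody V → ℝ) : Prop := ∀ K : ConvexBody V, μ K.reflect = μ K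

/-- Odd valuations: `μ (-K) = -μ K`. -/
def OddVal (μ : ConvexBody V → ℝ) : Prop := ∀ K : ConvexBody V, μ K.reflect = -μ K

end Generic

/-- The image of a convex body under the linear map of `ℝⁿ` given by a real `n × n` matrix. -/
def matBody {n : ℕ} (A : Matrix (Fin n) (Fin n) ℝ) (K : ConvexBody (Eucl n)) :
    ConvexBody (Eucl n) :=
  ⟨Matrix.toEuclideanLin A '' (K : Set (Eucl n)),
    K.convex.linear_image (Matrix.toEuclideanLin A),
    K.isCompact.image (Matrix.toEuclideanLin A).continuous_of_finiteDimensional,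
    K.nonempty.image _⟩

/-- The space of real `n × n` matrices, as a (measurable, topological) function space. -/
abbrev Mat (n : ℕ) : Type := Fin n → Fin n → ℝ

/-- `A` is an orthogonal matrix. -/
def IsOrth {n : ℕ} (A : Mat n) : Prop := Matrix.of A ∈ Matrix.orthogonalGroup (Fin n) ℝ

/-- `γ` is the Haar probability measure of the orthogonal group `O(n)`: a probability
measure concentrated on the orthogonal matrices which is invariant under left translation
by orthogonal matrices. -/
def IsHaarOrth {n : ℕ} (γ : Measure (Mat n)) : Prop :=
  IsProbabilityMeasure γ ∧ γ {A : Mat n | ¬ IsOrth A} = 0 ∧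
    ∀ B : Mat n, IsOrth B →
      Measure.map (fun A : Mat n => Matrix.of.symm (Matrix.of B * Matrix.of A)) γ = γ

/-- `G` is a closed subgroup of the orthogonal group `O(n)` (a set of orthogonal matrices
containing the identity, closed under multiplication and inverse, and topologically
closed). -/
def IsClosedSubgroupO {n : ℕ} (G : Set (Matrix (Fin n) (Fin n) ℝ)) : Prop :=
  (∀ A ∈ G, A ∈ Matrix.orthogonalGroup (Fin n) ℝ) ∧ (1 : Matrix (Fin n) (Fin n) ℝ) ∈ G ∧
    (∀ A ∈ G, ∀ B ∈ G, A * B ∈ G) ∧ (∀ A ∈ G, A⁻¹ ∈ G) ∧ IsClosed G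

/-- `G` acts transitively on the unit sphere of `ℝⁿ`. -/
def ActsTransitively {n : ℕ} (G : Set (Matrix (Fin n) (Fin n) ℝ)) : Prop :=
  ∀ u v : Eucl n, ‖u‖ = 1 → ‖v‖ = 1 → ∃ A ∈ G, Matrix.toEuclideanLin A u = v

/-- Invariance of a valuation under the subgroup `G`. -/
def GInv {n : ℕ} (G : Set (Matrix (Fin n) (Fin n) ℝ)) (μ : ConvexBody (Eucl n) → ℝ) : Prop :=
  ∀ A ∈ G, ∀ K : ConvexBody (Eucl n), μ (matBody A K) = μ K

open scoped Classical in
/-- The extension of a valuation on convex bodies to arbitrary sets: on sets which are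
convex bodies it agrees with `φ`, and elsewhere (in particular on `∅`) it is `0`. -/
def extendVal {n : ℕ} (φ : ConvexBody (Eucl n) → ℝ) (S : Set (Eucl n)) : ℝ :=
  if h : ∃ B : ConvexBody (Eucl n), (B : Set (Eucl n)) = S then φ h.choose else 0

namespace Kinematic

open scoped RealInnerProductSpace

variable {E : Type*} [NormedAddCommGroup E] [InnerProductSpace ℝ E]

/-- Sublinear functions, i.e. support functions of convex bodies. -/
structure SubLin (h : E → ℝ) : Prop where
  add_le : ∀ x y, h (x + y) ≤ h x + h y
  smul : ∀ t : ℝ, 0 ≤ t → ∀ x, h (t • x) = t * h x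

/-- Continuous translation invariant valuations, expressed on support functions. -/
structure IsVF (Φ : (E → ℝ) → ℝ) : Prop where
  val : ∀ h k, SubLin h → SubLin k → SubLin (h ⊓ k) → Φ (h ⊔ k) + Φ (h ⊓ k) = Φ h + Φ k
  trans : ∀ h, SubLin h → ∀ v : E, Φ (h + fun x => ⟪v, x⟫) = Φ h
  cont : ∀ h, SubLin h → ∀ ε > 0, ∃ δ > 0, ∀ k, SubLin k →
    (∀ x, |k x - h x| ≤ δ * ‖x‖) → |Φ k - Φ h| ≤ ε

namespace SubLin

theorem zero : SubLin (0 : E → ℝ) := ⟨by simp, by simp⟩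

theorem add {h k : E → ℝ} (hh : SubLin h) (hk : SubLin k) : SubLin (h + k) where
  add_le x y := by have := hh.add_le x y; have := hk.add_le x y; simp only [Pi.add_apply]; linarith
  smul t ht x := by simp only [Pi.add_apply, hh.smul t ht, hk.smul t ht]; ring

theorem const_smul {h : E → ℝ} (hh : SubLin h) {c : ℝ} (hc : 0 ≤ c) : SubLin (c • h) where
  add_le x y := by
    have := mul_le_mul_of_nonneg_left (hh.add_le x y) hc
    simp only [Pi.smul_apply, smul_eq_mul]; linarith
  smul t ht x := by simp only [Pi.smul_apply, hh.smul t ht, smul_eq_mul]; ring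

theorem sup {h k : E → ℝ} (hh : SubLin h) (hk : SubLin k) : SubLin (h ⊔ k) where
  add_le x y := by
    simp only [Pi.sup_apply]
    refine sup_le ((hh.add_le x y).trans ?_) ((hk.add_le x y).trans ?_)
    · exact add_le_add le_sup_left le_sup_left
    · exact add_le_add le_sup_right le_sup_right
  smul t ht x := by
    simp only [Pi.sup_apply, hh.smul t ht, hk.smul t ht]
    exact (mul_max_of_nonneg _ _ ht).symm

theorem linear (v : E) : SubLin (fun x : E => ⟪v, x⟫) where
  add_le x y := by rw [inner_add_right]
  smul t _ x := by rw [inner_smul_right]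

theorem map_zero {h : E → ℝ} (hh : SubLin h) : h 0 = 0 := by
  simpa using hh.smul 0 le_rfl 0

theorem sum {ι : Type*} (s : Finset ι) {h : ι → E → ℝ} (hh : ∀ i ∈ s, SubLin (h i)) :
    SubLin (∑ i ∈ s, h i) := by
  classical
  induction s using Finset.induction_on with
  | empty => simpa using zero
  | insert i s hi ih =>
    rw [Finset.sum_insert hi]
    exact (hh i (by simp)).add (ih fun j hj => hh j (by simp [hj]))

theorem norm : SubLin (fun x : E => ‖x‖) where
  add_le := norm_add_le
  smul t ht x := by rw [norm_smul, Real.norm_of_nonneg ht]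

theorem comp {F : Type*} [NormedAddCommGroup F] [InnerProductSpace ℝ F] {h : E → ℝ}
    (hh : SubLin h) (L : F →ₗ[ℝ] E) : SubLin (fun x => h (L x)) where
  add_le x y := by rw [map_add]; exact hh.add_le _ _
  smul t ht x := by rw [_root_.map_smul]; exact hh.smul t ht _

theorem of_tendsto {h : E → ℝ} {u : ℕ → E → ℝ} (hu : ∀ i, SubLin (u i))
    (hlim : ∀ x, Filter.Tendsto (fun i => u i x) Filter.atTop (nhds (h x))) : SubLin h where
  add_le x y := le_of_tendsto_of_tendsto' (hlim _) ((hlim x).add (hlim y)) fun i => (hu i).add_le x y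
  smul t ht x := tendsto_nhds_unique (hlim _)
    (((hlim x).const_mul t).congr fun i => ((hu i).smul t ht x).symm)

end SubLin

/-- The positive part of the linear functional `v`; support function of the segment `[0,v]`. -/
def pp (v : E) : E → ℝ := fun x => max ⟪v, x⟫ 0

theorem subLin_pp (v : E) : SubLin (pp v) := by
  have := (SubLin.linear v).sup SubLin.zero
  exact this

/-- Finite difference operator on functionals. -/
def Dif (k : E → ℝ) (Φ : (E → ℝ) → ℝ) : (E → ℝ) → ℝ := fun h => Φ (h + k) - Φ h

theorem dif_comm (k l : E → ℝ) (Φ : (E → ℝ) → ℝ) : Dif k (Dif l Φ) = Dif l (Dif k Φ) := by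
  ext h; simp only [Dif, add_right_comm h k l]; ring

theorem dif_zero (Φ : (E → ℝ) → ℝ) : Dif 0 Φ = 0 := by ext h; simp [Dif]

theorem IsVF.dif {Φ : (E → ℝ) → ℝ} (hΦ : IsVF Φ) {k : E → ℝ} (hk : SubLin k) :
    IsVF (Dif k Φ) where
  val h l hh hl hi := by
    have e1 : (h ⊔ l) + k = (h + k) ⊔ (l + k) := by
      ext x; simp only [Pi.add_apply, Pi.sup_apply]; exact (max_add_add_right _ _ _).symm
    have e2 : (h ⊓ l) + k = (h + k) ⊓ (l + k) := by
      ext x; simp only [Pi.add_apply, Pi.inf_apply]; exact (min_add_add_right _ _ _).symm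
    have h1 := hΦ.val (h + k) (l + k) (hh.add hk) (hl.add hk) (e2 ▸ hi.add hk)
    have h2 := hΦ.val h l hh hl hi
    simp only [Dif, e1, e2]; linarith
  trans h hh v := by
    simp only [Dif]; rw [add_right_comm, hΦ.trans _ (hh.add hk), hΦ.trans _ hh]
  cont h hh ε hε := by
    obtain ⟨δ₁, h1, H1⟩ := hΦ.cont h hh (ε / 2) (by positivity)
    obtain ⟨δ₂, h2, H2⟩ := hΦ.cont (h + k) (hh.add hk) (ε / 2) (by positivity)
    refine ⟨min δ₁ δ₂, by positivity, fun l hl hd => ?_⟩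
    have a1 := H1 l hl fun x => (hd x).trans (by gcongr; exact min_le_left _ _)
    have a2 := H2 (l + k) (hl.add hk) fun x => by
      simp only [Pi.add_apply, add_sub_add_right_eq_sub]
      exact (hd x).trans (by gcongr; exact min_le_right _ _)
    simp only [Dif]; rw [abs_le] at *; constructor <;> linarith [a1.1, a1.2, a2.1, a2.2]

theorem IsVF.cont_seq {Φ : (E → ℝ) → ℝ} (hΦ : IsVF Φ) {h : E → ℝ} (hh : SubLin h)
    {u : ℕ → E → ℝ} (hu : ∀ i, SubLin (u i)) {e : ℕ → ℝ}
    (he : Filter.Tendsto e Filter.atTop (nhds 0)) (hb : ∀ i x, |u i x - h x| ≤ e i * ‖x‖) :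
    Filter.Tendsto (fun i => Φ (u i)) Filter.atTop (nhds (Φ h)) := by
  rw [Metric.tendsto_atTop]
  intro ε hε
  obtain ⟨δ, hδ, H⟩ := hΦ.cont h hh (ε / 2) (by positivity)
  obtain ⟨N, hN⟩ := (Metric.tendsto_atTop.1 he) δ hδ
  refine ⟨N, fun i hi => ?_⟩
  rw [Real.dist_eq]
  refine (H (u i) (hu i) fun x => (hb i x).trans ?_).trans_lt (by linarith)
  have := hN i hi
  rw [Real.dist_eq, sub_zero] at this
  gcongr
  exact (le_abs_self _).trans this.le

section Segments

theorem eq_max_left' {a b c : ℝ} (h : c ≤ b) (e : a = b) : a = max b c := by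
  rw [max_eq_left h, e]

theorem eq_max_right' {a b c : ℝ} (h : b ≤ c) (e : a = c) : a = max b c := by
  rw [max_eq_right h, e]

theorem eq_min_left' {a b c : ℝ} (h : b ≤ c) (e : a = b) : a = min b c := by
  rw [min_eq_left h, e]

theorem eq_min_right' {a b c : ℝ} (h : c ≤ b) (e : a = c) : a = min b c := by
  rw [min_eq_right h, e]

variable {Φ : (E → ℝ) → ℝ}

theorem IsVF.val' (hΦ : IsVF Φ) {h k M m : E → ℝ} (hh : SubLin h) (hk : SubLin k)
    (hm : SubLin m) (hM : ∀ x, M x = max (h x) (k x)) (hm' : ∀ x, m x = min (h x) (k x)) :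
    Φ M + Φ m = Φ h + Φ k := by
  obtain rfl : M = h ⊔ k := funext hM
  obtain rfl : m = h ⊓ k := funext hm'
  exact hΦ.val h k hh hk hm

theorem IsVF.seg_add (hΦ : IsVF Φ) {h : E → ℝ} (hh : SubLin h) (v : E) {s t : ℝ}
    (hs : 0 ≤ s) (ht : 0 ≤ t) :
    Φ (h + (s + t) • pp v) + Φ h = Φ (h + s • pp v) + Φ (h + t • pp v) := by
  have hp := subLin_pp v
  have tr := hΦ.trans (h + t • pp v) (hh.add (hp.const_smul ht)) (s • v)
  have tr0 := hΦ.trans h hh (s • v)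
  have key := hΦ.val' (h := h + s • pp v) (k := h + t • pp v + fun x => ⟪s • v, x⟫)
    (M := h + (s + t) • pp v) (m := h + fun x => ⟪s • v, x⟫)
    (hh.add (hp.const_smul hs)) ((hh.add (hp.const_smul ht)).add (SubLin.linear _))
    (hh.add (SubLin.linear _)) ?_ ?_
  · rw [tr, tr0] at key; exact key
  all_goals
    intro x
    simp only [Pi.add_apply, Pi.smul_apply, smul_eq_mul, pp, real_inner_smul_left]
    rcases le_total 0 ⟪v, x⟫ with hx | hx
    · have := mul_nonneg hs hx; have := mul_nonneg ht hx
      rw [max_eq_left hx]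
      first
        | exact eq_max_left' (by linarith) (by linarith)
        | exact eq_max_right' (by linarith) (by linarith)
        | exact eq_min_left' (by linarith) (by linarith)
    · have := mul_nonpos_of_nonneg_of_nonpos hs hx
      rw [max_eq_right hx]
      first
        | exact eq_max_left' (by linarith) (by linarith)
        | exact eq_max_right' (by linarith) (by linarith)
        | exact eq_min_left' (by linarith) (by linarith)
        | exact eq_min_right' (by linarith) (by linarith)

theorem IsVF.seg_neg (hΦ : IsVF Φ) {h : E → ℝ} (hh : SubLin h) (v : E) {t : ℝ} (ht : 0 ≤ t) :
    Φ (h + t • pp (-v)) = Φ (h + t • pp v) := by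
  rw [← hΦ.trans (h + t • pp (-v)) (hh.add ((subLin_pp _).const_smul ht)) (t • v)]
  congr 1
  ext x
  simp only [Pi.add_apply, Pi.smul_apply, smul_eq_mul, pp, real_inner_smul_left, inner_neg_left]
  rcases le_total 0 ⟪v, x⟫ with hx | hx
  · rw [max_eq_left hx, max_eq_right (by linarith)]; ring
  · rw [max_eq_right hx, max_eq_left (by linarith)]; ring

theorem IsVF.seg_shear_pos (hΦ : IsVF Φ) {h : E → ℝ} (hh : SubLin h) (v w : E) {c : ℝ}
    (hc : 0 ≤ c) :
    Φ (h + pp (w + c • v) + pp v) - Φ (h + pp (w + c • v)) =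
      Φ (h + pp w + pp v) - Φ (h + pp w) := by
  have hp := subLin_pp v
  set m' : E → ℝ := (((0 : E → ℝ) ⊔ fun x => ⟪c • v, x⟫) ⊔ fun x => ⟪w + c • v, x⟫) with hm'
  have Sm : SubLin m' := (SubLin.zero.sup (SubLin.linear _)).sup (SubLin.linear _)
  have hpw := subLin_pp w
  have hpw' := subLin_pp (w + c • v)
  have Pm : ∀ x, 0 ≤ ⟪v, x⟫ → m' x = max ⟪w, x⟫ 0 + c * ⟪v, x⟫ := by
    intro x hx
    have := mul_nonneg hc hx
    simp only [hm', Pi.sup_apply, Pi.zero_apply, real_inner_smul_left, inner_add_left]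
    rw [max_eq_right this, max_comm, ← max_add_add_right, zero_add]
  have Nm : ∀ x, ⟪v, x⟫ ≤ 0 → m' x = max (⟪w, x⟫ + c * ⟪v, x⟫) 0 := by
    intro x hx
    have := mul_nonpos_of_nonneg_of_nonpos hc hx
    simp only [hm', Pi.sup_apply, Pi.zero_apply, real_inner_smul_left, inner_add_left]
    rw [max_eq_left this, max_comm]
  have k1 := hΦ.val' (h := h + m' + pp v) (k := h + pp w + c • pp v)
    (M := h + pp w + (c + 1) • pp v) (m := h + m')
    ((hh.add Sm).add hp) ((hh.add hpw).add (hp.const_smul hc)) (hh.add Sm) ?_ ?_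
  · have k2 := hΦ.val' (h := h + pp (w + c • v) + c • pp v) (k := h + m' + pp (-v))
      (M := h + pp (w + c • v) + c • pp v + (1 : ℝ) • pp (-v)) (m := h + m')
      ((hh.add hpw').add (hp.const_smul hc)) ((hh.add Sm).add (subLin_pp _)) (hh.add Sm) ?_ ?_
    · have n1 := hΦ.seg_neg (h := h + pp (w + c • v) + c • pp v)
        ((hh.add hpw').add (hp.const_smul hc)) v (zero_le_one)
      have n2 := hΦ.seg_neg (h := h + m') (hh.add Sm) v (zero_le_one)
      have l1 := hΦ.seg_add (hh.add hpw) v hc zero_le_one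
      have l2 := hΦ.seg_add (hh.add hpw') v hc zero_le_one
      rw [n1, add_assoc (h + pp (w + c • v)), ← add_smul] at k2
      rw [one_smul, one_smul] at n2
      rw [one_smul] at l1 l2
      linarith
    all_goals
      intro x
      simp only [Pi.add_apply, Pi.smul_apply, smul_eq_mul, pp, inner_neg_left]
      rcases le_total 0 ⟪v, x⟫ with hx | hx
      · have := mul_nonneg hc hx
        have h3 : max (⟪w + c • v, x⟫) 0 ≥ max ⟪w, x⟫ 0 := by
          rw [inner_add_left, real_inner_smul_left]; exact max_le_max (by linarith) le_rfl
        have h4 : max (⟪w + c • v, x⟫) 0 ≤ max ⟪w, x⟫ 0 + c * ⟪v, x⟫ := by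
          rw [inner_add_left, real_inner_smul_left, ← max_add_add_right]
          exact max_le_max (by linarith) (by linarith)
        rw [Pm x hx, max_eq_left hx, max_eq_right (by linarith : -⟪v, x⟫ ≤ 0)]
        first
          | exact eq_max_left' (by linarith) (by linarith)
          | exact eq_max_right' (by linarith) (by linarith)
          | exact eq_min_left' (by linarith) (by linarith)
          | exact eq_min_right' (by linarith) (by linarith)
      · rw [Nm x hx, max_eq_right hx, max_eq_left (by linarith : 0 ≤ -⟪v, x⟫), inner_add_left,
          real_inner_smul_left]
        first
          | exact eq_max_left' (by linarith) (by linarith)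
          | exact eq_max_right' (by linarith) (by linarith)
          | exact eq_min_left' (by linarith) (by linarith)
  all_goals
    intro x
    simp only [Pi.add_apply, Pi.smul_apply, smul_eq_mul, pp]
    rcases le_total 0 ⟪v, x⟫ with hx | hx
    · rw [Pm x hx, max_eq_left hx]
      first
        | exact eq_max_left' (by linarith) (by linarith)
        | exact eq_max_right' (by linarith) (by linarith)
        | exact eq_min_left' (by linarith) (by linarith)
        | exact eq_min_right' (by linarith) (by linarith)
    · have := mul_nonpos_of_nonneg_of_nonpos hc hx
      rw [Nm x hx, max_eq_right hx]
      have h3 : max (⟪w, x⟫ + c * ⟪v, x⟫) 0 ≤ max ⟪w, x⟫ 0 := max_le_max (by linarith) le_rfl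
      first
        | exact eq_max_left' (by linarith) (by linarith)
        | exact eq_max_right' (by linarith) (by linarith)
        | exact eq_min_left' (by linarith) (by linarith)

theorem IsVF.seg_shear (hΦ : IsVF Φ) {h : E → ℝ} (hh : SubLin h) (v w : E) (c : ℝ) :
    Dif (pp v) (Dif (pp (w + c • v)) Φ) h = Dif (pp v) (Dif (pp w) Φ) h := by
  rcases le_total 0 c with hc | hc
  · have := hΦ.seg_shear_pos hh v w hc
    simp only [Dif]
    rw [add_right_comm h (pp v), add_right_comm h (pp v)]
    linarith
  · have := hΦ.seg_shear_pos hh (-v) w (c := -c) (by linarith)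
    have e : w + -c • -v = w + c • v := by simp
    rw [e] at this
    have n1 := hΦ.seg_neg (hh.add (subLin_pp (w + c • v))) v zero_le_one
    have n2 := hΦ.seg_neg (hh.add (subLin_pp w)) v zero_le_one
    simp only [one_smul] at n1 n2
    simp only [Dif]
    rw [add_right_comm h (pp v), add_right_comm h (pp v)]
    linarith

end Segments

end Kinematic

namespace Kinematic

open scoped RealInnerProductSpace

variable {E : Type*} [NormedAddCommGroup E] [InnerProductSpace ℝ E]

/-- Iterated finite differences. -/
def MD (l : List (E → ℝ)) (Φ : (E → ℝ) → ℝ) : (E → ℝ) → ℝ := l.foldr Dif Φ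

theorem md_cons (k : E → ℝ) (l : List (E → ℝ)) (Φ : (E → ℝ) → ℝ) :
    MD (k :: l) Φ = Dif k (MD l Φ) := rfl

theorem md_dif (k : E → ℝ) (l : List (E → ℝ)) (Φ : (E → ℝ) → ℝ) :
    MD l (Dif k Φ) = Dif k (MD l Φ) := by
  induction l with
  | nil => rfl
  | cons a l ih => rw [md_cons, ih, md_cons, dif_comm]

theorem IsVF.md {Φ : (E → ℝ) → ℝ} (hΦ : IsVF Φ) {l : List (E → ℝ)} (hl : ∀ k ∈ l, SubLin k) :
    IsVF (MD l Φ) := by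
  induction l with
  | nil => exact hΦ
  | cons a l ih => exact (ih fun k hk => hl k (by simp [hk])).dif (hl a (by simp))

theorem IsVF.md_pp {Φ : (E → ℝ) → ℝ} (hΦ : IsVF Φ) (l : List E) : IsVF (MD (l.map pp) Φ) :=
  hΦ.md fun k hk => by
    obtain ⟨v, -, rfl⟩ := List.mem_map.1 hk
    exact subLin_pp v

theorem dif_congr {Φ Ψ : (E → ℝ) → ℝ} (h : ∀ f, SubLin f → Φ f = Ψ f) {k : E → ℝ}
    (hk : SubLin k) : ∀ f, SubLin f → Dif k Φ f = Dif k Ψ f := fun f hf => by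
  simp only [Dif, h f hf, h _ (hf.add hk)]

theorem md_congr {Φ Ψ : (E → ℝ) → ℝ} (h : ∀ f, SubLin f → Φ f = Ψ f) {l : List (E → ℝ)}
    (hl : ∀ k ∈ l, SubLin k) : ∀ f, SubLin f → MD l Φ f = MD l Ψ f := by
  induction l with
  | nil => exact h
  | cons a l ih => exact dif_congr (ih fun k hk => hl k (by simp [hk])) (hl a (by simp))

theorem md_pp_add_span {Φ : (E → ℝ) → ℝ} (hΦ : IsVF Φ) (l : List E) {y : E}
    (hy : y ∈ Submodule.span ℝ {v | v ∈ l}) : ∀ (x : E) (f : E → ℝ), SubLin f →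
      MD (l.map pp) (Dif (pp (x + y)) Φ) f = MD (l.map pp) (Dif (pp x) Φ) f := by
  have hsub : ∀ l : List E, ∀ k ∈ l.map pp, SubLin k := fun l k hk => by
    obtain ⟨v, -, rfl⟩ := List.mem_map.1 hk
    exact subLin_pp v
  suffices H : ∀ (c : ℝ) (x : E) (f : E → ℝ), SubLin f →
      MD (l.map pp) (Dif (pp (x + c • y)) Φ) f = MD (l.map pp) (Dif (pp x) Φ) f by
    simpa using H 1
  induction hy using Submodule.span_induction with
  | mem v hv =>
    intro c x f hf
    obtain ⟨l₁, l₂, rfl⟩ := List.append_of_mem hv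
    have key : ∀ w, MD ((l₁ ++ v :: l₂).map pp) (Dif (pp w) Φ) =
        MD ((l₁ ++ l₂).map pp) (Dif (pp v) (Dif (pp w) Φ)) := by
      intro w
      simp only [MD, List.map_append, List.map_cons, List.foldr_append, List.foldr_cons]
      congr 1
      exact (md_dif (pp v) (l₂.map pp) _).symm
    rw [key, key]
    exact md_congr (fun g hg => hΦ.seg_shear hg v x c) (hsub _) f hf
  | zero => simp
  | add y z _ _ hy hz =>
    intro c x f hf
    rw [smul_add, ← add_assoc, hz c _ f hf, hy c _ f hf]
  | smul d y _ ih =>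
    intro c x f hf
    rw [smul_smul, ih (c * d) x f hf]

theorem pp_zero : pp (0 : E) = 0 := by ext x; simp [pp]

theorem md_zero (l : List (E → ℝ)) : MD l (0 : (E → ℝ) → ℝ) = 0 := by
  induction l with
  | nil => rfl
  | cons a l ih => rw [md_cons, ih]; ext h; simp [Dif]

/-- Iterated differences along linearly dependent segments vanish. -/
theorem md_pp_span {Φ : (E → ℝ) → ℝ} (hΦ : IsVF Φ) (l : List E) {y : E}
    (hy : y ∈ Submodule.span ℝ {v | v ∈ l}) {f : E → ℝ} (hf : SubLin f) :
    MD (l.map pp) (Dif (pp y) Φ) f = 0 := by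
  have := md_pp_add_span hΦ l hy 0 f hf
  rw [zero_add, pp_zero, dif_zero, md_zero] at this
  exact this

theorem md_pp_eq_zero [FiniteDimensional ℝ E] (l : List E)
    (hl : Module.finrank ℝ E < l.length) {Φ : (E → ℝ) → ℝ} (hΦ : IsVF Φ) {f : E → ℝ}
    (hf : SubLin f) : MD (l.map pp) Φ f = 0 := by
  have key : ∀ l : List E, (∀ Φ : (E → ℝ) → ℝ, IsVF Φ → ∀ f, SubLin f → MD (l.map pp) Φ f = 0) ∨
      l.length ≤ Module.finrank ℝ (Submodule.span ℝ {v | v ∈ l}) := by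
    intro l
    induction l with
    | nil => exact Or.inr (by simp)
    | cons v l ih =>
      rcases ih with ih | ih
      · left
        intro Φ hΦ f hf
        rw [List.map_cons, md_cons, ← md_dif]
        exact ih _ (hΦ.dif (subLin_pp v)) f hf
      · by_cases hv : v ∈ Submodule.span ℝ {v | v ∈ l}
        · left
          intro Φ hΦ f hf
          rw [List.map_cons, md_cons, ← md_dif]
          exact md_pp_span hΦ l hv hf
        · right
          have hlt : Submodule.span ℝ {w | w ∈ l} < Submodule.span ℝ {w | w ∈ v :: l} := by
            refine lt_of_le_of_ne (Submodule.span_mono fun w hw => by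
              simp only [Set.mem_ofPred_eq, List.mem_cons]; exact Or.inr hw) fun he => hv ?_
            rw [he]
            exact Submodule.subset_span (by simp)
          have := Submodule.finrank_lt_finrank_of_lt hlt
          rw [List.length_cons]
          omega
  rcases key l with h | h
  · exact h Φ hΦ f hf
  · have := Submodule.finrank_le (Submodule.span ℝ {v | v ∈ l})
    omega

/-- Support functions of zonoids. -/
structure IsZonoid (z : E → ℝ) : Prop where
  subLin : SubLin z
  approx : ∀ ε > 0, ∃ l : List E, ∀ x, |(l.map pp).sum x - z x| ≤ ε * ‖x‖

theorem subLin_sum_pp (l : List E) : SubLin (l.map pp).sum := by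
  induction l with
  | nil => exact SubLin.zero
  | cons v l ih => rw [List.map_cons, List.sum_cons]; exact (subLin_pp v).add ih

theorem IsZonoid.dif_eq_zero {z : E → ℝ} (hz : IsZonoid z) {Φ : (E → ℝ) → ℝ} (hΦ : IsVF Φ)
    (h0 : ∀ v f, SubLin f → Dif (pp v) Φ f = 0) {f : E → ℝ} (hf : SubLin f) :
    Dif z Φ f = 0 := by
  have hl : ∀ l : List E, ∀ f, SubLin f → Φ (f + (l.map pp).sum) = Φ f := by
    intro l
    induction l with
    | nil => intro f _; simp
    | cons v l ih =>
      intro f hf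
      rw [List.map_cons, List.sum_cons, ← add_assoc, ih _ (hf.add (subLin_pp v))]
      have := h0 v f hf
      simp only [Dif] at this
      linarith
  choose l hl' using fun i : ℕ => hz.approx (1 / ((i : ℝ) + 1)) (by positivity)
  have := hΦ.cont_seq (hf.add hz.subLin) (u := fun i => f + ((l i).map pp).sum)
    (fun i => hf.add (subLin_sum_pp _)) tendsto_one_div_add_atTop_nhds_zero_nat
    (fun i x => by simpa using hl' i x)
  simp only [hl _ f hf] at this
  simp only [Dif]
  rw [tendsto_nhds_unique this tendsto_const_nhds, sub_self]

theorem md_zonoid_pp_eq_zero [FiniteDimensional ℝ E] (l₁ : List (E → ℝ))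
    (hl₁ : ∀ z ∈ l₁, IsZonoid z) (l₂ : List E)
    (hl : Module.finrank ℝ E < l₁.length + l₂.length) {Φ : (E → ℝ) → ℝ} (hΦ : IsVF Φ)
    {f : E → ℝ} (hf : SubLin f) : MD l₁ (MD (l₂.map pp) Φ) f = 0 := by
  induction l₁ generalizing l₂ f with
  | nil => exact md_pp_eq_zero l₂ (by simpa using hl) hΦ hf
  | cons z l₁ ih =>
    rw [md_cons]
    refine (hl₁ z (by simp)).dif_eq_zero
      ((hΦ.md_pp _).md fun k hk => (hl₁ k (by simp [hk])).subLin) (fun v g hg => ?_) hf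
    rw [← md_dif, ← md_cons, ← List.map_cons]
    refine ih (fun z hz => hl₁ z (by simp [hz])) (v :: l₂) ?_ hg
    simp only [List.length_cons] at hl ⊢
    omega

theorem md_zonoid_eq_zero [FiniteDimensional ℝ E] (l : List (E → ℝ))
    (hl : ∀ z ∈ l, IsZonoid z) (hn : Module.finrank ℝ E < l.length) {Φ : (E → ℝ) → ℝ}
    (hΦ : IsVF Φ) {f : E → ℝ} (hf : SubLin f) : MD l Φ f = 0 :=
  md_zonoid_pp_eq_zero l hl [] (by simpa using hn) hΦ hf

end Kinematic

namespace Kinematic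

open scoped RealInnerProductSpace

variable {E : Type*} [NormedAddCommGroup E] [InnerProductSpace ℝ E]

variable (E) in
/-- Differences of sublinear functions. -/
def DD : Submodule ℝ (E → ℝ) where
  carrier := {f | ∃ u v, SubLin u ∧ SubLin v ∧ f = u - v}
  zero_mem' := ⟨0, 0, SubLin.zero, SubLin.zero, by simp⟩
  add_mem' := by
    rintro _ _ ⟨u, v, hu, hv, rfl⟩ ⟨u', v', hu', hv', rfl⟩
    exact ⟨u + u', v + v', hu.add hu', hv.add hv', by abel⟩
  smul_mem' := by
    rintro c _ ⟨u, v, hu, hv, rfl⟩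
    rcases le_total 0 c with hc | hc
    · exact ⟨c • u, c • v, hu.const_smul hc, hv.const_smul hc, smul_sub _ _ _⟩
    · refine ⟨(-c) • v, (-c) • u, hv.const_smul (by linarith), hu.const_smul (by linarith), ?_⟩
      rw [neg_smul, neg_smul, smul_sub]; abel

theorem SubLin.mem_DD {k : E → ℝ} (hk : SubLin k) : k ∈ DD E :=
  ⟨k, 0, hk, SubLin.zero, by simp⟩

/-- A sublinear function as an element of `DD`. -/
def SubLin.dd {k : E → ℝ} (hk : SubLin k) : DD E := ⟨k, hk.mem_DD⟩

theorem DD.exists_rep (f : DD E) : ∃ v, SubLin v ∧ SubLin ((f : E → ℝ) + v) := by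
  obtain ⟨f, u, v, hu, hv, rfl⟩ := f
  exact ⟨v, hv, by simpa using hu⟩

/-- Evaluation of a formal combination of translations on a functional. -/
def ev (Φ : (E → ℝ) → ℝ) (h : E → ℝ) : AddMonoidAlgebra ℝ (DD E) →ₗ[ℝ] ℝ :=
  (Finsupp.linearCombination ℝ fun f : DD E => Φ (h + (f : E → ℝ))) ∘ₗ
    (AddMonoidAlgebra.coeffLinearEquiv ℝ).toLinearMap

/-- The formal translation by `f`. -/
def tt (f : DD E) : AddMonoidAlgebra ℝ (DD E) := AddMonoidAlgebra.single f 1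

/-- The formal difference `T_f - 1`. -/
def dl (f : DD E) : AddMonoidAlgebra ℝ (DD E) := tt f - 1

theorem ev_single (Φ : (E → ℝ) → ℝ) (h : E → ℝ) (f : DD E) (r : ℝ) :
    ev Φ h (AddMonoidAlgebra.single f r) = r * Φ (h + f) := by
  simp [ev, Finsupp.linearCombination_single]

theorem ev_one (Φ : (E → ℝ) → ℝ) (h : E → ℝ) : ev Φ h 1 = Φ h := by
  rw [AddMonoidAlgebra.one_def, ev_single]; simp

theorem ev_tt_mul (Φ : (E → ℝ) → ℝ) (h : E → ℝ) (f : DD E) (a : AddMonoidAlgebra ℝ (DD E)) :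
    ev Φ h (tt f * a) = ev Φ (h + f) a := by
  induction a using AddMonoidAlgebra.induction_linear with
  | zero => simp
  | add a b ha hb => rw [mul_add, map_add, map_add, ha, hb]
  | single g r =>
    rw [tt, AddMonoidAlgebra.single_mul_single, ev_single, ev_single, one_mul, Submodule.coe_add,
      add_assoc]

theorem tt_add (f g : DD E) : tt (f + g) = tt f * tt g := by
  rw [tt, tt, tt, AddMonoidAlgebra.single_mul_single, one_mul]

theorem tt_zero : tt (0 : DD E) = 1 := rfl

theorem dl_add (f g : DD E) : dl (f + g) = dl f + dl g + dl f * dl g := by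
  simp only [dl, tt_add]; ring

theorem dl_sub (f g : DD E) : dl (f - g) = tt (-g) * (dl f - dl g) := by
  have h1 : tt (-g) * tt g = 1 := by rw [← tt_add, neg_add_cancel, tt_zero]
  have h2 : tt (f - g) = tt (-g) * tt f := by rw [← tt_add]; congr 1; abel
  simp only [dl, h2]
  linear_combination h1

theorem ev_dl_mul (Φ : (E → ℝ) → ℝ) (h : E → ℝ) (f : DD E) (a : AddMonoidAlgebra ℝ (DD E)) :
    ev Φ h (dl f * a) = ev Φ (h + f) a - ev Φ h a := by
  rw [dl, sub_mul, map_sub, ev_tt_mul, one_mul]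

theorem ev_dif (Φ : (E → ℝ) → ℝ) (h : E → ℝ) (f : DD E) (a : AddMonoidAlgebra ℝ (DD E)) :
    ev (Dif f Φ) h a = ev Φ h (dl f * a) := by
  rw [ev_dl_mul]
  induction a using AddMonoidAlgebra.induction_linear with
  | zero => simp
  | add a b ha hb => simp only [map_add, ha, hb]; ring
  | single g r =>
    simp only [ev_single, Dif]
    rw [add_right_comm]; ring

theorem ev_prod_dl (Φ : (E → ℝ) → ℝ) (h : E → ℝ) (l : List (DD E)) :
    ev Φ h (l.map dl).prod = MD (l.map Subtype.val) Φ h := by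
  induction l generalizing Φ with
  | nil => exact ev_one Φ h
  | cons f l ih =>
    rw [List.map_cons, List.prod_cons, ← ev_dif, ih, List.map_cons, md_cons, md_dif]

/-- Formal combinations of translations vanishing eventually on all functionals in `T`. -/
def JJ (T : Set ((E → ℝ) → ℝ)) : Ideal (AddMonoidAlgebra ℝ (DD E)) where
  carrier := {a | ∃ b, SubLin b ∧ ∀ Φ ∈ T, ∀ h, SubLin h → ev Φ (h + b) a = 0}
  zero_mem' := ⟨0, SubLin.zero, by simp⟩
  add_mem' := by
    rintro a a' ⟨b, hb, H⟩ ⟨b', hb', H'⟩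
    refine ⟨b + b', hb.add hb', fun Φ hΦ h hh => ?_⟩
    rw [map_add, ← add_assoc, H' Φ hΦ _ (hh.add hb), add_right_comm, H Φ hΦ _ (hh.add hb'),
      add_zero]
  smul_mem' := by
    rintro c a ⟨b, hb, H⟩
    rw [smul_eq_mul]
    induction c using AddMonoidAlgebra.induction_linear with
    | zero => exact ⟨0, SubLin.zero, by simp⟩
    | add c c' h1 h2 =>
      obtain ⟨b, hb, H⟩ := h1
      obtain ⟨b', hb', H'⟩ := h2
      refine ⟨b + b', hb.add hb', fun Φ hΦ h hh => ?_⟩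
      rw [add_mul, map_add, ← add_assoc, H' Φ hΦ _ (hh.add hb), add_right_comm,
        H Φ hΦ _ (hh.add hb'), add_zero]
    | single f r =>
      obtain ⟨v, hv, hfv⟩ := DD.exists_rep f
      refine ⟨v + b, hv.add hb, fun Φ hΦ h hh => ?_⟩
      have : (AddMonoidAlgebra.single f r : AddMonoidAlgebra ℝ (DD E)) = r • tt f := by
        simp [tt]
      rw [this, smul_mul_assoc, LinearMap.map_smul, ev_tt_mul]
      have e : h + (v + b) + (f : E → ℝ) = (h + (f + v)) + b := by abel
      rw [e, H Φ hΦ _ (hh.add hfv), smul_zero]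

theorem mem_JJ {T : Set ((E → ℝ) → ℝ)} {a : AddMonoidAlgebra ℝ (DD E)} :
    a ∈ JJ T ↔ ∃ b, SubLin b ∧ ∀ Φ ∈ T, ∀ h, SubLin h → ev Φ (h + b) a = 0 := Iff.rfl

variable (E) in
/-- The ideal of relations valid eventually on all continuous translation invariant valuations. -/
def JV : Ideal (AddMonoidAlgebra ℝ (DD E)) := JJ {Φ | IsVF Φ}

theorem dl_mul_dl_mem (f p : DD E) (hf : ∀ x, 0 ≤ (f : E → ℝ) x) (hp : ∀ x, 0 ≤ (p : E → ℝ) x)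
    (hfp : ∀ x, (f : E → ℝ) x = 0 ∨ (p : E → ℝ) x = 0) : dl f * dl p ∈ JV E := by
  obtain ⟨v, hv, hfv⟩ := DD.exists_rep f
  obtain ⟨v', hv', hpv⟩ := DD.exists_rep p
  refine ⟨v + v', hv.add hv', fun Φ hΦ h hh => ?_⟩
  have e := hΦ.val' (h := h + (v + v') + f) (k := h + (v + v') + p) (M := h + (v + v') + f + p)
    (m := h + (v + v')) ?_ ?_ (hh.add (hv.add hv')) ?_ ?_
  · rw [← mul_one (dl p), ev_dl_mul, ev_dl_mul, ev_dl_mul, ev_one, ev_one, ev_one, ev_one]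
    linarith
  · have : h + (v + v') + (f : E → ℝ) = h + (f + v) + v' := by abel
    rw [this]; exact (hh.add hfv).add hv'
  · have : h + (v + v') + (p : E → ℝ) = h + (p + v') + v := by abel
    rw [this]; exact (hh.add hpv).add hv
  all_goals
    intro x
    have h1 := hf x
    have h2 := hp x
    simp only [Pi.add_apply]
    rcases hfp x with h0 | h0 <;> rw [h0] <;>
    first
      | exact eq_max_left' (by linarith) (by linarith)
      | exact eq_max_right' (by linarith) (by linarith)
      | exact eq_min_left' (by linarith) (by linarith)
      | exact eq_min_right' (by linarith) (by linarith)

theorem prod_dl_zonoid_mem [FiniteDimensional ℝ E] (l : List (DD E))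
    (hl : ∀ z ∈ l, IsZonoid (z : E → ℝ)) (hn : Module.finrank ℝ E < l.length) :
    (l.map dl).prod ∈ JV E := by
  refine ⟨0, SubLin.zero, fun Φ hΦ h hh => ?_⟩
  rw [add_zero, ev_prod_dl]
  refine md_zonoid_eq_zero _ (fun z hz => ?_) (by simpa using hn) hΦ hh
  obtain ⟨w, hw, rfl⟩ := List.mem_map.1 hz
  exact hl w hw

/-- Products of more than `dim E` differences of zonoids vanish. -/
theorem prod_dl_zonoid_sub_mem [FiniteDimensional ℝ E] (l : List (DD E))
    (hl : ∀ w ∈ l, ∃ z₁ z₂ : DD E, IsZonoid (z₁ : E → ℝ) ∧ IsZonoid (z₂ : E → ℝ) ∧ w = z₁ - z₂)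
    (hn : Module.finrank ℝ E < l.length) : (l.map dl).prod ∈ JV E := by
  suffices H : ∀ (l l' : List (DD E)), (∀ w ∈ l, ∃ z₁ z₂ : DD E, IsZonoid (z₁ : E → ℝ) ∧
      IsZonoid (z₂ : E → ℝ) ∧ w = z₁ - z₂) → (∀ z ∈ l', IsZonoid (z : E → ℝ)) →
      Module.finrank ℝ E < l.length + l'.length → (l.map dl).prod * (l'.map dl).prod ∈ JV E by
    simpa using H l [] hl (by simp) (by simpa using hn)
  intro l
  induction l with
  | nil =>
    intro l' _ h2 h3
    simpa using prod_dl_zonoid_mem l' h2 (by simpa using h3)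
  | cons w l ih =>
    intro l' h1 h2 h3
    obtain ⟨z₁, z₂, hz₁, hz₂, rfl⟩ := h1 w (by simp)
    have A : ∀ z : DD E, IsZonoid (z : E → ℝ) →
        (l.map dl).prod * (dl z * (l'.map dl).prod) ∈ JV E := fun z hz => by
      have := ih (z :: l') (fun w hw => h1 w (by simp [hw])) (by simpa [hz] using h2)
        (by simp only [List.length_cons] at h3 ⊢; omega)
      simpa using this
    have := (JV E).mul_mem_left (tt (-z₂)) ((JV E).sub_mem (A z₁ hz₁) (A z₂ hz₂))
    rw [List.map_cons, List.prod_cons, dl_sub]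
    convert this using 1
    ring

end Kinematic

namespace Kinematic

open scoped RealInnerProductSpace

variable {E : Type*} [NormedAddCommGroup E] [InnerProductSpace ℝ E]

/-- The positively `1`-homogeneous extension of the restriction of `u` to the unit sphere. -/
def HH (u : E → ℝ) : E → ℝ := fun x => ‖x‖ * u (‖x‖⁻¹ • x)

theorem HH_zero_apply (u : E → ℝ) : HH u 0 = 0 := by simp [HH]

theorem HH_smul_apply (u : E → ℝ) {t : ℝ} (ht : 0 ≤ t) (x : E) : HH u (t • x) = t * HH u x := by
  rcases ht.eq_or_lt with rfl | ht
  · simp [HH]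
  · simp only [HH, norm_smul, Real.norm_of_nonneg ht.le, smul_smul]
    rw [mul_inv, mul_assoc, mul_right_comm, inv_mul_cancel₀ ht.ne', one_mul]

theorem norm_inv_smul_self {x : E} (hx : x ≠ 0) : ‖‖x‖⁻¹ • x‖ = 1 := by
  rw [norm_smul, norm_inv, norm_norm, inv_mul_cancel₀ (norm_ne_zero_iff.2 hx)]

theorem norm_smul_inv_smul {x : E} (hx : x ≠ 0) : ‖x‖ • ‖x‖⁻¹ • x = x := by
  rw [smul_smul, mul_inv_cancel₀ (norm_ne_zero_iff.2 hx), one_smul]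

/-- A homogeneous function agrees with `HH` of itself. -/
theorem HH_eq_self {f : E → ℝ} (hf : ∀ t : ℝ, 0 ≤ t → ∀ x, f (t • x) = t * f x) : HH f = f := by
  ext x
  rcases eq_or_ne x 0 with rfl | hx
  · rw [HH_zero_apply]; simpa using (hf 0 le_rfl 0).symm
  · rw [HH, hf _ (by positivity), mul_inv_cancel_left₀ (norm_ne_zero_iff.2 hx)]

theorem HH_congr {u v : E → ℝ} (h : ∀ x, ‖x‖ = 1 → u x = v x) : HH u = HH v := by
  ext x
  rcases eq_or_ne x 0 with rfl | hx
  · simp [HH]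
  · rw [HH, HH, h _ (norm_inv_smul_self hx)]

theorem HH_add (u v : E → ℝ) : HH (u + v) = HH u + HH v := by ext x; simp [HH, mul_add]

theorem HH_sub (u v : E → ℝ) : HH (u - v) = HH u - HH v := by ext x; simp [HH, mul_sub]

theorem HH_smul (c : ℝ) (u : E → ℝ) : HH (c • u) = c • HH u := by
  ext x; simp [HH]; ring

theorem subLin_norm_add_of_quadratic {u : E → ℝ} {du : E → E →L[ℝ] ℝ} {B M : ℝ} (hM : 0 ≤ M)
    (hu : ∀ p, ‖p‖ = 1 → |u p| ≤ B) (hdu : ∀ p, ‖p‖ = 1 → ‖du p‖ ≤ B)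
    (hq : ∀ p q, ‖p‖ = 1 → ‖q‖ = 1 → |u q - u p - du p (q - p)| ≤ M * ‖q - p‖ ^ 2) :
    SubLin (fun x => 2 * (M + B) * ‖x‖ + HH u x) where
  smul t ht x := by
    rw [HH_smul_apply u ht, norm_smul, Real.norm_of_nonneg ht]; ring
  add_le x y := by
    have hB : 0 ≤ B ∨ ∀ z : E, z = 0 := by
      by_cases h : ∃ z : E, z ≠ 0
      · obtain ⟨z, hz⟩ := h
        exact Or.inl ((abs_nonneg _).trans (hu _ (norm_inv_smul_self hz)))
      · exact Or.inr (by simpa using h)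
    rcases hB with hB | hB
    swap
    · simp [hB x, hB y, HH]
    rcases eq_or_ne (x + y) 0 with hz | hz
    · rw [hz, HH_zero_apply, norm_zero]
      have key : ∀ x : E, 0 ≤ 2 * (M + B) * ‖x‖ + HH u x := by
        intro x
        rcases eq_or_ne x 0 with rfl | hx
        · simp [HH]
        · have := (abs_le.1 (hu _ (norm_inv_smul_self hx))).1
          simp only [HH]
          nlinarith [norm_nonneg x, mul_nonneg hM (norm_nonneg x),
            mul_le_mul_of_nonneg_left this (norm_nonneg x), mul_nonneg hB (norm_nonneg x)]
      linarith [key x, key y]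
    · set p := ‖x + y‖⁻¹ • (x + y) with hp
      have hp1 : ‖p‖ = 1 := norm_inv_smul_self hz
      set ℓ : E → ℝ := fun q => du p q + (u p - du p p) * ⟪p, q⟫ with hℓ
      have sph : ∀ q, ‖q‖ = 1 → |u q - ℓ q| ≤ (M + B) * ‖q - p‖ ^ 2 := by
        intro q hq1
        have h1 := hq p q hp1 hq1
        have h2 : ‖q - p‖ ^ 2 = 2 - 2 * ⟪p, q⟫ := by
          rw [norm_sub_sq_real, hq1, hp1, real_inner_comm]; ring
        have h3 : |u p - du p p| ≤ 2 * B := by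
          have a1 := hu p hp1
          have a2 : |du p p| ≤ B := by
            have := (du p).le_opNorm p
            rw [hp1, mul_one, Real.norm_eq_abs] at this
            exact this.trans (hdu p hp1)
          calc _ ≤ |u p| + |du p p| := abs_sub _ _
            _ ≤ _ := by linarith
        have h4 : u q - ℓ q = (u q - u p - du p (q - p)) + (u p - du p p) * (‖q - p‖ ^ 2 / 2) := by
          rw [h2, hℓ, map_sub]; ring
        rw [h4]
        refine (abs_add_le _ _).trans ?_
        rw [abs_mul, abs_of_nonneg (by positivity : 0 ≤ ‖q - p‖ ^ 2 / 2)]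
        have := mul_le_mul_of_nonneg_right h3 (by positivity : 0 ≤ ‖q - p‖ ^ 2 / 2)
        linarith
      have hom : ∀ x : E, |HH u x - ℓ x| ≤ (M + B) * (2 * ‖x‖ - 2 * ⟪p, x⟫) := by
        intro x
        rcases eq_or_ne x 0 with rfl | hx
        · simp [HH, hℓ]
        · have h1 := sph _ (norm_inv_smul_self hx)
          have h2 : ‖‖x‖⁻¹ • x - p‖ ^ 2 = 2 - 2 * ⟪p, ‖x‖⁻¹ • x⟫ := by
            rw [norm_sub_sq_real, norm_inv_smul_self hx, hp1, real_inner_comm]; ring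
          have h3 : HH u x - ℓ x = ‖x‖ * (u (‖x‖⁻¹ • x) - ℓ (‖x‖⁻¹ • x)) := by
            have : ℓ x = ‖x‖ * ℓ (‖x‖⁻¹ • x) := by
              conv_lhs => rw [← norm_smul_inv_smul hx]
              simp only [hℓ, map_smul, inner_smul_right, smul_eq_mul]; ring
            rw [this, HH]; ring
          have h4 : ⟪p, x⟫ = ‖x‖ * ⟪p, ‖x‖⁻¹ • x⟫ := by
            conv_lhs => rw [← norm_smul_inv_smul hx]
            rw [inner_smul_right]
          rw [h3, abs_mul, abs_of_nonneg (norm_nonneg x), h4]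
          rw [h2] at h1
          have := mul_le_mul_of_nonneg_left h1 (norm_nonneg x)
          linarith
      have hzz : HH u (x + y) = ℓ (x + y) := by
        have h1 : ℓ (x + y) = ‖x + y‖ * ℓ p := by
          conv_lhs => rw [← norm_smul_inv_smul hz]
          simp only [hℓ, map_smul, inner_smul_right, smul_eq_mul, ← hp]; ring
        rw [h1, hℓ, HH, ← hp]
        simp only [real_inner_self_eq_norm_sq, hp1]; ring
      have hip : ⟪p, x⟫ + ⟪p, y⟫ = ‖x + y‖ := by
        rw [← inner_add_right, hp, real_inner_smul_left, real_inner_self_eq_norm_sq]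
        have := norm_ne_zero_iff.2 hz
        field_simp
      have hadd : ℓ (x + y) = ℓ x + ℓ y := by
        simp only [hℓ, map_add, inner_add_right]; ring
      have hx := (abs_le.1 (hom x)).1
      have hy := (abs_le.1 (hom y)).1
      rw [hzz, hadd, ← hip]
      nlinarith

/-- Bounds for the derivatives up to order `m` on the closed unit ball. -/
def CB (m : ℕ) (u : E → ℝ) (B : ℝ) : Prop :=
  ∀ i ≤ m, ∀ x ∈ Metric.closedBall (0 : E) 1, ‖iteratedFDeriv ℝ i u x‖ ≤ B

theorem CB.nonneg {m : ℕ} {u : E → ℝ} {B : ℝ} (h : CB m u B) : 0 ≤ B :=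
  (norm_nonneg _).trans (h 0 (Nat.zero_le _) 0 (by simp))

theorem CB.abs_le {m : ℕ} {u : E → ℝ} {B : ℝ} (h : CB m u B) {x : E} (hx : ‖x‖ ≤ 1) :
    |u x| ≤ B := by
  simpa using h 0 (Nat.zero_le _) x (by simpa using hx)

theorem CB.mono {m m' : ℕ} (hm : m ≤ m') {u : E → ℝ} {B B' : ℝ} (hB : B ≤ B') (h : CB m' u B) :
    CB m u B' := fun i hi x hx => (h i (hi.trans hm) x hx).trans hB

theorem CB.abs_HH_le {m : ℕ} {u : E → ℝ} {B : ℝ} (h : CB m u B) (x : E) : |HH u x| ≤ B * ‖x‖ := by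
  rcases eq_or_ne x 0 with rfl | hx
  · simp [HH]
  · rw [HH, abs_mul, abs_norm, mul_comm]
    exact mul_le_mul_of_nonneg_right (h.abs_le (norm_inv_smul_self hx).le) (norm_nonneg _)

theorem subLin_norm_add_HH {u : E → ℝ} {B : ℝ} (hu : ContDiff ℝ 2 u) (hB : CB 2 u B) :
    SubLin (fun x => 4 * B * ‖x‖ + HH u x) := by
  have hd1 : ∀ x ∈ Metric.closedBall (0 : E) 1, ‖fderiv ℝ u x‖ ≤ B := fun x hx => by
    rw [← norm_iteratedFDeriv_one]; exact hB 1 (by norm_num) x hx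
  have hd2 : ∀ x ∈ Metric.closedBall (0 : E) 1, ‖fderiv ℝ (fderiv ℝ u) x‖ ≤ B := fun x hx => by
    rw [← norm_iteratedFDeriv_one, norm_iteratedFDeriv_fderiv]; exact hB 2 le_rfl x hx
  have hu1 : Differentiable ℝ u := hu.differentiable (by norm_num)
  have hu2 : Differentiable ℝ (fderiv ℝ u) :=
    (hu.fderiv_right (m := 1) (by norm_num)).differentiable (by norm_num)
  have hconv := convex_closedBall (0 : E) 1
  have lip : ∀ p q : E, p ∈ Metric.closedBall (0 : E) 1 → q ∈ Metric.closedBall (0 : E) 1 →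
      ‖fderiv ℝ u q - fderiv ℝ u p‖ ≤ B * ‖q - p‖ := fun p q hp hq =>
    hconv.norm_image_sub_le_of_norm_fderiv_le (fun x _ => hu2 x) hd2 hp hq
  have := subLin_norm_add_of_quadratic (u := u) (du := fderiv ℝ u) (B := B) (M := B) hB.nonneg
    (fun p hp => hB.abs_le hp.le) (fun p hp => hd1 p (by simp [hp])) ?_
  · convert this using 3; ring
  · intro p q hp hq
    have hp' : p ∈ Metric.closedBall (0 : E) 1 := by simp [hp]
    have hq' : q ∈ Metric.closedBall (0 : E) 1 := by simp [hq]
    have hs : segment ℝ p q ⊆ Metric.closedBall (0 : E) 1 := hconv.segment_subset hp' hq'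
    have := (convex_segment p q).norm_image_sub_le_of_norm_hasFDerivWithin_le
      (f := fun x => u x - fderiv ℝ u p x) (f' := fun x => fderiv ℝ u x - fderiv ℝ u p)
      (C := B * ‖q - p‖) (fun x hx => ((hu1 x).hasFDerivAt.sub
        (fderiv ℝ u p).hasFDerivAt).hasFDerivWithinAt) ?_ (left_mem_segment ℝ p q)
      (right_mem_segment ℝ p q)
    · rw [Real.norm_eq_abs] at this
      convert this using 1
      · rw [map_sub]; congr 1; ring
      · ring
    · intro x hx
      refine (lip p x hp' (hs hx)).trans (mul_le_mul_of_nonneg_left ?_ hB.nonneg)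
      exact norm_sub_le_of_mem_segment hx

theorem HH_mem_DD {u : E → ℝ} {B : ℝ} (hu : ContDiff ℝ 2 u) (hB : CB 2 u B) : HH u ∈ DD E := by
  refine ⟨_, (4 * B) • fun x : E => ‖x‖, subLin_norm_add_HH hu hB,
    SubLin.norm.const_smul (by have := hB.nonneg; positivity), ?_⟩
  ext x; simp

theorem exists_CB [FiniteDimensional ℝ E] {m : ℕ} {u : E → ℝ} (hu : ContDiff ℝ m u) :
    ∃ B, CB m u B := by
  have : ∀ i ≤ m, ∃ B, ∀ x ∈ Metric.closedBall (0 : E) 1, ‖iteratedFDeriv ℝ i u x‖ ≤ B := by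
    intro i hi
    exact (isCompact_closedBall (0 : E) 1).exists_bound_of_continuousOn
      (hu.continuous_iteratedFDeriv (by exact_mod_cast hi)).continuousOn
  choose! B hB using this
  refine ⟨∑ i ∈ Finset.range (m + 1), |B i|, fun i hi x hx => (hB i hi x hx).trans ?_⟩
  exact (le_abs_self _).trans (Finset.single_le_sum (f := fun i => |B i|)
    (fun _ _ => abs_nonneg _) (Finset.mem_range.2 (by omega)))

theorem contDiff_HH_mem_DD [FiniteDimensional ℝ E] {u : E → ℝ} (hu : ContDiff ℝ 2 u) :
    HH u ∈ DD E := by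
  obtain ⟨B, hB⟩ := exists_CB (m := 2) hu
  exact Kinematic.HH_mem_DD hu hB

end Kinematic

namespace Kinematic

open scoped RealInnerProductSpace

variable {E : Type*} [NormedAddCommGroup E] [InnerProductSpace ℝ E]

theorem abs_pp_sub_le (v w x : E) : |pp v x - pp w x| ≤ ‖v - w‖ * ‖x‖ := by
  refine (abs_max_sub_max_le_abs _ _ _).trans ?_
  rw [← inner_sub_left]
  exact abs_real_inner_le_norm _ _

theorem pp_smul {c : ℝ} (hc : 0 ≤ c) (v : E) : pp (c • v) = c • pp v := by
  ext x
  simp only [pp, Pi.smul_apply, smul_eq_mul, real_inner_smul_left]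
  rw [mul_max_of_nonneg _ _ hc, mul_zero]

/-- The restriction of `pp v` to the unit sphere as a continuous function. -/
def ppC (v : E) : C(Metric.sphere (0 : E) 1, ℝ) :=
  ⟨fun x => pp v x, by unfold pp; fun_prop⟩

theorem sum_ppC_apply (l : List E) (x : Metric.sphere (0 : E) 1) :
    (l.map ppC).sum x = (l.map pp).sum x := by
  induction l with
  | nil => simp
  | cons a l ih =>
    rw [List.map_cons, List.sum_cons, List.map_cons, List.sum_cons, Pi.add_apply, ← ih]
    rfl

instance [FiniteDimensional ℝ E] : CompactSpace (Metric.sphere (0 : E) 1) :=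
  isCompact_iff_compactSpace.1 (isCompact_sphere _ _)

theorem dist_ppC_le [FiniteDimensional ℝ E] (v w : E) : dist (ppC v) (ppC w) ≤ ‖v - w‖ :=
  (ContinuousMap.dist_le (norm_nonneg _)).2 fun x => by
    have := abs_pp_sub_le v w x
    rw [norm_eq_of_mem_sphere x, mul_one] at this
    exact this

theorem continuous_ppC [FiniteDimensional ℝ E] :
    Continuous (ppC : E → C(Metric.sphere (0 : E) 1, ℝ)) :=
  (LipschitzWith.of_dist_le_mul (K := 1) fun v w => by
    rw [NNReal.coe_one, one_mul, dist_eq_norm v w]; exact dist_ppC_le v w).continuous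

theorem isZonoid_integral [FiniteDimensional ℝ E] [MeasurableSpace E] [BorelSpace E] {Ω : Type*}
    [MeasurableSpace Ω] {μ : Measure Ω} {V : Ω → E} (hV : Integrable V μ) :
    IsZonoid (fun x => ∫ ω, pp (V ω) x ∂μ) := by
  have hint : ∀ x, Integrable (fun ω => pp (V ω) x) μ := fun x => by
    refine (hV.norm.mul_const ‖x‖).mono' ?_ (.of_forall fun ω => ?_)
    · have : Continuous fun v : E => pp v x := by unfold pp; fun_prop
      exact this.comp_aestronglyMeasurable hV.1
    · have := abs_pp_sub_le (V ω) 0 x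
      simpa [pp_zero] using this
  have hsub : SubLin (fun x => ∫ ω, pp (V ω) x ∂μ) := by
    refine ⟨fun x y => ?_, fun t ht x => ?_⟩
    · rw [← integral_add (hint x) (hint y)]
      exact integral_mono (hint _) ((hint x).add (hint y)) fun ω => (subLin_pp _).add_le x y
    · rw [← integral_const_mul]
      exact integral_congr_ae (.of_forall fun ω => (subLin_pp _).smul t ht x)
  refine ⟨hsub, fun ε hε => ?_⟩
  have hF : Integrable (fun ω => ppC (V ω)) μ := by
    refine hV.norm.mono' (continuous_ppC.comp_aestronglyMeasurable hV.1) (.of_forall fun ω => ?_)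
    have := dist_ppC_le (V ω) 0
    have h0 : ppC (0 : E) = 0 := by ext x; simp [ppC, pp_zero]
    simpa [h0, dist_eq_norm] using this
  set A : Set C(Metric.sphere (0 : E) 1, ℝ) := {g | ∃ l : List E, (l.map ppC).sum = g} with hA
  have hAsm : ∀ g ∈ A, ∀ c : ℝ, 0 ≤ c → c • g ∈ A := by
    rintro _ ⟨l, rfl⟩ c hc
    refine ⟨l.map (c • ·), ?_⟩
    rw [List.smul_sum, List.map_map, List.map_map]
    congr 2
    ext v x
    simp [ppC, pp_smul hc]
  have hAadd : ∀ g ∈ A, ∀ g' ∈ A, g + g' ∈ A := by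
    rintro _ ⟨l, rfl⟩ _ ⟨l', rfl⟩
    exact ⟨l ++ l', by simp⟩
  have hAc : Convex ℝ A := fun g hg g' hg' a b ha hb _ => hAadd _ (hAsm g hg a ha) _ (hAsm g' hg' b hb)
  have hmem : ∫ ω, ppC (V ω) ∂μ ∈ closure A := by
    by_contra hn
    obtain ⟨f, u, hfu, hux⟩ := geometric_hahn_banach_closed_point hAc.closure isClosed_closure hn
    have h0 : 0 < u := by
      have := hfu 0 (subset_closure ⟨[], rfl⟩)
      simpa using this
    have hneg : ∀ g ∈ A, f g ≤ 0 := by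
      intro g hg
      by_contra! hpos
      have := hfu _ (subset_closure (hAsm g hg (u / f g) (by positivity)))
      rw [map_smul, smul_eq_mul, div_mul_cancel₀ _ hpos.ne'] at this
      exact lt_irrefl _ this
    rw [← f.integral_comp_comm hF] at hux
    have : ∫ ω, f (ppC (V ω)) ∂μ ≤ 0 :=
      integral_nonpos fun ω => hneg _ ⟨[V ω], by simp⟩
    linarith
  obtain ⟨_, ⟨l, rfl⟩, hl⟩ := Metric.mem_closure_iff.1 hmem ε hε
  refine ⟨l, fun x => ?_⟩
  have key : ∀ x : Metric.sphere (0 : E) 1,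
      |(l.map pp).sum x - ∫ ω, pp (V ω) x ∂μ| ≤ ε := fun x => by
    have h1 := (ContinuousMap.dist_apply_le_dist x).trans hl.le
    rw [dist_comm, Real.dist_eq, ContinuousMap.integral_apply hF, sum_ppC_apply] at h1
    exact h1
  rcases eq_or_ne x 0 with rfl | hx
  · rw [(subLin_sum_pp l).map_zero, hsub.map_zero]; simp
  · have h1 := key ⟨‖x‖⁻¹ • x, by simpa using norm_inv_smul_self hx⟩
    have e1 := (subLin_sum_pp l).smul _ (norm_nonneg x) (‖x‖⁻¹ • x)
    have e2 := hsub.smul _ (norm_nonneg x) (‖x‖⁻¹ • x)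
    rw [norm_smul_inv_smul hx] at e1 e2
    rw [e1, e2, ← mul_sub, abs_mul, abs_norm, mul_comm]
    exact mul_le_mul_of_nonneg_right h1 (norm_nonneg _)

end Kinematic

namespace Kinematic

open scoped RealInnerProductSpace

theorem integral_taylor_of_nonneg {g g' g'' : ℝ → ℝ} (h1 : ∀ t, HasDerivAt g (g' t) t)
    (h2 : ∀ t, HasDerivAt g' (g'' t) t) (hc : Continuous g'') {r t : ℝ} (ht : 0 ≤ t)
    (htr : t ≤ 2 * r) :
    ∫ τ in (0 : ℝ)..2, r * g'' (r * τ) * max (t - r * τ) 0 = g t - g 0 - g' 0 * t := by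
  have e1 : ∫ τ in (0 : ℝ)..2, r * g'' (r * τ) * max (t - r * τ) 0
      = ∫ c in (r * 0)..(r * 2), g'' c * max (t - c) 0 := by
    rw [← intervalIntegral.mul_integral_comp_mul_left, ← intervalIntegral.integral_const_mul]
    simp only [mul_assoc]
  have hcont : Continuous fun c => g'' c * max (t - c) 0 := by fun_prop
  rw [e1, mul_zero, ← intervalIntegral.integral_add_adjacent_intervals
    (hcont.intervalIntegrable 0 t) (hcont.intervalIntegrable t (r * 2))]
  have e2 : ∫ c in t..(r * 2), g'' c * max (t - c) 0 = ∫ c in t..(r * 2), (0 : ℝ) := by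
    refine intervalIntegral.integral_congr fun c hc => ?_
    rw [Set.uIcc_of_le (by linarith)] at hc
    have : max (t - c) 0 = 0 := max_eq_right (by linarith [hc.1])
    simp [this]
  have e3 : ∫ c in (0 : ℝ)..t, g'' c * max (t - c) 0 = ∫ c in (0 : ℝ)..t, g'' c * (t - c) := by
    refine intervalIntegral.integral_congr fun c hc => ?_
    rw [Set.uIcc_of_le ht] at hc
    have : max (t - c) 0 = t - c := max_eq_left (by linarith [hc.2])
    simp [this]
  have e4 : ∫ c in (0 : ℝ)..t, g'' c * (t - c) = (g' t * (t - t) + g t) - (g' 0 * (t - 0) + g 0) := by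
    refine intervalIntegral.integral_eq_sub_of_hasDerivAt (f := fun c => g' c * (t - c) + g c)
      (fun c _ => ?_) (Continuous.intervalIntegrable (by fun_prop) _ _)
    have := ((h2 c).mul ((hasDerivAt_id c).const_sub t)).add (h1 c)
    have e : g'' c * (t - id c) + g' c * -1 + g' c = g'' c * (t - c) := by simp only [id]; ring
    rw [e] at this
    exact this
  rw [e2, e3, e4, intervalIntegral.integral_zero]
  ring

theorem integral_taylor_of_nonpos {g'' : ℝ → ℝ} {r t : ℝ} (hr : 0 ≤ r) (ht : t ≤ 0) :
    ∫ τ in (0 : ℝ)..2, r * g'' (r * τ) * max (t - r * τ) 0 = 0 := by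
  have : ∫ τ in (0 : ℝ)..2, r * g'' (r * τ) * max (t - r * τ) 0 = ∫ τ in (0 : ℝ)..2, (0 : ℝ) := by
    refine intervalIntegral.integral_congr fun c hc => ?_
    rw [Set.uIcc_of_le (by norm_num)] at hc
    have : max (t - r * c) 0 = 0 := max_eq_right (by nlinarith [hc.1])
    simp [this]
  simpa using this

/-- Second-order Taylor expansion with a kernel made of truncated linear functions. -/
theorem taylor_kernel {g g' g'' : ℝ → ℝ} (h1 : ∀ t, HasDerivAt g (g' t) t)
    (h2 : ∀ t, HasDerivAt g' (g'' t) t) (hc : Continuous g'') {r t : ℝ} (hr : 0 ≤ r)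
    (ht : |t| ≤ 2 * r) :
    g t = g 0 + g' 0 * t + (∫ τ in (0 : ℝ)..2, r * g'' (r * τ) * max (t - r * τ) 0) +
      ∫ τ in (0 : ℝ)..2, r * g'' (-(r * τ)) * max (-t - r * τ) 0 := by
  obtain ⟨ht1, ht2⟩ := abs_le.1 ht
  rcases le_total 0 t with h0 | h0
  · rw [integral_taylor_of_nonneg h1 h2 hc h0 ht2,
      integral_taylor_of_nonpos (g'' := fun c => g'' (-c)) hr (by linarith : -t ≤ 0)]
    ring
  · rw [integral_taylor_of_nonpos hr h0]
    have := integral_taylor_of_nonneg (g := fun c => g (-c)) (g' := fun c => -g' (-c))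
      (g'' := fun c => g'' (-c)) (r := r) (t := -t)
      (fun c => by have := (h1 (-c)).comp c (hasDerivAt_neg c); rw [mul_neg_one] at this; exact this)
      (fun c => by
        have := ((h2 (-c)).comp c (hasDerivAt_neg c)).neg
        rw [mul_neg_one, neg_neg] at this; exact this)
      (by fun_prop) (by linarith) (by linarith)
    rw [this]
    simp

variable {E : Type*} [NormedAddCommGroup E] [InnerProductSpace ℝ E]

/-- Differences of support functions of zonoids. -/
def IsZD (w : E → ℝ) : Prop := ∃ z₁ z₂, IsZonoid z₁ ∧ IsZonoid z₂ ∧ w = z₁ - z₂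

theorem IsZonoid.add {z₁ z₂ : E → ℝ} (h₁ : IsZonoid z₁) (h₂ : IsZonoid z₂) :
    IsZonoid (z₁ + z₂) := by
  refine ⟨h₁.subLin.add h₂.subLin, fun ε hε => ?_⟩
  obtain ⟨l₁, hl₁⟩ := h₁.approx (ε / 2) (by positivity)
  obtain ⟨l₂, hl₂⟩ := h₂.approx (ε / 2) (by positivity)
  refine ⟨l₁ ++ l₂, fun x => ?_⟩
  rw [List.map_append, List.sum_append]
  have := abs_add_le ((l₁.map pp).sum x - z₁ x) ((l₂.map pp).sum x - z₂ x)
  simp only [Pi.add_apply]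
  rw [add_sub_add_comm]
  linarith [hl₁ x, hl₂ x]

theorem isZonoid_pp (v : E) : IsZonoid (pp v) :=
  ⟨subLin_pp v, fun ε hε => ⟨[v], fun x => by simpa using by positivity⟩⟩

theorem IsZD.add {w₁ w₂ : E → ℝ} (h₁ : IsZD w₁) (h₂ : IsZD w₂) : IsZD (w₁ + w₂) := by
  obtain ⟨a, b, ha, hb, rfl⟩ := h₁
  obtain ⟨c, d, hc, hd, rfl⟩ := h₂
  exact ⟨a + c, b + d, ha.add hc, hb.add hd, by ext x; simp; ring⟩

theorem isZD_linear (v : E) : IsZD (fun x => ⟪v, x⟫) := by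
  refine ⟨_, _, isZonoid_pp v, isZonoid_pp (-v), ?_⟩
  ext x
  simp only [pp, Pi.sub_apply, inner_neg_left]
  rcases le_total 0 ⟪v, x⟫ with h | h
  · rw [max_eq_left h, max_eq_right (by linarith)]; ring
  · rw [max_eq_right h, max_eq_left (by linarith)]; ring

theorem isZD_integral [FiniteDimensional ℝ E] [MeasurableSpace E] [BorelSpace E] {Ω : Type*}
    [MeasurableSpace Ω] {μ : Measure Ω} {κ : Ω → ℝ} {V : Ω → E}
    (hV : Integrable (fun ω => κ ω • V ω) μ) (hκ : AEStronglyMeasurable κ μ)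
    (hV' : AEStronglyMeasurable V μ) :
    IsZD (fun x => ∫ ω, κ ω * pp (V ω) x ∂μ) := by
  have h1 : Integrable (fun ω => max (κ ω) 0 • V ω) μ := by
    refine hV.norm.mono' (AEStronglyMeasurable.smul ?_ hV') (.of_forall fun ω => ?_)
    · exact (continuous_id.max continuous_const).comp_aestronglyMeasurable hκ
    · rw [norm_smul, norm_smul, Real.norm_eq_abs, Real.norm_eq_abs, abs_of_nonneg (le_max_right _ _)]
      exact mul_le_mul_of_nonneg_right (max_le (le_abs_self _) (abs_nonneg _)) (norm_nonneg _)
  have h2 : Integrable (fun ω => max (-κ ω) 0 • V ω) μ := by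
    refine hV.norm.mono' (AEStronglyMeasurable.smul ?_ hV') (.of_forall fun ω => ?_)
    · exact (continuous_neg.max continuous_const).comp_aestronglyMeasurable hκ
    · rw [norm_smul, norm_smul, Real.norm_eq_abs, Real.norm_eq_abs, abs_of_nonneg (le_max_right _ _)]
      exact mul_le_mul_of_nonneg_right (max_le (neg_le_abs _) (abs_nonneg _)) (norm_nonneg _)
  have hint : ∀ {W : Ω → E}, Integrable W μ → ∀ x, Integrable (fun ω => pp (W ω) x) μ :=
    fun {W} hW x => by
    refine (hW.norm.mul_const ‖x‖).mono' ?_ (.of_forall fun ω => ?_)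
    · have : Continuous fun v : E => pp v x := by unfold pp; fun_prop
      exact this.comp_aestronglyMeasurable hW.1
    · have := abs_pp_sub_le (W ω) 0 x
      simpa [pp_zero] using this
  refine ⟨_, _, isZonoid_integral h1, isZonoid_integral h2, ?_⟩
  ext x
  simp only [Pi.sub_apply]
  rw [← integral_sub (hint h1 x) (hint h2 x)]
  refine integral_congr_ae (.of_forall fun ω => ?_)
  simp only [pp_smul (le_max_right _ _), Pi.smul_apply, smul_eq_mul]
  rw [← sub_mul]
  congr 1
  rcases le_total 0 (κ ω) with h | h
  · rw [max_eq_left h, max_eq_right (by linarith)]; ring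
  · rw [max_eq_right h, max_eq_left (by linarith)]; ring

end Kinematic

namespace Kinematic

open scoped RealInnerProductSpace

variable {E : Type*} [NormedAddCommGroup E] [InnerProductSpace ℝ E]

theorem integrable_mul_pp [MeasurableSpace E] [BorelSpace E] [FiniteDimensional ℝ E] {Ω : Type*}
    [MeasurableSpace Ω] {μ : Measure Ω} {κ : Ω → ℝ} {V : Ω → E}
    (hV : Integrable (fun ω => κ ω • V ω) μ) (hκ : AEStronglyMeasurable κ μ)
    (hV' : AEStronglyMeasurable V μ) (x : E) : Integrable (fun ω => κ ω * pp (V ω) x) μ := by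
  refine (hV.norm.mul_const ‖x‖).mono' (hκ.mul ?_) (.of_forall fun ω => ?_)
  · have : Continuous fun v : E => pp v x := by unfold pp; fun_prop
    exact this.comp_aestronglyMeasurable hV'
  · have := abs_pp_sub_le (V ω) 0 x
    rw [pp_zero, Pi.zero_apply, sub_zero, sub_zero] at this
    rw [norm_mul, norm_smul, mul_assoc]
    exact mul_le_mul_of_nonneg_left this (norm_nonneg _)

theorem mul_max_sub_eq_pp {s : ℝ} (hs : 0 < s) (ξ e x : E) (c : ℝ) (he : ⟪x, e⟫ = s) :
    s * max (⟪ξ, s⁻¹ • x⟫ - c) 0 = pp (ξ - c • e) x := by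
  rw [pp, mul_max_of_nonneg _ _ hs.le, mul_zero, inner_sub_left, real_inner_smul_left,
    real_inner_comm x e, he, inner_smul_right, mul_sub, mul_inv_cancel_left₀ hs.ne', mul_comm s c]

theorem exists_isZD_of_fourier [MeasurableSpace E] [BorelSpace E] [FiniteDimensional ℝ E]
    {a : E → ℂ} (ha : Continuous a)
    (hint : Integrable (fun ξ => (1 + ‖ξ‖) ^ 2 * ‖a ξ‖)) {e : E} (he : ‖e‖ = 1) :
    ∃ w : E → ℝ, IsZD w ∧ ∀ x : E, 0 < ⟪x, e⟫ → ‖x‖ ≤ 2 * ⟪x, e⟫ → w x = ⟪x, e⟫ *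
      (∫ ξ, Complex.exp ((2 * Real.pi * ⟪ξ, ⟪x, e⟫⁻¹ • x⟫ : ℝ) * Complex.I) • a ξ).re := by
  set g : E → ℝ → ℝ := fun ξ t =>
    (a ξ).re * Real.cos (2 * Real.pi * t) - (a ξ).im * Real.sin (2 * Real.pi * t) with hg
  set g' : E → ℝ → ℝ := fun ξ t =>
    -(2 * Real.pi) * ((a ξ).re * Real.sin (2 * Real.pi * t) + (a ξ).im * Real.cos (2 * Real.pi * t))
    with hg'
  set g'' : E → ℝ → ℝ := fun ξ t => -(2 * Real.pi) ^ 2 * g ξ t with hg''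
  have h1 : ∀ ξ t, HasDerivAt (g ξ) (g' ξ t) t := fun ξ t => by
    have hl : HasDerivAt (fun t : ℝ => 2 * Real.pi * t) (2 * Real.pi * 1) t :=
      (hasDerivAt_id t).const_mul _
    have := (hl.cos.const_mul (a ξ).re).sub (hl.sin.const_mul (a ξ).im)
    refine this.congr_deriv ?_
    simp only [hg']; ring
  have h2 : ∀ ξ t, HasDerivAt (g' ξ) (g'' ξ t) t := fun ξ t => by
    have hl : HasDerivAt (fun t : ℝ => 2 * Real.pi * t) (2 * Real.pi * 1) t :=
      (hasDerivAt_id t).const_mul _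
    have := ((hl.sin.const_mul (a ξ).re).add (hl.cos.const_mul (a ξ).im)).const_mul
      (-(2 * Real.pi))
    refine this.congr_deriv ?_
    simp only [hg'', hg]; ring
  have hre : Continuous fun ξ => (a ξ).re := Complex.continuous_re.comp ha
  have him : Continuous fun ξ => (a ξ).im := Complex.continuous_im.comp ha
  have hgc : Continuous fun p : E × ℝ => g p.1 p.2 := by
    simp only [hg]
    exact ((hre.comp continuous_fst).mul (by fun_prop)).sub
      ((him.comp continuous_fst).mul (by fun_prop))
  have hgc'' : Continuous fun p : E × ℝ => g'' p.1 p.2 := continuous_const.mul hgc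
  have hgb : ∀ ξ t, |g ξ t| ≤ 2 * ‖a ξ‖ := fun ξ t => by
    have a1 := Complex.abs_re_le_norm (a ξ)
    have a2 := Complex.abs_im_le_norm (a ξ)
    have a3 := Real.abs_cos_le_one (2 * Real.pi * t)
    have a4 := Real.abs_sin_le_one (2 * Real.pi * t)
    calc |g ξ t| ≤ |(a ξ).re| * |Real.cos (2 * Real.pi * t)|
          + |(a ξ).im| * |Real.sin (2 * Real.pi * t)| := by
          rw [← abs_mul, ← abs_mul]; exact abs_sub _ _
      _ ≤ ‖a ξ‖ * 1 + ‖a ξ‖ * 1 := by gcongr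
      _ = _ := by ring
  set ν : Measure ℝ := volume.restrict (Set.Ioc 0 2) with hν
  set μ : Measure (E × ℝ) := (volume : Measure E).prod ν with hμ
  have hae : ∀ᵐ p : E × ℝ ∂μ, p.2 ∈ Set.Ioc (0 : ℝ) 2 :=
    Measure.quasiMeasurePreserving_snd.ae (ae_restrict_mem measurableSet_Ioc)
  have key : ∀ (σ : ℝ), |σ| = 1 → Integrable (fun p : E × ℝ =>
      (‖p.1‖ * g'' p.1 (σ * (‖p.1‖ * p.2))) • (σ • p.1 - (‖p.1‖ * p.2) • e)) μ ∧
      AEStronglyMeasurable (fun p : E × ℝ => ‖p.1‖ * g'' p.1 (σ * (‖p.1‖ * p.2))) μ ∧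
      AEStronglyMeasurable (fun p : E × ℝ => σ • p.1 - (‖p.1‖ * p.2) • e) μ := by
    intro σ hσ
    have c1 : Continuous (fun p : E × ℝ => ‖p.1‖ * g'' p.1 (σ * (‖p.1‖ * p.2))) :=
      (by fun_prop : Continuous fun p : E × ℝ => ‖p.1‖).mul
        (hgc''.comp (by fun_prop : Continuous fun p : E × ℝ => (p.1, σ * (‖p.1‖ * p.2))))
    have c2 : Continuous (fun p : E × ℝ => σ • p.1 - (‖p.1‖ * p.2) • e) := by fun_prop
    refine ⟨?_, c1.aestronglyMeasurable, c2.aestronglyMeasurable⟩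
    have hb : Integrable (fun p : E × ℝ =>
        ((2 * Real.pi) ^ 2 * 6) * ((1 + ‖p.1‖) ^ 2 * ‖a p.1‖)) μ :=
      (hint.comp_fst ν).const_mul _
    refine hb.mono' (c1.smul c2).aestronglyMeasurable ?_
    filter_upwards [hae] with p hp
    have b1 := hgb p.1 (σ * (‖p.1‖ * p.2))
    have b2 : ‖σ • p.1 - (‖p.1‖ * p.2) • e‖ ≤ 3 * ‖p.1‖ := by
      refine (norm_sub_le _ _).trans ?_
      rw [norm_smul, norm_smul, he, Real.norm_eq_abs, Real.norm_eq_abs, hσ,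
        abs_of_nonneg (mul_nonneg (norm_nonneg _) hp.1.le)]
      nlinarith [hp.2, norm_nonneg p.1]
    rw [norm_smul, norm_mul, norm_norm, hg'']
    simp only [norm_mul, norm_neg, norm_pow, Real.norm_eq_abs]
    have b3 : |(2 : ℝ)| ^ 2 * |Real.pi| ^ 2 = (2 * Real.pi) ^ 2 := by
      rw [← mul_pow, ← abs_mul, sq_abs]
    calc ‖p.1‖ * ((|2| * |Real.pi|) ^ 2 * |g p.1 (σ * (‖p.1‖ * p.2))|) *
          ‖σ • p.1 - (‖p.1‖ * p.2) • e‖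
        ≤ ‖p.1‖ * ((2 * Real.pi) ^ 2 * (2 * ‖a p.1‖)) * (3 * ‖p.1‖) := by
          rw [mul_pow, b3]; gcongr
      _ = (2 * Real.pi) ^ 2 * 6 * (‖p.1‖ ^ 2 * ‖a p.1‖) := by ring
      _ ≤ _ := by
          have : ‖p.1‖ ^ 2 ≤ (1 + ‖p.1‖) ^ 2 := by
            gcongr; linarith
          gcongr
  obtain ⟨i1, m1, n1⟩ := key 1 (by simp)
  obtain ⟨i2, m2, n2⟩ := key (-1) (by simp)
  have hna : Integrable fun ξ => ‖a ξ‖ := by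
    refine hint.mono' ha.norm.aestronglyMeasurable (.of_forall fun ξ => ?_)
    rw [norm_norm]
    exact le_mul_of_one_le_left (norm_nonneg _) (one_le_pow₀ (by linarith [norm_nonneg ξ]))
  have hia : Integrable a := (integrable_norm_iff ha.aestronglyMeasurable).1 hna
  have hv0 : Integrable fun ξ => g ξ 0 • e + g' ξ 0 • ξ := by
    have c0 : Continuous fun ξ => g ξ 0 • e + g' ξ 0 • ξ := by
      simp only [hg, hg']; fun_prop
    refine (hint.const_mul (2 + 2 * Real.pi)).mono' c0.aestronglyMeasurable
      (.of_forall fun ξ => ?_)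
    refine (norm_add_le _ _).trans ?_
    rw [norm_smul, norm_smul, he, Real.norm_eq_abs, Real.norm_eq_abs]
    have b1 := hgb ξ 0
    have b2 : |g' ξ 0| ≤ 2 * Real.pi * ‖a ξ‖ := by
      simp only [hg', mul_zero, Real.sin_zero, Real.cos_zero, mul_one, zero_add]
      rw [abs_mul, abs_neg, abs_of_nonneg (by positivity : 0 ≤ 2 * Real.pi)]
      exact mul_le_mul_of_nonneg_left (Complex.abs_im_le_norm _) (by positivity)
    have b3 : ‖ξ‖ ≤ (1 + ‖ξ‖) ^ 2 := by nlinarith [norm_nonneg ξ]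
    have b4 : 1 ≤ (1 + ‖ξ‖) ^ 2 := by nlinarith [norm_nonneg ξ]
    calc |g ξ 0| * 1 + |g' ξ 0| * ‖ξ‖
        ≤ (2 * ‖a ξ‖) * (1 + ‖ξ‖) ^ 2 + (2 * Real.pi * ‖a ξ‖) * (1 + ‖ξ‖) ^ 2 := by gcongr
      _ = _ := by ring
  refine ⟨_, ((isZD_linear (∫ ξ, (g ξ 0 • e + g' ξ 0 • ξ))).add (isZD_integral i1 m1 n1)).add
    (isZD_integral i2 m2 n2), fun x hs hx => ?_⟩
  set s := ⟪x, e⟫ with hsdef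
  set y := s⁻¹ • x with hy
  have hgy : (∫ ξ, Complex.exp ((2 * Real.pi * ⟪ξ, y⟫ : ℝ) * Complex.I) • a ξ).re
      = ∫ ξ, g ξ ⟪ξ, y⟫ := by
    have hi : Integrable fun ξ => Complex.exp ((2 * Real.pi * ⟪ξ, y⟫ : ℝ) * Complex.I) • a ξ := by
      refine hna.mono' ?_ (.of_forall fun ξ => ?_)
      · exact Continuous.aestronglyMeasurable (by fun_prop)
      · rw [norm_smul, Complex.norm_exp_ofReal_mul_I, one_mul]
    have := Complex.reCLM.integral_comp_comm hi
    simp only [Complex.reCLM_apply] at this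
    rw [← this]
    refine integral_congr_ae (.of_forall fun ξ => ?_)
    simp only [smul_eq_mul, Complex.mul_re, Complex.exp_ofReal_mul_I_re,
      Complex.exp_ofReal_mul_I_im, hg]
    ring
  rw [hgy, ← integral_const_mul]
  simp only [Pi.add_apply]
  have l0 : ⟪∫ ξ, (g ξ 0 • e + g' ξ 0 • ξ), x⟫ = ∫ ξ, ⟪g ξ 0 • e + g' ξ 0 • ξ, x⟫ := by
    rw [real_inner_comm, ← integral_inner hv0]
    simp only [real_inner_comm]
  have j0 := hv0.inner_const (𝕜 := ℝ) x
  have j1 := (integrable_mul_pp i1 m1 n1 x).integral_prod_left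
  have j2 := (integrable_mul_pp i2 m2 n2 x).integral_prod_left
  have s1 := integral_add j0 j1
  have s2 := integral_add (j0.add j1) j2
  simp only [Pi.add_apply] at s2
  rw [l0, integral_prod _ (integrable_mul_pp i1 m1 n1 x),
    integral_prod _ (integrable_mul_pp i2 m2 n2 x), ← s1, ← s2]
  refine integral_congr_ae (.of_forall fun ξ => ?_)
  have hyn : ‖y‖ ≤ 2 := by
    rw [hy, norm_smul, norm_inv, Real.norm_of_nonneg hs.le, inv_mul_le_iff₀ hs]; linarith
  have ht : |⟪ξ, y⟫| ≤ 2 * ‖ξ‖ := (abs_real_inner_le_norm _ _).trans (by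
    nlinarith [norm_nonneg ξ])
  have tk := taylor_kernel (h1 ξ) (h2 ξ)
    (hgc''.comp (by fun_prop : Continuous fun t : ℝ => (ξ, t))) (norm_nonneg ξ) ht
  simp only
  rw [tk, mul_add, mul_add, mul_add]
  congr 1
  · congr 1
    · rw [inner_add_left, real_inner_smul_left, real_inner_smul_left, real_inner_comm, ← hsdef,
        hy, inner_smul_right]
      field_simp
    · rw [intervalIntegral.integral_of_le (by norm_num), ← integral_const_mul]
      refine integral_congr_ae (.of_forall fun τ => ?_)
      simp only [one_mul, one_smul]
      rw [← mul_max_sub_eq_pp hs ξ e x (‖ξ‖ * τ) rfl]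
      ring
  · rw [intervalIntegral.integral_of_le (by norm_num), ← integral_const_mul]
    refine integral_congr_ae (.of_forall fun τ => ?_)
    simp only [neg_one_mul, neg_one_smul]
    rw [← mul_max_sub_eq_pp hs (-ξ) e x (‖ξ‖ * τ) rfl, inner_neg_left]
    ring

end Kinematic

namespace Kinematic

open scoped RealInnerProductSpace

open FourierTransform in
theorem integrable_fourier_weight {E : Type*} [NormedAddCommGroup E] [InnerProductSpace ℝ E]
    [MeasurableSpace E] [BorelSpace E] [FiniteDimensional ℝ E] {N : ℕ}
    (hN : Module.finrank ℝ E + 3 ≤ N) {f : E → ℂ} (hf : ContDiff ℝ N f)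
    (hs : HasCompactSupport f) :
    Continuous (𝓕 f) ∧ Integrable (fun ξ => (1 + ‖ξ‖) ^ 2 * ‖𝓕 f ξ‖) := by
  have hfi : Integrable f := hf.continuous.integrable_of_hasCompactSupport hs
  have hc : Continuous (𝓕 f) :=
    VectorFourier.fourierIntegral_continuous Real.continuous_fourierChar (by
      exact continuous_inner) hfi
  refine ⟨hc, ?_⟩
  have hint : ∀ k n : ℕ, (k : ℕ∞) ≤ (0 : ℕ∞) → (n : ℕ∞) ≤ (N : ℕ∞) →
      Integrable (fun v => ‖v‖ ^ k * ‖iteratedFDeriv ℝ n f v‖) := fun k n _ hn => by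
    have c1 : Continuous (iteratedFDeriv ℝ n f) :=
      hf.continuous_iteratedFDeriv (by exact_mod_cast hn)
    refine Continuous.integrable_of_hasCompactSupport (by fun_prop) ?_
    exact (hs.iteratedFDeriv n).norm.mul_left
  have hb : ∀ n ≤ N, ∃ C, ∀ w, ‖w‖ ^ n * ‖𝓕 f w‖ ≤ C := fun n hn => by
    have := Real.pow_mul_norm_iteratedFDeriv_fourier_le (K := (0 : ℕ∞)) (N := (N : ℕ∞)) hf hint
      (k := 0) (n := n) le_rfl (by exact_mod_cast hn)
    simp only [norm_iteratedFDeriv_zero] at this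
    exact ⟨_, this⟩
  obtain ⟨C0, hC0⟩ := hb 0 (Nat.zero_le _)
  obtain ⟨C1, hC1⟩ := hb (Module.finrank ℝ E + 3) hN
  set d := Module.finrank ℝ E with hd
  have hdom : Integrable (fun ξ : E => (2 ^ (d + 2) * (C0 + C1)) * (1 + ‖ξ‖) ^ (-((d : ℝ) + 1))) :=
    (integrable_one_add_norm (by linarith)).const_mul _
  refine hdom.mono' (Continuous.aestronglyMeasurable (by fun_prop)) (.of_forall fun ξ => ?_)
  have h1 : (0 : ℝ) < 1 + ‖ξ‖ := by positivity
  rw [Real.norm_of_nonneg (by positivity), Real.rpow_neg h1.le, ← div_eq_mul_inv,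
    le_div_iff₀ (by positivity)]
  have e1 : (1 + ‖ξ‖) ^ ((d : ℝ) + 1) = (1 + ‖ξ‖) ^ (d + 1) := by
    rw [← Real.rpow_natCast]; push_cast; rfl
  rw [e1]
  have h2 := add_pow_le (zero_le_one (α := ℝ)) (norm_nonneg ξ) (d + 3)
  have h3 := hC0 ξ
  have h4 := hC1 ξ
  rw [pow_zero, one_mul] at h3
  rw [one_pow, show d + 3 - 1 = d + 2 by omega] at h2
  calc (1 + ‖ξ‖) ^ 2 * ‖𝓕 f ξ‖ * (1 + ‖ξ‖) ^ (d + 1) = (1 + ‖ξ‖) ^ (d + 3) * ‖𝓕 f ξ‖ := by ring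
    _ ≤ (2 ^ (d + 2) * (1 + ‖ξ‖ ^ (d + 3))) * ‖𝓕 f ξ‖ := by gcongr
    _ = 2 ^ (d + 2) * (‖𝓕 f ξ‖ + ‖ξ‖ ^ (d + 3) * ‖𝓕 f ξ‖) := by ring
    _ ≤ _ := by gcongr

variable {E : Type*} [NormedAddCommGroup E] [InnerProductSpace ℝ E] [FiniteDimensional ℝ E]

theorem contDiffAt_HH {N : ℕ} {u : E → ℝ} (hu : ContDiff ℝ N u) {x : E} (hx : x ≠ 0) :
    ContDiffAt ℝ N (HH u) x := by
  have h1 : ContDiffAt ℝ N (fun x : E => ‖x‖) x := contDiffAt_norm ℝ hx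
  exact h1.mul (hu.contDiffAt.comp x ((h1.inv (norm_ne_zero_iff.2 hx)).smul contDiffAt_id))

open FourierTransform in
theorem exists_isZD_of_contDiff {N : ℕ} (hN : Module.finrank ℝ E + 3 ≤ N) {u : E → ℝ}
    (hu : ContDiff ℝ N u) {e : E} (he : ‖e‖ = 1) :
    ∃ w : E → ℝ, IsZD w ∧ ∀ x : E, ‖x‖ ≤ 2 * ⟪x, e⟫ → w x = HH u x := by
  let : MeasurableSpace E := borel E
  have : BorelSpace E := ⟨rfl⟩
  let b1 : ContDiffBump (0 : E) := ⟨2, 3, by norm_num, by norm_num⟩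
  let b2 : ContDiffBump (0 : E) := ⟨1 / 4, 1 / 2, by norm_num, by norm_num⟩
  set F : E → ℝ := fun y => b1 y * ((1 - b2 y) * HH u y) with hF
  have hFc : ContDiff ℝ N F := by
    refine contDiff_iff_contDiffAt.2 fun x => ?_
    rcases eq_or_ne x 0 with rfl | hx
    · have : F =ᶠ[nhds 0] fun _ => 0 := by
        filter_upwards [Metric.ball_mem_nhds (0 : E) (by norm_num : (0 : ℝ) < 1 / 4)] with y hy
        have : b2 y = 1 := b2.one_of_mem_closedBall (Metric.ball_subset_closedBall hy)
        simp [hF, this]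
      exact contDiffAt_const.congr_of_eventuallyEq this
    · exact b1.contDiffAt.mul ((contDiffAt_const.sub b2.contDiffAt).mul (contDiffAt_HH hu hx))
  set f : E → ℂ := fun y => (F y : ℂ) with hf
  have hfc : ContDiff ℝ N f := Complex.ofRealCLM.contDiff.comp hFc
  have hfs : HasCompactSupport f := by
    have : HasCompactSupport F := b1.hasCompactSupport.mul_right
    exact this.comp_left (g := fun r : ℝ => (r : ℂ)) (by simp)
  obtain ⟨hc, hi⟩ := integrable_fourier_weight hN hfc hfs
  have hfi : Integrable f := hfc.continuous.integrable_of_hasCompactSupport hfs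
  have hai : Integrable (𝓕 f) := by
    refine (integrable_norm_iff hc.aestronglyMeasurable).1
      (hi.mono' hc.norm.aestronglyMeasurable (.of_forall fun ξ => ?_))
    rw [norm_norm]
    exact le_mul_of_one_le_left (norm_nonneg _) (one_le_pow₀ (by linarith [norm_nonneg ξ]))
  have hinv := hfc.continuous.fourierInv_fourier_eq hfi hai
  obtain ⟨w, hw, hwx⟩ := exists_isZD_of_fourier hc hi he
  refine ⟨w, hw, fun x hx => ?_⟩
  rcases eq_or_ne x 0 with rfl | hx0
  · obtain ⟨z1, z2, h1, h2, rfl⟩ := hw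
    simp [h1.subLin.map_zero, h2.subLin.map_zero, HH_zero_apply]
  have hxp : 0 < ‖x‖ := norm_pos_iff.2 hx0
  have hs : 0 < ⟪x, e⟫ := by linarith
  rw [hwx x hs hx]
  have h3 := congrFun hinv (⟪x, e⟫⁻¹ • x)
  rw [Real.fourierInv_eq'] at h3
  rw [h3]
  set s := ⟪x, e⟫ with hsdef
  have hsx : s ≤ ‖x‖ := by
    have := real_inner_le_norm x e
    rwa [he, mul_one] at this
  have hn : ‖s⁻¹ • x‖ = ‖x‖ / s := by
    rw [norm_smul, norm_inv, Real.norm_of_nonneg hs.le]; field_simp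
  have hb1 : b1 (s⁻¹ • x) = 1 := b1.one_of_mem_closedBall (by
    rw [mem_closedBall_zero_iff, hn, div_le_iff₀ hs]; exact hx)
  have hb2 : b2 (s⁻¹ • x) = 0 := b2.zero_of_le_dist (by
    rw [dist_zero_right, hn]
    have : 1 ≤ ‖x‖ / s := (one_le_div hs).2 hsx
    exact le_trans (by norm_num [b2]) this)
  simp only [hf, hF, hb1, hb2, Complex.ofReal_re]
  rw [HH_smul_apply u (by positivity)]
  field_simp
  ring

end Kinematic

namespace Kinematic

open scoped RealInnerProductSpace

variable {E : Type*} [NormedAddCommGroup E] [InnerProductSpace ℝ E] [FiniteDimensional ℝ E]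

theorem SubLin.continuous {h : E → ℝ} (hh : SubLin h) : Continuous h := by
  have : ConvexOn ℝ Set.univ h := ⟨convex_univ, fun x _ y _ a b ha hb _ => by
    refine (hh.add_le _ _).trans_eq ?_
    rw [hh.smul a ha, hh.smul b hb]; rfl⟩
  exact this.locallyLipschitz.continuous

theorem SubLin.abs_le {h : E → ℝ} (hh : SubLin h) : ∃ C, 0 ≤ C ∧ ∀ x, |h x| ≤ C * ‖x‖ := by
  obtain ⟨C, hC⟩ := (isCompact_sphere (0 : E) 1).exists_bound_of_continuousOn
    hh.continuous.continuousOn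
  refine ⟨max C 0, le_max_right _ _, fun x => ?_⟩
  rcases eq_or_ne x 0 with rfl | hx
  · simp [hh.map_zero]
  · have h1 := hC (‖x‖⁻¹ • x) (by simpa using norm_inv_smul_self hx)
    rw [← norm_smul_inv_smul hx, hh.smul _ (norm_nonneg x), abs_mul, abs_norm, mul_comm,
      norm_smul_inv_smul hx]
    exact mul_le_mul_of_nonneg_right (h1.trans (le_max_left _ _)) (norm_nonneg _)

theorem DD.abs_le (f : DD E) : ∃ C, 0 ≤ C ∧ ∀ x, |(f : E → ℝ) x| ≤ C * ‖x‖ := by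
  obtain ⟨f, a, b, ha, hb, rfl⟩ := f
  obtain ⟨A, hA, hA'⟩ := ha.abs_le
  obtain ⟨B, hB, hB'⟩ := hb.abs_le
  refine ⟨A + B, by positivity, fun x => ?_⟩
  have := abs_sub (a x) (b x)
  simp only [Pi.sub_apply]
  linarith [hA' x, hB' x]

/-- A smooth nonnegative piece supported near the direction `e`. -/
def IsPiece (N : ℕ) (r : ℝ) (e : E) (f : DD E) : Prop :=
  ∃ u : E → ℝ, ContDiff ℝ N u ∧ (f : E → ℝ) = HH u ∧
    ∀ x, ‖x‖ = 1 → 0 ≤ u x ∧ (r ≤ ‖x - e‖ → u x = 0)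

theorem IsPiece.nonneg {N : ℕ} {r : ℝ} {e : E} {f : DD E} (h : IsPiece N r e f) (x : E) :
    0 ≤ (f : E → ℝ) x := by
  obtain ⟨u, -, hf, hu⟩ := h
  rw [hf]
  rcases eq_or_ne x 0 with rfl | hx
  · simp [HH]
  · exact mul_nonneg (norm_nonneg _) (hu _ (norm_inv_smul_self hx)).1

theorem IsPiece.eq_zero {N : ℕ} {r : ℝ} {e : E} {f : DD E} (h : IsPiece N r e f) {x : E}
    (hx : x = 0 ∨ r ≤ ‖‖x‖⁻¹ • x - e‖) : (f : E → ℝ) x = 0 := by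
  obtain ⟨u, -, hf, hu⟩ := h
  rw [hf]
  rcases eq_or_ne x 0 with rfl | hx0
  · simp [HH]
  · rw [HH, (hu _ (norm_inv_smul_self hx0)).2 (hx.resolve_left hx0), mul_zero]

theorem dl_mul_dl_mem_of_disjoint (f g θ : DD E) (hf : ∀ x, 0 ≤ (f : E → ℝ) x)
    (hθ : ∀ x, 0 ≤ (θ : E → ℝ) x) (hgθ : ∀ x, 0 ≤ (g : E → ℝ) x + (θ : E → ℝ) x)
    (h1 : ∀ x, (f : E → ℝ) x = 0 ∨ ((g : E → ℝ) x = 0 ∧ (θ : E → ℝ) x = 0)) :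
    dl f * dl g ∈ JV E := by
  have e1 : g = (g + θ) - θ := by abel
  have m1 := dl_mul_dl_mem f (g + θ) hf hgθ fun x => (h1 x).imp_right fun h => by
    simp [h.1, h.2]
  have m2 := dl_mul_dl_mem f θ hf hθ fun x => (h1 x).imp_right fun h => h.2
  rw [e1, dl_sub]
  have := (JV E).mul_mem_left (tt (-θ)) ((JV E).sub_mem m1 m2)
  convert this using 1
  ring

theorem exists_zonoid_model {N : ℕ} (hN : Module.finrank ℝ E + 3 ≤ N) {e : E} (he : ‖e‖ = 1)
    {f₀ f : DD E} (h₀ : IsPiece N (1 / 2) e f₀) (hf : ∃ u : E → ℝ, ContDiff ℝ N u ∧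
      (f : E → ℝ) = HH u) :
    ∃ w : DD E, (∃ z₁ z₂ : DD E, IsZonoid (z₁ : E → ℝ) ∧ IsZonoid (z₂ : E → ℝ) ∧ w = z₁ - z₂) ∧
      dl f₀ * (dl w - dl f) ∈ JV E := by
  obtain ⟨u, hu, hfu⟩ := hf
  obtain ⟨w, ⟨z₁, z₂, hz₁, hz₂, rfl⟩, hw⟩ := exists_isZD_of_contDiff hN hu he
  refine ⟨hz₁.subLin.dd - hz₂.subLin.dd, ⟨_, _, hz₁, hz₂, rfl⟩, ?_⟩
  set w : DD E := hz₁.subLin.dd - hz₂.subLin.dd with hwdef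
  set g := w - f with hg
  have hsph : ∀ x : E, x ≠ 0 → ‖‖x‖⁻¹ • x - e‖ ≤ 1 → ‖x‖ ≤ 2 * ⟪x, e⟫ := fun x hx hxe => by
    have h1 : ‖‖x‖⁻¹ • x - e‖ ^ 2 = 2 - 2 * (‖x‖⁻¹ * ⟪x, e⟫) := by
      rw [norm_sub_sq_real, norm_inv_smul_self hx, he, real_inner_smul_left]; ring
    have h2 : ‖‖x‖⁻¹ • x - e‖ ^ 2 ≤ 1 := by nlinarith [norm_nonneg (‖x‖⁻¹ • x - e)]
    have h3 : 1 / 2 ≤ ‖x‖⁻¹ * ⟪x, e⟫ := by linarith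
    rw [inv_mul_eq_div, le_div_iff₀ (norm_pos_iff.2 hx)] at h3
    linarith
  have hg0 : ∀ x : E, x ≠ 0 → ‖‖x‖⁻¹ • x - e‖ ≤ 1 → (g : E → ℝ) x = 0 := fun x hx hxe => by
    have := hw x (hsph x hx hxe)
    simp only [Pi.sub_apply] at this
    simp only [hg, hwdef, Submodule.coe_sub, Pi.sub_apply, hfu]
    exact sub_eq_zero.2 this
  obtain ⟨C, hC, hgC⟩ := DD.abs_le g
  let b : ContDiffBump e := ⟨1 / 2, 3 / 4, by norm_num, by norm_num⟩
  let θ : DD E := ⟨HH (fun x => 1 - b x), contDiff_HH_mem_DD (contDiff_const.sub b.contDiff)⟩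
  have hθ0 : ∀ x, 0 ≤ (θ : E → ℝ) x := fun x =>
    mul_nonneg (norm_nonneg _) (sub_nonneg.2 b.le_one)
  have key : dl f₀ * dl g ∈ JV E := by
    refine dl_mul_dl_mem_of_disjoint f₀ g (C • θ) h₀.nonneg
      (fun x => mul_nonneg hC (hθ0 x)) (fun x => ?_) fun x => ?_
    · rcases eq_or_ne x 0 with rfl | hx
      · have := hgC 0
        rw [norm_zero, mul_zero] at this
        rw [abs_nonpos_iff.1 this, zero_add]
        exact mul_nonneg hC (hθ0 0)
      · rcases le_total ‖‖x‖⁻¹ • x - e‖ 1 with h1 | h1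
        · rw [hg0 x hx h1, zero_add]
          exact mul_nonneg hC (hθ0 x)
        · have e1 : b (‖x‖⁻¹ • x) = 0 := b.zero_of_le_dist (by
            rw [dist_eq_norm]; exact le_trans (by norm_num [b]) h1)
          have e2 : (θ : E → ℝ) x = ‖x‖ := by
            change ‖x‖ * (1 - b (‖x‖⁻¹ • x)) = _
            rw [e1]; ring
          have := (abs_le.1 (hgC x)).1
          simp only [Submodule.coe_smul, Pi.smul_apply, smul_eq_mul, e2]
          linarith
    · rcases eq_or_ne x 0 with rfl | hx
      · exact Or.inl (h₀.eq_zero (Or.inl rfl))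
      · rcases le_total (1 / 2) ‖‖x‖⁻¹ • x - e‖ with h1 | h1
        · exact Or.inl (h₀.eq_zero (Or.inr h1))
        · refine Or.inr ⟨hg0 x hx (by linarith), ?_⟩
          have e1 : b (‖x‖⁻¹ • x) = 1 := b.one_of_mem_closedBall (by
            rw [mem_closedBall_iff_norm]; exact h1)
          have e2 : (θ : E → ℝ) x = 0 := by
            change ‖x‖ * (1 - b (‖x‖⁻¹ • x)) = _
            rw [e1]; ring
          simp [e2]
  have e1 : dl w = dl f + dl g + dl f * dl g := by
    rw [← dl_add]; congr 1; rw [hg]; abel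
  have := (JV E).mul_mem_left (1 + dl f) key
  rw [e1]
  convert this using 1
  ring

theorem prod_dl_local_mem {N : ℕ} (hN : Module.finrank ℝ E + 3 ≤ N) {e : E} (he : ‖e‖ = 1)
    {f₀ : DD E} (h₀ : IsPiece N (1 / 2) e f₀) (l : List (DD E))
    (hl : ∀ f ∈ l, ∃ u : E → ℝ, ContDiff ℝ N u ∧ (f : E → ℝ) = HH u)
    (hn : Module.finrank ℝ E < l.length) : dl f₀ * (l.map dl).prod ∈ JV E := by
  suffices H : ∀ (l l' : List (DD E)), (∀ f ∈ l, ∃ u : E → ℝ, ContDiff ℝ N u ∧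
      (f : E → ℝ) = HH u) → (∀ w ∈ l', ∃ z₁ z₂ : DD E, IsZonoid (z₁ : E → ℝ) ∧
      IsZonoid (z₂ : E → ℝ) ∧ w = z₁ - z₂) → Module.finrank ℝ E < l.length + l'.length →
      dl f₀ * ((l.map dl).prod * (l'.map dl).prod) ∈ JV E by
    simpa using H l [] hl (by simp) (by simpa using hn)
  intro l
  induction l with
  | nil =>
    intro l' _ h2 h3
    simpa using (JV E).mul_mem_left (dl f₀) (prod_dl_zonoid_sub_mem l' h2 (by simpa using h3))
  | cons f l ih =>
    intro l' h1 h2 h3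
    obtain ⟨w, hw, hwf⟩ := exists_zonoid_model hN he h₀ (h1 f (by simp))
    have A := ih (w :: l') (fun g hg => h1 g (by simp [hg]))
      (fun g hg => by
        rcases List.mem_cons.1 hg with rfl | hg
        · exact hw
        · exact h2 g hg) (by simp only [List.length_cons] at h3 ⊢; omega)
    have B := (JV E).mul_mem_left ((l.map dl).prod * (l'.map dl).prod) hwf
    have := (JV E).sub_mem A B
    rw [List.map_cons, List.prod_cons] at this ⊢
    convert this using 1
    ring

theorem dl_sum_mul_mem {ι : Type*} (J : Ideal (AddMonoidAlgebra ℝ (DD E))) (s : Finset ι)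
    (f : ι → DD E) (a : AddMonoidAlgebra ℝ (DD E)) (h : ∀ i ∈ s, dl (f i) * a ∈ J) :
    dl (∑ i ∈ s, f i) * a ∈ J := by
  classical
  induction s using Finset.induction_on with
  | empty => simp [dl, tt_zero]
  | insert i s hi ih =>
    rw [Finset.sum_insert hi, dl_add]
    have h1 := h i (by simp)
    have h2 := ih fun j hj => h j (by simp [hj])
    have := J.add_mem (J.add_mem h1 h2) (J.mul_mem_left (dl (f i)) h2)
    convert this using 1
    ring

theorem exists_pieces {N : ℕ} (hN : 2 ≤ N) {f : DD E} {u : E → ℝ} (hu : ContDiff ℝ N u)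
    (hf : (f : E → ℝ) = HH u) (h0 : ∀ x, ‖x‖ = 1 → 0 ≤ u x) :
    ∃ (s : Finset E) (p : E → DD E), (∀ e ∈ s, ‖e‖ = 1 ∧ IsPiece N (1 / 2) e (p e)) ∧
      f = ∑ e ∈ s, p e := by
  obtain ⟨s, hs, hcov⟩ := (isCompact_sphere (0 : E) 1).elim_nhds_subcover
    (fun x => Metric.ball x (1 / 4)) (fun x _ => Metric.ball_mem_nhds x (by norm_num))
  let b : ∀ e : E, ContDiffBump e := fun e => ⟨1 / 4, 1 / 2, by norm_num, by norm_num⟩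
  let θ : E → ℝ := fun x => ∑ e ∈ s, b e x + (‖x‖ ^ 2 - 1) ^ 2
  have hθ : ∀ x, 0 < θ x := fun x => by
    have h1 : ∀ e ∈ s, 0 ≤ b e x := fun e _ => (b e).nonneg
    have h2 := Finset.sum_nonneg h1
    by_cases hx : ‖x‖ = 1
    · obtain ⟨e, he, hxe⟩ := Set.mem_iUnion₂.1 (hcov (by simpa using hx))
      have h3 : b e x = 1 := (b e).one_of_mem_closedBall (Metric.ball_subset_closedBall hxe)
      have := Finset.single_le_sum h1 he
      have h4 := sq_nonneg (‖x‖ ^ 2 - 1)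
      simp only [θ]; linarith
    · have : 0 < (‖x‖ ^ 2 - 1) ^ 2 := by
        refine sq_pos_of_ne_zero fun h => hx ?_
        have : (‖x‖ - 1) * (‖x‖ + 1) = 0 := by linear_combination h
        rcases mul_eq_zero.1 this with h | h
        · linarith
        · linarith [norm_nonneg x]
      simp only [θ]; linarith
  have hθc : ContDiff ℝ N θ :=
    (ContDiff.sum fun e _ => (b e).contDiff).add (((contDiff_norm_sq ℝ).sub contDiff_const).pow 2)
  let v : E → E → ℝ := fun e x => u x * b e x / θ x
  have hv : ∀ e, ContDiff ℝ N (v e) := fun e =>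
    (hu.mul (b e).contDiff).div hθc fun x => (hθ x).ne'
  refine ⟨s, fun e => ⟨HH (v e), contDiff_HH_mem_DD ((hv e).of_le (by exact_mod_cast hN))⟩,
    fun e he => ⟨by simpa using hs e he, v e, hv e, rfl, fun x hx => ⟨?_, fun h => ?_⟩⟩, ?_⟩
  · exact div_nonneg (mul_nonneg (h0 x hx) (b e).nonneg) (hθ x).le
  · have : b e x = 0 := (b e).zero_of_le_dist (by rw [dist_eq_norm]; exact h)
    simp [v, this]
  · ext x
    rw [hf, AddSubmonoidClass.coe_finsetSum, Finset.sum_apply]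
    simp only [HH]
    rcases eq_or_ne x 0 with rfl | hx
    · simp
    rw [← Finset.mul_sum]
    congr 1
    set y := ‖x‖⁻¹ • x
    have hy : ‖y‖ = 1 := norm_inv_smul_self hx
    have h1 : θ y = ∑ e ∈ s, b e y := by simp [θ, hy]
    simp only [v]
    rw [← Finset.sum_div, ← Finset.mul_sum, ← h1, mul_div_cancel_right₀ _ (hθ y).ne']

theorem prod_dl_smooth_mem {N : ℕ} (hN : Module.finrank ℝ E + 3 ≤ N) (l : List (DD E))
    (hl : ∀ f ∈ l, ∃ u : E → ℝ, ContDiff ℝ N u ∧ (f : E → ℝ) = HH u ∧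
      ∀ x, ‖x‖ = 1 → 0 ≤ u x)
    (hn : Module.finrank ℝ E + 1 < l.length) : (l.map dl).prod ∈ JV E := by
  match l, hl, hn with
  | f₀ :: l, hl, hn =>
    rw [List.map_cons, List.prod_cons]
    obtain ⟨u, hu, hfu, hu'⟩ := hl f₀ (by simp)
    obtain ⟨s, p, hp, rfl⟩ := exists_pieces (by omega) hu hfu hu'
    refine dl_sum_mul_mem _ s p _ fun e he => ?_
    refine prod_dl_local_mem hN (hp e he).1 (hp e he).2 l (fun f hf => ?_) (by simpa using hn)
    obtain ⟨u', hu', hfu', _⟩ := hl f (by simp [hf])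
    exact ⟨u', hu', hfu'⟩

end Kinematic

namespace Kinematic

open scoped RealInnerProductSpace

variable {E : Type*} [NormedAddCommGroup E] [InnerProductSpace ℝ E]

theorem IsVF.dilate {Φ : (E → ℝ) → ℝ} (hΦ : IsVF Φ) {c : ℝ} (hc : 0 < c) :
    IsVF (fun h => Φ (c • h)) where
  val h k hh hk hi := by
    have e1 : c • (h ⊔ k) = c • h ⊔ c • k := by
      ext x
      simp only [Pi.smul_apply, Pi.sup_apply, smul_eq_mul]
      exact mul_max_of_nonneg _ _ hc.le
    have e2 : c • (h ⊓ k) = c • h ⊓ c • k := by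
      ext x
      simp only [Pi.smul_apply, Pi.inf_apply, smul_eq_mul]
      exact mul_min_of_nonneg _ _ hc.le
    simp only [e1, e2]
    exact hΦ.val _ _ (hh.const_smul hc.le) (hk.const_smul hc.le) (e2 ▸ hi.const_smul hc.le)
  trans h hh v := by
    have : c • (h + fun x => ⟪v, x⟫) = c • h + fun x => ⟪c • v, x⟫ := by
      ext x; simp [inner_smul_left, mul_add]
    simp only [this]
    exact hΦ.trans _ (hh.const_smul hc.le) _
  cont h hh ε hε := by
    obtain ⟨δ, hδ, H⟩ := hΦ.cont (c • h) (hh.const_smul hc.le) ε hε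
    refine ⟨δ / c, by positivity, fun k hk hd => H _ (hk.const_smul hc.le) fun x => ?_⟩
    simp only [Pi.smul_apply, smul_eq_mul, ← mul_sub, abs_mul, abs_of_pos hc]
    calc c * |k x - h x| ≤ c * (δ / c * ‖x‖) := by gcongr; exact hd x
      _ = δ * ‖x‖ := by field_simp

theorem md_dilate (c : ℝ) (l : List (E → ℝ)) (Φ : (E → ℝ) → ℝ) (h : E → ℝ) :
    MD l (fun h => Φ (c • h)) h = MD (l.map (c • ·)) Φ (c • h) := by
  induction l generalizing h with
  | nil => rfl
  | cons k l ih =>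
    rw [List.map_cons, md_cons, md_cons]
    simp only [Dif, ih, smul_add]

theorem dif_eq_zero_of_dif_smul {Ψ : (E → ℝ) → ℝ} {b k : E → ℝ} (hk : SubLin k) {M : ℕ}
    (hM : 0 < M) (H : ∀ h, SubLin h → Dif ((M : ℝ)⁻¹ • k) Ψ (h + b) = 0) :
    ∀ h, SubLin h → Dif k Ψ (h + b) = 0 := by
  have key : ∀ (i : ℕ) h, SubLin h → Ψ (h + b + ((i : ℝ) * (M : ℝ)⁻¹) • k) = Ψ (h + b) := by
    intro i
    induction i with
    | zero => intro h _; simp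
    | succ i ih =>
      intro h hh
      have h1 := H (h + ((i : ℝ) * (M : ℝ)⁻¹) • k) (hh.add (hk.const_smul (by positivity)))
      rw [Dif, sub_eq_zero] at h1
      rw [← ih h hh]
      have e1 : h + b + (((i + 1 : ℕ) : ℝ) * (M : ℝ)⁻¹) • k =
          h + ((i : ℝ) * (M : ℝ)⁻¹) • k + b + (M : ℝ)⁻¹ • k := by
        push_cast; rw [add_mul, one_mul, add_smul]; abel
      rw [e1, h1]; congr 1; abel
  intro h hh
  have := key M h hh
  rw [mul_inv_cancel₀ (by positivity), one_smul] at this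
  rw [Dif, this, sub_self]

theorem md_eq_zero_of_md_smul {b : E → ℝ} {M : ℕ} (hM : 0 < M) (l : List (E → ℝ))
    (hl : ∀ k ∈ l, SubLin k) {Ψ : (E → ℝ) → ℝ}
    (H : ∀ h, SubLin h → MD (l.map ((M : ℝ)⁻¹ • ·)) Ψ (h + b) = 0) :
    ∀ h, SubLin h → MD l Ψ (h + b) = 0 := by
  induction l generalizing Ψ with
  | nil => exact H
  | cons k l ih =>
    rw [md_cons]
    refine dif_eq_zero_of_dif_smul (hl k (by simp)) hM ?_
    rw [← md_dif]
    refine ih (fun k hk => hl k (by simp [hk])) ?_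
    rw [md_dif]
    exact H

/-- Sublinear functions with a nonnegative `C^N` restriction to the sphere. -/
def Smo (N : ℕ) (k : E → ℝ) : Prop :=
  SubLin k ∧ ∃ u : E → ℝ, ContDiff ℝ N u ∧ k = HH u ∧ ∀ x, ‖x‖ = 1 → 0 ≤ u x

theorem smo_norm (N : ℕ) {R : ℝ} (hR : 0 ≤ R) : Smo N (fun x : E => R * ‖x‖) := by
  refine ⟨SubLin.norm.const_smul hR, fun _ => R, contDiff_const, ?_, fun _ _ => hR⟩
  ext x; simp [HH, mul_comm]

variable [FiniteDimensional ℝ E]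

theorem md_smo_eq_zero {N : ℕ} (hN : Module.finrank ℝ E + 3 ≤ N) {Φ : (E → ℝ) → ℝ}
    (hΦ : IsVF Φ) (l : List (E → ℝ)) (hl : ∀ k ∈ l, Smo N k)
    (hlen : Module.finrank ℝ E + 1 < l.length) {h : E → ℝ} (hh : SubLin h) : MD l Φ h = 0 := by
  have hsub : ∀ k ∈ l, SubLin k := fun k hk => (hl k hk).1
  obtain ⟨L, rfl⟩ : ∃ L : List (DD E), L.map Subtype.val = l :=
    ⟨l.pmap Subtype.mk fun k hk => (hsub k hk).mem_DD, by simp [List.map_pmap]⟩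
  have hmem := prod_dl_smooth_mem hN L (fun f hf => (hl _ (List.mem_map_of_mem hf)).2)
    (by simpa using hlen)
  obtain ⟨b, hb, H⟩ := mem_JJ.1 hmem
  set l := L.map Subtype.val
  have key : ∀ M : ℕ, MD l Φ (h + ((M : ℝ) + 1)⁻¹ • b) = 0 := by
    intro M
    refine md_eq_zero_of_md_smul (M := M + 1) (b := ((M : ℝ) + 1)⁻¹ • b) (by omega) l hsub ?_ h hh
    intro g hg
    have hp : (0 : ℝ) < M + 1 := by positivity
    have h1 := H _ (hΦ.dilate (inv_pos.2 hp)) (((M : ℝ) + 1) • g) (hg.const_smul hp.le)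
    rw [ev_prod_dl, md_dilate, smul_add, smul_smul, inv_mul_cancel₀ hp.ne', one_smul] at h1
    push_cast
    exact h1
  obtain ⟨C, hC, hbC⟩ := hb.abs_le
  have ht := (hΦ.md hsub).cont_seq hh (u := fun M : ℕ => h + ((M : ℝ) + 1)⁻¹ • b)
    (fun M => hh.add (hb.const_smul (by positivity))) (e := fun M : ℕ => ((M : ℝ) + 1)⁻¹ * C) ?_ ?_
  · simp only [key] at ht
    exact (tendsto_nhds_unique ht tendsto_const_nhds)
  · have := (tendsto_one_div_add_atTop_nhds_zero_nat (𝕜 := ℝ)).mul_const C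
    simpa using this
  · intro M x
    have hp : (0 : ℝ) < ((M : ℝ) + 1)⁻¹ := by positivity
    simp only [Pi.add_apply, Pi.smul_apply, smul_eq_mul, add_sub_cancel_left, abs_mul,
      abs_of_pos hp, mul_assoc]
    gcongr
    exact hbC x

theorem SubLin.exists_support {h : E → ℝ} (hh : SubLin h) (e : E) :
    ∃ v : E, (∀ x, ⟪v, x⟫ ≤ h x) ∧ ⟪v, e⟫ = h e := by
  have main : ∀ e : E, e ≠ 0 → ∃ v : E, (∀ x, ⟪v, x⟫ ≤ h x) ∧ ⟪v, e⟫ = h e := by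
    intro e he
    obtain ⟨g, hg, hgl⟩ := exists_extension_of_le_sublinear
      (LinearPMap.mkSpanSingleton e (h e) he : E →ₗ.[ℝ] ℝ) h (fun c hc x => hh.smul c hc.le x)
      hh.add_le (by
        rintro ⟨x, hx⟩
        obtain ⟨t, rfl⟩ := Submodule.mem_span_singleton.1 hx
        have hap : (LinearPMap.mkSpanSingleton e (h e) he : E →ₗ.[ℝ] ℝ) ⟨t • e, hx⟩ = t • h e :=
          LinearPMap.mkSpanSingleton'_apply _ _ _ t hx
        rw [hap]
        rcases le_total 0 t with ht | ht
        · simp [hh.smul t ht]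
        · have h1 := hh.add_le (t • e) ((-t) • e)
          rw [← add_smul, add_neg_cancel, zero_smul, hh.map_zero, hh.smul (-t) (by linarith)] at h1
          simp only [smul_eq_mul]
          linarith)
    refine ⟨(InnerProductSpace.toDual ℝ E).symm g.toContinuousLinearMap, fun x => ?_, ?_⟩
    · simpa using hgl x
    · have := hg ⟨e, Submodule.mem_span_singleton_self e⟩
      simp only [InnerProductSpace.toDual_symm_apply, LinearMap.coe_toContinuousLinearMap']
      rw [this]
      exact LinearPMap.mkSpanSingleton_apply ℝ ℝ he (h e)
  by_cases he : e = 0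
  · subst he
    by_cases hn : ∃ e : E, e ≠ 0
    · obtain ⟨e, he⟩ := hn
      obtain ⟨v, hv, -⟩ := main e he
      exact ⟨v, hv, by simp [hh.map_zero]⟩
    · push Not at hn
      exact ⟨0, fun x => by simp [hn x, hh.map_zero], by simp [hh.map_zero]⟩
  · exact main e he

theorem SubLin.exists_net {h : E → ℝ} (hh : SubLin h) {ε : ℝ} (hε : 0 < ε) :
    ∃ s : Finset E, s.Nonempty ∧ (∀ v ∈ s, ∀ x, ⟪v, x⟫ ≤ h x) ∧
      ∀ x, ∃ v ∈ s, h x ≤ ⟪v, x⟫ + ε * ‖x‖ := by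
  classical
  choose w hw hwe using fun e => hh.exists_support e
  obtain ⟨t, -, ht⟩ := (isCompact_sphere (0 : E) 1).elim_nhds_subcover
    (fun e => {x | h x - ⟪w e, x⟫ < ε}) fun e _ => by
      refine IsOpen.mem_nhds (isOpen_lt ?_ continuous_const) (by simp [hwe, hε])
      exact hh.continuous.sub (continuous_const.inner continuous_id)
  refine ⟨insert (w 0) (t.image w), by simp, ?_, fun x => ?_⟩
  · intro v hv x
    obtain ⟨e, rfl⟩ : ∃ e, w e = v := by
      rcases Finset.mem_insert.1 hv with rfl | hv
      · exact ⟨_, rfl⟩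
      · obtain ⟨e, -, he⟩ := Finset.mem_image.1 hv
        exact ⟨e, he⟩
    exact hw e x
  · by_cases hx : x = 0
    · exact ⟨w 0, by simp, by simp [hx, hh.map_zero]⟩
    · have h1 := ht (show ‖x‖⁻¹ • x ∈ Metric.sphere (0 : E) 1 by
        simpa using norm_inv_smul_self hx)
      simp only [Set.mem_iUnion] at h1
      obtain ⟨e, he, h2⟩ := h1
      refine ⟨w e, by simp [Finset.mem_image_of_mem w he], ?_⟩
      have hx' : 0 < ‖x‖ := norm_pos_iff.2 hx
      have h2 : h (‖x‖⁻¹ • x) - ⟪w e, ‖x‖⁻¹ • x⟫ < ε := h2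
      rw [hh.smul _ (by positivity), inner_smul_right, ← mul_sub, inv_mul_lt_iff₀ hx'] at h2
      linarith

theorem exists_contDiff_HH {N : ℕ} {k : E → ℝ} (hk : ∀ t : ℝ, 0 ≤ t → ∀ x, k (t • x) = t * k x)
    (hs : ∀ x, x ≠ 0 → ContDiffAt ℝ N k x) :
    ∃ u : E → ℝ, ContDiff ℝ N u ∧ k = HH u ∧ ∀ x, ‖x‖ = 1 → u x = k x := by
  let b : ContDiffBump (0 : E) := ⟨1 / 4, 1 / 2, by norm_num, by norm_num⟩
  have hone : ∀ x : E, ‖x‖ = 1 → (1 - b x) * k x = k x := fun x hx => by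
    rw [b.zero_of_le_dist (by rw [dist_zero_right, hx]; norm_num [b])]; ring
  refine ⟨fun x => (1 - b x) * k x, ?_, ?_, hone⟩
  · rw [contDiff_iff_contDiffAt]
    intro x
    by_cases hx : x = 0
    · subst hx
      refine (contDiffAt_const (c := (0 : ℝ))).congr_of_eventuallyEq ?_
      filter_upwards [b.eventuallyEq_one] with y hy
      rw [hy]; simp
    · exact (contDiffAt_const.sub b.contDiff.contDiffAt).mul (hs x hx)
  · rw [HH_congr hone, HH_eq_self hk]

theorem exists_smo_approx (N : ℕ) {K : E → ℝ} (hK : SubLin K) :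
    ∃ R : ℝ, 0 ≤ R ∧ ∀ δ > 0, ∃ k, Smo N k ∧ ∀ x, |k x - (K x + R * ‖x‖)| ≤ δ * ‖x‖ := by
  obtain ⟨C, hC, hKC⟩ := hK.abs_le
  refine ⟨C + 1, by positivity, fun δ hδ => ?_⟩
  obtain ⟨s, hs, hsK, hsn⟩ := hK.exists_net hδ
  have hm : (0 : ℝ) < s.card := by exact_mod_cast hs.card_pos
  have hlim : Filter.Tendsto (fun p : ℝ => ((s.card : ℝ) ^ (1 / p) - 1) * (2 * C + 1))
      Filter.atTop (nhds 0) := by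
    have h1 : Filter.Tendsto (fun p : ℝ => 1 / p) Filter.atTop (nhds 0) := by
      simpa using tendsto_inv_atTop_zero (𝕜 := ℝ)
    have h2 := (Real.continuous_const_rpow hm.ne').tendsto (0 : ℝ) |>.comp h1
    have h3 := (h2.sub_const 1).mul_const (2 * C + 1)
    simpa using h3
  obtain ⟨p, hp1, hp2⟩ := ((Filter.eventually_ge_atTop (1 : ℝ)).and
    (hlim.eventually (eventually_lt_nhds hδ))).exists
  have hp0 : 0 < p := by linarith
  let a : E → E → ℝ := fun v x => ⟪v, x⟫ + (C + 1) * ‖x‖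
  have hva : ∀ v ∈ s, ∀ x, |⟪v, x⟫| ≤ C * ‖x‖ := fun v hv x => by
    have h1 := hsK v hv x
    have h2 := hsK v hv (-x)
    have h3 := abs_le.1 (hKC x)
    have h4 := abs_le.1 (hKC (-x))
    rw [inner_neg_right] at h2
    rw [norm_neg] at h4
    exact abs_le.2 ⟨by linarith [h4.2], by linarith [h3.2]⟩
  have ha : ∀ v ∈ s, ∀ x, ‖x‖ ≤ a v x := fun v hv x => by
    have := (abs_le.1 (hva v hv x)).1
    simp only [a]; linarith
  have ha0 : ∀ v ∈ s, ∀ x, 0 ≤ a v x := fun v hv x => (norm_nonneg x).trans (ha v hv x)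
  have hsa : ∀ v, SubLin (a v) := fun v =>
    (SubLin.linear v).add (SubLin.norm.const_smul (by positivity : (0 : ℝ) ≤ C + 1))
  let k : E → ℝ := fun x => (∑ v ∈ s, a v x ^ p) ^ (1 / p)
  have hsum0 : ∀ x, 0 ≤ ∑ v ∈ s, a v x ^ p := fun x =>
    Finset.sum_nonneg fun v hv => Real.rpow_nonneg (ha0 v hv x) _
  have hkS : SubLin k := by
    refine ⟨fun x y => ?_, fun t ht x => ?_⟩
    · refine le_trans ?_ (Real.Lp_add_le_of_nonneg s hp1 (fun v hv => ha0 v hv x)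
        (fun v hv => ha0 v hv y))
      refine Real.rpow_le_rpow (hsum0 _) (Finset.sum_le_sum fun v hv => ?_) (by positivity)
      exact Real.rpow_le_rpow (ha0 v hv _) ((hsa v).add_le x y) hp0.le
    · simp only [k]
      have : ∑ v ∈ s, a v (t • x) ^ p = t ^ p * ∑ v ∈ s, a v x ^ p := by
        rw [Finset.mul_sum]
        refine Finset.sum_congr rfl fun v hv => ?_
        rw [(hsa v).smul t ht, Real.mul_rpow ht (ha0 v hv x)]
      rw [this, Real.mul_rpow (by positivity) (hsum0 x), ← Real.rpow_mul ht,
        mul_one_div_cancel hp0.ne', Real.rpow_one]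
  have hcd : ∀ x, x ≠ 0 → ContDiffAt ℝ N k x := by
    intro x hx
    have hx' : 0 < ‖x‖ := norm_pos_iff.2 hx
    refine ContDiffAt.rpow_const_of_ne (ContDiffAt.sum fun v hv => ?_) ?_
    · refine ContDiffAt.rpow_const_of_ne ?_ (hx'.trans_le (ha v hv x)).ne'
      exact (contDiffAt_const.inner ℝ contDiffAt_id).add
        (contDiffAt_const.mul (contDiffAt_norm ℝ hx))
    · exact (Finset.sum_pos (fun v hv => Real.rpow_pos_of_pos (hx'.trans_le (ha v hv x)) _)
        hs).ne'
  obtain ⟨u, hu, hku, huk⟩ := exists_contDiff_HH hkS.smul hcd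
  refine ⟨k, ⟨hkS, u, hu, hku, fun x hx => ?_⟩, fun x => ?_⟩
  · rw [huk x hx]; exact Real.rpow_nonneg (hsum0 x) _
  · rw [abs_le]
    constructor
    · obtain ⟨v, hv, hvx⟩ := hsn x
      have h1 : a v x ≤ k x := by
        calc a v x = (a v x ^ p) ^ (1 / p) := by
              rw [← Real.rpow_mul (ha0 v hv x), mul_one_div_cancel hp0.ne', Real.rpow_one]
          _ ≤ k x := Real.rpow_le_rpow (Real.rpow_nonneg (ha0 v hv x) _)
              (Finset.single_le_sum (f := fun v => a v x ^ p)
                (fun v hv => Real.rpow_nonneg (ha0 v hv x) _) hv) (by positivity)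
      simp only [a] at h1
      linarith
    · have hT : 0 ≤ K x + (C + 1) * ‖x‖ := by
        have := (abs_le.1 (hKC x)).1
        linarith [norm_nonneg x]
      have h1 : k x ≤ (s.card : ℝ) ^ (1 / p) * (K x + (C + 1) * ‖x‖) := by
        calc k x ≤ (∑ v ∈ s, (K x + (C + 1) * ‖x‖) ^ p) ^ (1 / p) := by
              refine Real.rpow_le_rpow (hsum0 _) (Finset.sum_le_sum fun v hv => ?_) (by positivity)
              refine Real.rpow_le_rpow (ha0 v hv _) ?_ hp0.le
              have := hsK v hv x
              simp only [a]; linarith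
          _ = _ := by
              rw [Finset.sum_const, nsmul_eq_mul, Real.mul_rpow hm.le (by positivity),
                ← Real.rpow_mul hT, mul_one_div_cancel hp0.ne', Real.rpow_one]
      have h2 : (1 : ℝ) ≤ (s.card : ℝ) ^ (1 / p) :=
        Real.one_le_rpow (by exact_mod_cast hs.card_pos) (by positivity)
      have h3 : K x + (C + 1) * ‖x‖ ≤ (2 * C + 1) * ‖x‖ := by
        have := (abs_le.1 (hKC x)).2
        linarith
      have h4 := mul_le_mul_of_nonneg_left h3 (sub_nonneg.2 h2)
      have h5 := mul_le_mul_of_nonneg_right hp2.le (norm_nonneg x)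
      linarith

theorem IsVF.add_eq_of_smo {N : ℕ} {Ψ : (E → ℝ) → ℝ} (hΨ : IsVF Ψ)
    (H : ∀ k, Smo N k → ∀ h, SubLin h → Ψ (h + k) = Ψ h) {K h : E → ℝ} (hK : SubLin K)
    (hh : SubLin h) : Ψ (h + K) = Ψ h := by
  obtain ⟨R, hR, hRa⟩ := exists_smo_approx N hK
  have h1 := H _ (smo_norm N hR) (h + K) (hh.add hK)
  rw [← h1, ← sub_eq_zero, ← abs_eq_zero]
  refine le_antisymm (le_of_forall_pos_le_add fun ε hε => ?_) (abs_nonneg _)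
  have hs : SubLin (h + K + fun x => R * ‖x‖) := (hh.add hK).add (smo_norm N hR).1
  obtain ⟨δ, hδ, hc⟩ := hΨ.cont _ hs ε hε
  obtain ⟨k, hk, hkx⟩ := hRa δ hδ
  have h2 := hc (h + k) (hh.add hk.1) fun x => by
    have := hkx x
    simp only [Pi.add_apply]
    rwa [show h x + k x - (h x + K x + R * ‖x‖) = k x - (K x + R * ‖x‖) by ring]
  rw [H k hk h hh, abs_sub_comm] at h2
  simpa using h2

theorem IsVF.md_eq_zero_of_smo {Φ : (E → ℝ) → ℝ} (hΦ : IsVF Φ) {N m : ℕ}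
    (H : ∀ l : List (E → ℝ), (∀ k ∈ l, Smo N k) → l.length = m → ∀ h, SubLin h → MD l Φ h = 0)
    (l : List (E → ℝ)) (hl : ∀ k ∈ l, SubLin k) (hlen : l.length = m) {h : E → ℝ}
    (hh : SubLin h) : MD l Φ h = 0 := by
  have key : ∀ l₁ l₂ : List (E → ℝ), (∀ k ∈ l₁, SubLin k) → (∀ k ∈ l₂, Smo N k) →
      l₁.length + l₂.length = m → ∀ h, SubLin h → MD l₁ (MD l₂ Φ) h = 0 := by
    intro l₁
    induction l₁ with
    | nil =>
      intro l₂ _ h2 hlen h hh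
      exact H l₂ h2 (by simpa using hlen) h hh
    | cons K l₁ ih =>
      intro l₂ h1 h2 hlen h hh
      have hΨ : IsVF (MD l₁ (MD l₂ Φ)) :=
        (hΦ.md fun k hk => (h2 k hk).1).md fun k hk => h1 k (by simp [hk])
      rw [md_cons, Dif, sub_eq_zero]
      refine hΨ.add_eq_of_smo (N := N) (fun k hk g hg => ?_) (h1 K (by simp)) hh
      have := ih (k :: l₂) (fun k hk => h1 k (by simp [hk]))
        (fun k' hk' => (List.mem_cons.1 hk').elim (fun e => e ▸ hk) (h2 k'))
        (by simp only [List.length_cons] at hlen ⊢; omega) g hg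
      rw [md_cons, md_dif, Dif, sub_eq_zero] at this
      exact this
  exact key l [] hl (by simp) (by simpa using hlen) h hh

/-- Continuous translation invariant valuations are polynomial with respect to Minkowski
addition. -/
theorem IsVF.md_eq_zero {Φ : (E → ℝ) → ℝ} (hΦ : IsVF Φ) (l : List (E → ℝ))
    (hl : ∀ k ∈ l, SubLin k) (hlen : Module.finrank ℝ E + 1 < l.length) {h : E → ℝ}
    (hh : SubLin h) : MD l Φ h = 0 :=
  hΦ.md_eq_zero_of_smo (fun l' hl' h1 _ hh' => md_smo_eq_zero le_rfl hΦ l' hl' (h1 ▸ hlen) hh')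
    l hl rfl hh

end Kinematic

namespace Kinematic

open scoped RealInnerProductSpace

variable {E : Type*} [NormedAddCommGroup E] [InnerProductSpace ℝ E]

theorem IsVF.sub {Φ Ψ : (E → ℝ) → ℝ} (hΦ : IsVF Φ) (hΨ : IsVF Ψ) : IsVF (Φ - Ψ) where
  val h k hh hk hi := by
    have := hΦ.val h k hh hk hi
    have := hΨ.val h k hh hk hi
    simp only [Pi.sub_apply]; linarith
  trans h hh v := by simp only [Pi.sub_apply, hΦ.trans h hh, hΨ.trans h hh]
  cont h hh ε hε := by
    obtain ⟨δ₁, h1, H1⟩ := hΦ.cont h hh (ε / 2) (by positivity)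
    obtain ⟨δ₂, h2, H2⟩ := hΨ.cont h hh (ε / 2) (by positivity)
    refine ⟨min δ₁ δ₂, by positivity, fun l hl hd => ?_⟩
    have a1 := H1 l hl fun x => (hd x).trans (by gcongr; exact min_le_left _ _)
    have a2 := H2 l hl fun x => (hd x).trans (by gcongr; exact min_le_right _ _)
    simp only [Pi.sub_apply]; rw [abs_le] at *; constructor <;> linarith [a1.1, a1.2, a2.1, a2.2]

/-- All `m`-fold differences of `Φ` in sublinear directions vanish. -/
def Van (m : ℕ) (Φ : (E → ℝ) → ℝ) : Prop :=
  ∀ L : List (E → ℝ), (∀ k ∈ L, SubLin k) → L.length = m → ∀ h, SubLin h → MD L Φ h = 0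

theorem Van.dif {m : ℕ} {Φ : (E → ℝ) → ℝ} (hΦ : Van (m + 1) Φ) {u : E → ℝ} (hu : SubLin u) :
    Van m (Dif u Φ) := by
  intro L hL hlen h hh
  rw [md_dif, ← md_cons]
  exact hΦ (u :: L) (fun k hk => (List.mem_cons.1 hk).elim (fun e => e ▸ hu) (hL k))
    (by simp [hlen]) h hh

section

variable {ι : Type*} [DecidableEq ι]

theorem ev_insert (Φ : (E → ℝ) → ℝ) (f : DD E) (w h W : E → ℝ) (P : AddMonoidAlgebra ℝ (DD E)) :
    ev Φ (h + (w + W)) (dl f * P) =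
      ev (Dif ((f : E → ℝ) + w) Φ) (h + W) P - ev (Dif w Φ) (h + W) P := by
  have key : ∀ k, ev (Dif k Φ) (h + W) P = ev Φ (h + W + k) P - ev Φ (h + W) P := by
    intro k
    induction P using AddMonoidAlgebra.induction_linear with
    | zero => simp
    | add a b ha hb => simp only [map_add, ha, hb]; ring
    | single g r =>
      simp only [ev_single, Dif]
      rw [add_right_comm]; ring
  rw [ev_dl_mul, key, key]
  have e1 : h + (w + W) + (f : E → ℝ) = h + W + (f + w) := by abel
  have e2 : h + (w + W) = h + W + w := by abel
  rw [e1, e2]; ring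

theorem ev_prod_eq_zero (s : Finset ι) {f : ι → DD E} {w : ι → E → ℝ}
    (hw : ∀ i ∈ s, SubLin (w i)) (hf : ∀ i ∈ s, SubLin ((f i : E → ℝ) + w i))
    {Φ : (E → ℝ) → ℝ} (hΦ : Van s.card Φ) {h : E → ℝ} (hh : SubLin h) :
    ev Φ (h + ∑ i ∈ s, w i) (∏ i ∈ s, dl (f i)) = 0 := by
  induction s using Finset.induction_on generalizing Φ with
  | empty =>
    simp only [Finset.sum_empty, add_zero, Finset.prod_empty, ev_one]
    exact hΦ [] (by simp) (by simp) h hh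
  | insert i s hi ih =>
    rw [Finset.card_insert_of_notMem hi] at hΦ
    rw [Finset.sum_insert hi, Finset.prod_insert hi, ev_insert,
      ih (fun j hj => hw j (by simp [hj])) (fun j hj => hf j (by simp [hj]))
        (hΦ.dif (hf i (by simp))),
      ih (fun j hj => hw j (by simp [hj])) (fun j hj => hf j (by simp [hj]))
        (hΦ.dif (hw i (by simp))), sub_zero]

theorem isVF_ev_prod (s : Finset ι) {f : ι → DD E} {w : ι → E → ℝ}
    (hw : ∀ i ∈ s, SubLin (w i)) (hf : ∀ i ∈ s, SubLin ((f i : E → ℝ) + w i))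
    {Φ : (E → ℝ) → ℝ} (hΦ : IsVF Φ) :
    IsVF (fun h => ev Φ (h + ∑ i ∈ s, w i) (∏ i ∈ s, dl (f i))) := by
  induction s using Finset.induction_on generalizing Φ with
  | empty => simpa only [Finset.sum_empty, add_zero, Finset.prod_empty, ev_one] using hΦ
  | insert i s hi ih =>
    simp only [Finset.sum_insert hi, Finset.prod_insert hi, ev_insert]
    exact (ih (fun j hj => hw j (by simp [hj])) (fun j hj => hf j (by simp [hj]))
        (hΦ.dif (hf i (by simp)))).sub
      (ih (fun j hj => hw j (by simp [hj])) (fun j hj => hf j (by simp [hj]))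
        (hΦ.dif (hw i (by simp))))

/-- A chosen sublinear function whose sum with `f` is sublinear. -/
def repw (f : DD E) : E → ℝ := (DD.exists_rep f).choose

theorem subLin_repw (f : DD E) : SubLin (repw f) := (DD.exists_rep f).choose_spec.1

theorem subLin_add_repw (f : DD E) : SubLin ((f : E → ℝ) + repw f) :=
  (DD.exists_rep f).choose_spec.2

variable [Fintype ι]

/-- Mixed differences, extended to differences of sublinear functions. -/
def QQ (Φ : (E → ℝ) → ℝ) (f : ι → DD E) : ℝ := ev Φ (∑ i, repw (f i)) (∏ i, dl (f i))

theorem QQ_spec {Φ : (E → ℝ) → ℝ} (hΦ : Van (Fintype.card ι + 1) Φ) {f : ι → DD E}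
    {w : ι → E → ℝ} (hw : ∀ i, SubLin (w i)) (hf : ∀ i, SubLin ((f i : E → ℝ) + w i))
    {h : E → ℝ} (hh : SubLin h) : ev Φ (h + ∑ i, w i) (∏ i, dl (f i)) = QQ Φ f := by
  have key : ∀ {w : ι → E → ℝ}, (∀ i, SubLin (w i)) → (∀ i, SubLin ((f i : E → ℝ) + w i)) →
      ∀ {h k}, SubLin h → SubLin k →
      ev Φ (h + k + ∑ i, w i) (∏ i, dl (f i)) = ev Φ (h + ∑ i, w i) (∏ i, dl (f i)) := by
    intro w hw hf h k hh hk
    have h1 := ev_prod_eq_zero Finset.univ (fun i _ => hw i) (fun i _ => hf i) (hΦ.dif hk) hh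
    rw [show k = ((hk.dd : DD E) : E → ℝ) from rfl, ev_dif, ev_dl_mul, sub_eq_zero] at h1
    rw [← h1, add_right_comm]; rfl
  have hs : SubLin (∑ i, w i) := SubLin.sum _ fun i _ => hw i
  have hr : SubLin (∑ i, repw (f i)) := SubLin.sum _ fun i _ => subLin_repw _
  have h1 := key hw hf hh hr
  have h2 := key (fun i => subLin_repw (f i)) (fun i => subLin_add_repw (f i)) SubLin.zero
    (hh.add hs)
  rw [← h1, QQ, add_right_comm]
  rw [zero_add, zero_add] at h2
  exact h2

theorem QQ_update {Φ : (E → ℝ) → ℝ} (hΦ : Van (Fintype.card ι + 1) Φ) (m : ι → DD E) (i : ι)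
    (x : DD E) {w h : E → ℝ} (hw : SubLin w) (hx : SubLin ((x : E → ℝ) + w)) (hh : SubLin h) :
    QQ Φ (Function.update m i x) = ev Φ (h + (w + ∑ j ∈ Finset.univ.erase i, repw (m j)))
      (dl x * ∏ j ∈ Finset.univ.erase i, dl (m j)) := by
  rw [← QQ_spec hΦ (w := Function.update (fun j => repw (m j)) i w) ?_ ?_ hh,
    ← Finset.add_sum_erase Finset.univ _ (Finset.mem_univ i),
    ← Finset.mul_prod_erase Finset.univ _ (Finset.mem_univ i)]
  · simp only [Function.update_self]
    congr 1
    · congr 3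
      refine Finset.sum_congr rfl fun j hj => ?_
      rw [Function.update_of_ne (Finset.ne_of_mem_erase hj)]
    · congr 1
      refine Finset.prod_congr rfl fun j hj => ?_
      rw [Function.update_of_ne (Finset.ne_of_mem_erase hj)]
  · intro j
    rcases eq_or_ne j i with rfl | hj
    · simpa using hw
    · simpa [hj] using subLin_repw (m j)
  · intro j
    rcases eq_or_ne j i with rfl | hj
    · simpa using hx
    · simpa [hj] using subLin_add_repw (m j)

theorem QQ_update_add {Φ : (E → ℝ) → ℝ} (hΦ : Van (Fintype.card ι + 1) Φ) (m : ι → DD E) (i : ι)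
    (x y : DD E) : QQ Φ (Function.update m i (x + y)) =
      QQ Φ (Function.update m i x) + QQ Φ (Function.update m i y) := by
  set W := ∑ j ∈ Finset.univ.erase i, repw (m j) with hW
  set P := ∏ j ∈ Finset.univ.erase i, dl (m j) with hP
  have hx := subLin_repw x
  have hy := subLin_repw y
  have hx' := subLin_add_repw x
  have hy' := subLin_add_repw y
  have e : (((x + y : DD E) : E → ℝ)) + (repw x + repw y) = (x + repw x) + (y + repw y) := by
    rw [Submodule.coe_add]; abel
  have h1 := QQ_update hΦ m i (x + y) (hx.add hy) (e ▸ hx'.add hy') SubLin.zero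
  have h2 := QQ_update hΦ m i x hx hx' hy
  have h3 := QQ_update hΦ m i x hx hx' hy'
  have h4 := QQ_update hΦ m i y hy hy' hx
  have h5 := ev_dl_mul Φ (repw y + (repw x + W)) y (dl x * P)
  rw [← hW, ← hP] at h1 h2 h3 h4
  have e2 : repw y + (repw x + W) + (y : E → ℝ) = y + repw y + (repw x + W) := by abel
  rw [e2, ← h2, ← h3, sub_self] at h5
  have e3 : 0 + (repw x + repw y + W) = repw y + (repw x + W) := by abel
  have e4 : repw x + (repw y + W) = repw y + (repw x + W) := by abel
  have e5 : dl (x + y) * P = dl x * P + dl y * P + dl y * (dl x * P) := by rw [dl_add]; ring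
  rw [e3, e5, map_add, map_add, ← h2, h5, ← e4, ← h4, add_zero] at h1
  exact h1

theorem QQ_update_smul {Φ : (E → ℝ) → ℝ} (hVF : IsVF Φ) [FiniteDimensional ℝ E]
    (hΦ : Van (Fintype.card ι + 1) Φ)
    (m : ι → DD E) (i : ι) (c : ℝ) (x : DD E) :
    QQ Φ (Function.update m i (c • x)) = c * QQ Φ (Function.update m i x) := by
  let A : DD E →+ ℝ := AddMonoidHom.mk' (fun x => QQ Φ (Function.update m i x))
    fun x y => QQ_update_add hΦ m i x y
  let B : DD E → ℝ →+ ℝ := fun x => A.comp (AddMonoidHom.mk' (fun t : ℝ => t • x)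
    fun s t => add_smul s t x)
  have hcont : ∀ {u : E → ℝ} (hu : SubLin u), Continuous (B hu.dd) := by
    intro u hu
    set W := ∑ j ∈ Finset.univ.erase i, repw (m j) with hW
    set P := ∏ j ∈ Finset.univ.erase i, dl (m j) with hP
    have hΨ : IsVF (fun h => ev Φ (h + W) P) := isVF_ev_prod _ (fun j _ => subLin_repw (m j))
      (fun j _ => subLin_add_repw (m j)) hVF
    have hB : ∀ t : ℝ, 0 ≤ t → B hu.dd t = ev Φ (t • u + W) P - ev Φ (0 + W) P := by
      intro t ht
      have h1 := QQ_update hΦ m i (t • hu.dd) SubLin.zero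
        (by rw [add_zero]; exact hu.const_smul ht) SubLin.zero
      rw [← hW, ← hP, zero_add, ev_dl_mul] at h1
      have e : (0 + W + ((t • hu.dd : DD E) : E → ℝ)) = t • u + W := by
        rw [zero_add, add_comm]; rfl
      rw [e] at h1
      exact h1
    obtain ⟨C, hC, hu'⟩ := hu.abs_le
    obtain ⟨δ, hδ, hc⟩ := hΨ.cont 0 SubLin.zero 1 one_pos
    have hb : ∀ t : ℝ, 0 ≤ t → t ≤ δ / (C + 1) → |B hu.dd t| ≤ 1 := by
      intro t ht htδ
      rw [hB t ht]
      refine hc _ (hu.const_smul ht) fun x => ?_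
      have h1 : t * C ≤ δ := by
        rw [le_div_iff₀ (by positivity)] at htδ
        nlinarith
      simp only [Pi.smul_apply, smul_eq_mul, Pi.zero_apply, sub_zero, abs_mul, abs_of_nonneg ht]
      calc t * |u x| ≤ t * (C * ‖x‖) := by gcongr; exact hu' x
        _ = t * C * ‖x‖ := by ring
        _ ≤ δ * ‖x‖ := by gcongr
    have hδ' : 0 < δ / (C + 1) := by positivity
    refine AddMonoidHom.continuous_of_isBounded_nhds_zero (B hu.dd)
      (Metric.closedBall_mem_nhds (0 : ℝ) hδ') ?_
    refine (Metric.isBounded_closedBall (x := (0 : ℝ)) (r := 1)).subset ?_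
    rintro _ ⟨t, ht, rfl⟩
    rw [mem_closedBall_zero_iff, Real.norm_eq_abs] at ht ⊢
    rcases le_total 0 t with h0 | h0
    · exact hb t h0 (by rwa [abs_of_nonneg h0] at ht)
    · have := hb (-t) (by linarith) (by rwa [abs_of_nonpos h0] at ht)
      rwa [map_neg, abs_neg] at this
  have hlin : ∀ {u : E → ℝ} (hu : SubLin u), A (c • hu.dd) = c * A hu.dd := by
    intro u hu
    have := map_real_smul (B hu.dd) (hcont hu) c 1
    simpa [B] using this
  obtain ⟨x, u, v, hu, hv, rfl⟩ := x
  have e : (⟨u - v, u, v, hu, hv, rfl⟩ : DD E) = hu.dd - hv.dd := rfl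
  change A (c • _) = c * A _
  rw [e, smul_sub, map_sub, map_sub, hlin hu, hlin hv]; ring

/-- Mixed differences as a multilinear map. -/
def QM {Φ : (E → ℝ) → ℝ} (hVF : IsVF Φ) [FiniteDimensional ℝ E]
    (hΦ : Van (Fintype.card ι + 1) Φ) : MultilinearMap ℝ (fun _ : ι => DD E) ℝ where
  toFun := QQ Φ
  map_update_add' := by
    intro inst m i x y
    rw [Subsingleton.elim inst (inferInstance : DecidableEq ι)]
    exact QQ_update_add hΦ m i x y
  map_update_smul' := by
    intro inst m i c x
    rw [Subsingleton.elim inst (inferInstance : DecidableEq ι)]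
    exact QQ_update_smul hVF hΦ m i c x

end

end Kinematic

namespace Kinematic

open scoped RealInnerProductSpace

variable {E : Type*} [NormedAddCommGroup E] [InnerProductSpace ℝ E]

section

variable {ι : Type*} [DecidableEq ι]

theorem ev_sum_smul {κ : Type*} (s : Finset κ) (c : κ → ℝ) (Φ : κ → (E → ℝ) → ℝ) (h : E → ℝ)
    (a : AddMonoidAlgebra ℝ (DD E)) :
    ev (∑ k ∈ s, c k • Φ k) h a = ∑ k ∈ s, c k * ev (Φ k) h a := by
  induction a using AddMonoidAlgebra.induction_linear with
  | zero => simp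
  | add a b ha hb => simp only [map_add, ha, hb, mul_add, Finset.sum_add_distrib]
  | single g r =>
    simp only [ev_single, Finset.sum_apply, Pi.smul_apply, smul_eq_mul, Finset.mul_sum]
    exact Finset.sum_congr rfl fun k _ => by ring

/-- Composition of a difference of sublinear functions with a linear map. -/
def DD.comp (g : E →ₗ[ℝ] E) (f : DD E) : DD E :=
  ⟨fun x => (f : E → ℝ) (g x), by
    obtain ⟨f, a, b, ha, hb, rfl⟩ := f
    exact ⟨_, _, ha.comp g, hb.comp g, rfl⟩⟩

theorem ev_comp (g : E →ₗ[ℝ] E) (s : Finset ι) {f : ι → DD E} {w : ι → E → ℝ}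
    (hw : ∀ i ∈ s, SubLin (w i)) (hf : ∀ i ∈ s, SubLin ((f i : E → ℝ) + w i))
    {Φ Ψ : (E → ℝ) → ℝ} (hΦ : ∀ h, SubLin h → Ψ (fun x => h (g x)) = Φ h) {h : E → ℝ}
    (hh : SubLin h) :
    ev Ψ ((fun x => h (g x)) + ∑ i ∈ s, fun x => w i (g x)) (∏ i ∈ s, dl (DD.comp g (f i))) =
      ev Φ (h + ∑ i ∈ s, w i) (∏ i ∈ s, dl (f i)) := by
  induction s using Finset.induction_on generalizing Φ Ψ with
  | empty =>
    simp only [Finset.sum_empty, add_zero, Finset.prod_empty, ev_one]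
    exact hΦ h hh
  | insert i s hi ih =>
    rw [Finset.sum_insert hi, Finset.sum_insert hi, Finset.prod_insert hi, Finset.prod_insert hi,
      ev_insert, ev_insert]
    have hd : ∀ u, SubLin u → ∀ h, SubLin h →
        Dif (fun x => u (g x)) Ψ (fun x => h (g x)) = Dif u Φ h := fun u hu h hh => by
      rw [Dif, Dif, ← hΦ h hh, ← hΦ _ (hh.add hu)]; rfl
    rw [← ih (fun j hj => hw j (by simp [hj])) (fun j hj => hf j (by simp [hj]))
        (hd _ (hf i (by simp))),
      ← ih (fun j hj => hw j (by simp [hj])) (fun j hj => hf j (by simp [hj]))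
        (hd _ (hw i (by simp)))]
    rfl

theorem abs_ev_le (s : Finset ι) {f : ι → DD E} {w : ι → E → ℝ} {r R A : ℝ}
    (hw : ∀ i ∈ s, SubLin (w i)) (hf : ∀ i ∈ s, SubLin ((f i : E → ℝ) + w i))
    (hwr : ∀ i ∈ s, ∀ x, |w i x| ≤ r * ‖x‖)
    (hfr : ∀ i ∈ s, ∀ x, |((f i : E → ℝ) + w i) x| ≤ r * ‖x‖)
    {Φ : (E → ℝ) → ℝ}
    (hΦ : ∀ h, SubLin h → (∀ x, |h x| ≤ (R + r * s.card) * ‖x‖) → |Φ h| ≤ A) {h : E → ℝ}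
    (hh : SubLin h) (hR : ∀ x, |h x| ≤ R * ‖x‖) :
    |ev Φ (h + ∑ i ∈ s, w i) (∏ i ∈ s, dl (f i))| ≤ 4 ^ s.card * A := by
  induction s using Finset.induction_on generalizing Φ A with
  | empty =>
    simp only [Finset.sum_empty, add_zero, Finset.prod_empty, ev_one]
    simpa using hΦ h hh (by simpa using hR)
  | insert i s hi ih =>
    rw [Finset.sum_insert hi, Finset.prod_insert hi, ev_insert]
    have hd : ∀ u, SubLin u → (∀ x, |u x| ≤ r * ‖x‖) → ∀ h, SubLin h →
        (∀ x, |h x| ≤ (R + r * s.card) * ‖x‖) → |Dif u Φ h| ≤ 2 * A := by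
      intro u hu hur h hh hhR
      have hr : ∀ x : E, 0 ≤ r * ‖x‖ := fun x => (abs_nonneg _).trans (hur x)
      have h1 := hΦ h hh fun x => (hhR x).trans (by
        rw [Finset.card_insert_of_notMem hi]; push_cast; linarith [hr x])
      have h2 := hΦ (h + u) (hh.add hu) fun x => by
        rw [Finset.card_insert_of_notMem hi]; push_cast
        have := abs_add_le (h x) (u x)
        have := hhR x
        have := hur x
        simp only [Pi.add_apply]; linarith
      have := abs_sub (Φ (h + u)) (Φ h)
      rw [Dif]; linarith
    have a1 := ih (fun j hj => hw j (by simp [hj])) (fun j hj => hf j (by simp [hj]))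
      (fun j hj => hwr j (by simp [hj])) (fun j hj => hfr j (by simp [hj]))
      (hd _ (hf i (by simp)) (hfr i (by simp)))
    have a2 := ih (fun j hj => hw j (by simp [hj])) (fun j hj => hf j (by simp [hj]))
      (fun j hj => hwr j (by simp [hj])) (fun j hj => hfr j (by simp [hj]))
      (hd _ (hw i (by simp)) (hwr i (by simp)))
    rw [Finset.card_insert_of_notMem hi, pow_succ]
    refine (abs_sub _ _).trans ?_
    have e : (4 : ℝ) ^ s.card * 4 * A = 4 ^ s.card * (2 * A) + 4 ^ s.card * (2 * A) := by ring
    rw [e]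
    exact add_le_add a1 a2

variable [Fintype ι]

theorem QQ_comp {Φ : (E → ℝ) → ℝ} (hΦ : Van (Fintype.card ι + 1) Φ) (g : E →ₗ[ℝ] E)
    (hg : ∀ h, SubLin h → Φ (fun x => h (g x)) = Φ h) (f : ι → DD E) :
    QQ Φ (fun i => DD.comp g (f i)) = QQ Φ f := by
  have h1 := QQ_spec hΦ (f := f) (fun i => subLin_repw (f i)) (fun i => subLin_add_repw (f i))
    SubLin.zero
  have h2 := QQ_spec hΦ (f := fun i => DD.comp g (f i)) (w := fun i x => repw (f i) (g x))
    (fun i => (subLin_repw (f i)).comp g) (fun i => (subLin_add_repw (f i)).comp g) SubLin.zero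
  have h3 := ev_comp g Finset.univ (fun i _ => subLin_repw (f i))
    (fun i _ => subLin_add_repw (f i)) hg SubLin.zero
  exact h2.symm.trans (h3.trans h1)

theorem QQ_eq_zero_of_mem {Φ : (E → ℝ) → ℝ} (hVF : IsVF Φ) (hΦ : Van (Fintype.card ι + 1) Φ)
    {f : ι → DD E} (hf : ∏ i, dl (f i) ∈ JV E) : QQ Φ f = 0 := by
  obtain ⟨b, hb, H⟩ := mem_JJ.1 hf
  have hr : SubLin (∑ i, repw (f i)) := SubLin.sum _ fun i _ => subLin_repw _
  rw [← QQ_spec hΦ (fun i => subLin_repw (f i)) (fun i => subLin_add_repw (f i)) hb, add_comm]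
  exact H Φ hVF _ hr

theorem QQ_eq_zero_of_disjoint {Φ : (E → ℝ) → ℝ} (hVF : IsVF Φ)
    (hΦ : Van (Fintype.card ι + 1) Φ) {f : ι → DD E} {i j : ι} (hij : i ≠ j)
    (hi : ∀ x, 0 ≤ (f i : E → ℝ) x) (hj : ∀ x, 0 ≤ (f j : E → ℝ) x)
    (hd : ∀ x, (f i : E → ℝ) x = 0 ∨ (f j : E → ℝ) x = 0) : QQ Φ f = 0 := by
  refine QQ_eq_zero_of_mem hVF hΦ ?_
  rw [← Finset.mul_prod_erase Finset.univ _ (Finset.mem_univ i),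
    ← Finset.mul_prod_erase _ _ (Finset.mem_erase.2 ⟨hij.symm, Finset.mem_univ j⟩), ← mul_assoc]
  exact Ideal.mul_mem_right _ _ (dl_mul_dl_mem _ _ hi hj hd)

variable [FiniteDimensional ℝ E]

theorem exists_QQ_bound {Φ : (E → ℝ) → ℝ} (hVF : IsVF Φ) (hΦ : Van (Fintype.card ι + 1) Φ) :
    ∃ C, 0 ≤ C ∧ ∀ (f : ι → DD E) (u : ι → E → ℝ) (M : ι → ℝ), (∀ i, 0 < M i) →
      (∀ i, ContDiff ℝ 2 (u i)) → (∀ i, CB 2 (u i) (M i)) → (∀ i, (f i : E → ℝ) = HH (u i)) →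
      |QQ Φ f| ≤ C * ∏ i, M i := by
  obtain ⟨δ, hδ, hc⟩ := hVF.cont 0 SubLin.zero 1 one_pos
  set r : ℝ := δ / (Fintype.card ι + 1) with hr
  have hr0 : 0 < r := by positivity
  have hrc : r * Fintype.card ι ≤ δ := by
    rw [hr, div_mul_eq_mul_div, div_le_iff₀ (by positivity)]
    nlinarith
  set t : ℝ := r / 5 with ht
  have ht0 : 0 < t := by positivity
  refine ⟨(t⁻¹) ^ Fintype.card ι * (4 ^ Fintype.card ι * (|Φ 0| + 1)), by positivity,
    fun f u M hM hu hCB hf => ?_⟩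
  have hs : ∀ i, f i = (t⁻¹ * M i) • ((t * (M i)⁻¹) • f i) := fun i => by
    have := (hM i).ne'
    rw [smul_smul]
    field_simp
    rw [one_smul]
  have hQ : QQ Φ f = (∏ i, (t⁻¹ * M i)) * QQ Φ fun i => (t * (M i)⁻¹) • f i := by
    have := (QM hVF hΦ).map_smul_univ (fun i => t⁻¹ * M i) (fun i => (t * (M i)⁻¹) • f i)
    simp only [← hs, smul_eq_mul] at this
    exact this
  have hwS : SubLin (fun x : E => 4 * t * ‖x‖) := SubLin.norm.const_smul (by positivity)
  have hfS : ∀ i, SubLin ((((t * (M i)⁻¹) • f i : DD E) : E → ℝ) + fun x => 4 * t * ‖x‖) := by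
    intro i
    have h1 := (subLin_norm_add_HH (hu i) (hCB i)).const_smul (c := t * (M i)⁻¹)
      (by have := hM i; positivity)
    have := (hM i).ne'
    refine (congrArg SubLin (funext fun x => ?_)).mp h1
    simp only [Submodule.coe_smul, hf, Pi.smul_apply, Pi.add_apply, smul_eq_mul]
    field_simp; ring
  have hb := abs_ev_le (r := r) (R := 0) (A := |Φ 0| + 1) Finset.univ
    (f := fun i => (t * (M i)⁻¹) • f i) (w := fun _ x => 4 * t * ‖x‖) (fun i _ => hwS)
    (fun i _ => hfS i) ?_ ?_ (Φ := Φ) ?_ SubLin.zero (by simp)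
  · rw [QQ_spec hΦ (fun _ => hwS) hfS SubLin.zero, Finset.card_univ] at hb
    rw [hQ, abs_mul, Finset.abs_prod]
    have : ∏ i, |t⁻¹ * M i| = (t⁻¹) ^ Fintype.card ι * ∏ i, M i := by
      rw [← Finset.card_univ, ← Finset.prod_const, ← Finset.prod_mul_distrib]
      exact Finset.prod_congr rfl fun i _ => abs_of_pos (mul_pos (by positivity) (hM i))
    rw [this]
    have hP : 0 ≤ (t⁻¹) ^ Fintype.card ι * ∏ i, M i :=
      mul_nonneg (by positivity) (Finset.prod_nonneg fun i _ => (hM i).le)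
    calc _ ≤ (t⁻¹) ^ Fintype.card ι * (∏ i, M i) * (4 ^ Fintype.card ι * (|Φ 0| + 1)) := by
          gcongr
      _ = _ := by ring
  · intro i _ x
    rw [abs_of_nonneg (by positivity), ht]
    nlinarith [norm_nonneg x]
  · intro i _ x
    have h1 := (hCB i).abs_HH_le x
    have h2 := (hM i)
    simp only [Submodule.coe_smul, hf, Pi.smul_apply, Pi.add_apply, smul_eq_mul]
    refine (abs_add_le _ _).trans ?_
    rw [abs_of_nonneg (a := 4 * t * ‖x‖) (by positivity), abs_mul,
      abs_of_pos (a := t * (M i)⁻¹) (by positivity)]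
    have h3 : t * (M i)⁻¹ * |HH (u i) x| ≤ t * (M i)⁻¹ * (M i * ‖x‖) := by gcongr
    have h4 : t * (M i)⁻¹ * (M i * ‖x‖) = t * ‖x‖ := by field_simp
    have h5 : r = 5 * t := by rw [ht]; ring
    rw [h5]; linarith
  · intro h hh hb
    have h1 := hc h hh fun x => by
      refine (by simpa using hb x : |h x| ≤ _).trans ?_ |>.trans' ?_
      · exact mul_le_mul_of_nonneg_right hrc (norm_nonneg x)
      · simp
    have := abs_sub_abs_le_abs_sub (Φ h) (Φ 0)
    linarith

end

theorem van_of_QQ_smo {N j : ℕ} [FiniteDimensional ℝ E] {Φ : (E → ℝ) → ℝ} (hVF : IsVF Φ)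
    (hΦ : Van (j + 1) Φ)
    (H : ∀ f : Fin j → DD E, (∀ i, ∃ u : E → ℝ, ContDiff ℝ N u ∧ (f i : E → ℝ) = HH u) →
      QQ Φ f = 0) : Van j Φ := by
  intro L hL hlen h hh
  refine hVF.md_eq_zero_of_smo (N := N) (fun l hl hlen h hh => ?_) L hL hlen hh
  subst hlen
  let f : Fin l.length → DD E := fun i => (hl _ (l.get_mem i)).1.dd
  have hf := H f fun i => by
    obtain ⟨u, hu, he, -⟩ := (hl _ (l.get_mem i)).2
    exact ⟨u, hu, he⟩
  rw [← QQ_spec (by simpa using hΦ) (w := fun _ => 0) (fun _ => SubLin.zero)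
    (fun i => by rw [add_zero]; exact (hl _ (l.get_mem i)).1) hh] at hf
  rw [← hf, Finset.sum_const_zero, add_zero, ← List.prod_ofFn]
  have := ev_prod_dl Φ h (List.ofFn f)
  rw [List.map_ofFn, List.map_ofFn] at this
  refine Eq.trans ?_ this.symm
  congr 1
  exact (List.ofFn_get l).symm

end Kinematic

namespace Kinematic

open scoped RealInnerProductSpace

variable {E : Type*} [NormedAddCommGroup E] [InnerProductSpace ℝ E]

theorem CB.mul {m : ℕ} {u v : E → ℝ} {B C : ℝ} (hu : ContDiff ℝ m u) (hv : ContDiff ℝ m v)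
    (hB : CB m u B) (hC : CB m v C) : CB m (fun x => u x * v x) (2 ^ m * (B * C)) := by
  intro i hi x hx
  have hB0 := hB.nonneg
  have hC0 := hC.nonneg
  refine (norm_iteratedFDeriv_mul_le hu hv x (by exact_mod_cast hi)).trans ?_
  calc _ ≤ ∑ k ∈ Finset.range (i + 1), (i.choose k : ℝ) * B * C := by
        refine Finset.sum_le_sum fun k hk => ?_
        rw [Finset.mem_range] at hk
        gcongr
        · exact hB k (by omega) x hx
        · exact hC (i - k) (by omega) x hx
    _ = (∑ k ∈ Finset.range (i + 1), (i.choose k : ℝ)) * (B * C) := by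
        rw [Finset.sum_mul]; simp only [mul_assoc]
    _ = 2 ^ i * (B * C) := by
        rw [← Nat.cast_sum, Nat.sum_range_choose]; norm_num
    _ ≤ _ := by gcongr; norm_num

theorem CB.comp_isometry {m : ℕ} {u : E → ℝ} {B : ℝ} (hB : CB m u B) (g : E ≃ₗᵢ[ℝ] E) :
    CB m (fun x => u (g x)) B := by
  intro i hi x hx
  have := g.norm_iteratedFDeriv_comp_right u x i
  rw [show (fun x => u (g x)) = u ∘ g from rfl, this]
  exact hB i hi _ (by simpa using hx)

theorem HH_comp_isometry (u : E → ℝ) (g : E ≃ₗᵢ[ℝ] E) :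
    (fun x => HH u (g x)) = HH (fun x => u (g x)) := by
  ext x; simp [HH]

/-- A random family of linear maps which almost surely belongs to the set `S` of isometries, and
whose orbits of unit vectors are all equidistributed in the same way. -/
structure IsTransitiveFamily {Ω : Type*} [TopologicalSpace Ω] [MeasurableSpace Ω] (γ : Measure Ω)
    (A : Ω → E →L[ℝ] E) (S : Set (E ≃ₗᵢ[ℝ] E)) : Prop where
  cont : Continuous A
  mem : ∀ᵐ ω ∂γ, ∃ g ∈ S, ∀ x, A ω x = g x
  inv : ∀ η : E → ℝ, Continuous η → ∀ x y, ‖x‖ = 1 → ‖y‖ = 1 →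
    ∫ ω, η (A ω x) ∂γ = ∫ ω, η (A ω y) ∂γ

/-- The positively homogeneous extension of a function on the unit sphere. -/
def sphereExt (F : C(Metric.sphere (0 : E) 1, ℝ)) (x : E) : ℝ :=
  open Classical in
  if hx : x = 0 then 0 else ‖x‖ * F ⟨‖x‖⁻¹ • x, by simpa using norm_inv_smul_self hx⟩

theorem sphereExt_eq_HH {F : C(Metric.sphere (0 : E) 1, ℝ)} {u : E → ℝ} (h : ∀ x, F x = u x) :
    sphereExt F = HH u := by
  ext x
  rw [sphereExt]
  split_ifs with hx
  · rw [hx, HH_zero_apply]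
  · rw [h, HH]

theorem sphereExt_add (F G : C(Metric.sphere (0 : E) 1, ℝ)) :
    sphereExt (F + G) = sphereExt F + sphereExt G := by
  ext x
  simp only [sphereExt, Pi.add_apply]
  split_ifs with hx
  · simp
  · simp [mul_add]

theorem sphereExt_smul (c : ℝ) (F : C(Metric.sphere (0 : E) 1, ℝ)) :
    sphereExt (c • F) = c • sphereExt F := by
  ext x
  simp only [sphereExt, Pi.smul_apply, smul_eq_mul]
  split_ifs with hx
  · simp
  · simp [mul_left_comm]

variable [FiniteDimensional ℝ E]

theorem abs_sphereExt_sub_le (F G : C(Metric.sphere (0 : E) 1, ℝ)) (x : E) :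
    |sphereExt F x - sphereExt G x| ≤ dist F G * ‖x‖ := by
  rw [sphereExt, sphereExt]
  split_ifs with hx
  · simp [hx]
  · rw [← mul_sub, abs_mul, abs_norm, mul_comm]
    gcongr
    exact ContinuousMap.dist_apply_le_dist (f := F) (g := G) _

section

variable {ι : Type*} [DecidableEq ι] [Fintype ι]

theorem QQ_update_tendsto {Φ : (E → ℝ) → ℝ} (hVF : IsVF Φ) (hΦ : Van (Fintype.card ι + 1) Φ)
    (m : ι → DD E) (i : ι) {d : ℕ → DD E} {d' : DD E} {w : E → ℝ} (hw : SubLin w)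
    (hd : ∀ n, SubLin ((d n : E → ℝ) + w)) (hd' : SubLin ((d' : E → ℝ) + w)) {e : ℕ → ℝ}
    (he : Filter.Tendsto e Filter.atTop (nhds 0))
    (hb : ∀ n x, |(d n : E → ℝ) x - (d' : E → ℝ) x| ≤ e n * ‖x‖) :
    Filter.Tendsto (fun n => QQ Φ (Function.update m i (d n))) Filter.atTop
      (nhds (QQ Φ (Function.update m i d'))) := by
  have hΨ := isVF_ev_prod (Finset.univ.erase i) (fun j _ => subLin_repw (m j))
    (fun j _ => subLin_add_repw (m j)) hVF
  have key : ∀ x : DD E, SubLin ((x : E → ℝ) + w) → QQ Φ (Function.update m i x) =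
      ev Φ (((x : E → ℝ) + w) + ∑ j ∈ Finset.univ.erase i, repw (m j))
        (∏ j ∈ Finset.univ.erase i, dl (m j)) -
      ev Φ (w + ∑ j ∈ Finset.univ.erase i, repw (m j))
        (∏ j ∈ Finset.univ.erase i, dl (m j)) := by
    intro x hx
    rw [QQ_update hΦ m i x hw hx SubLin.zero, ev_dl_mul, zero_add]
    rw [add_right_comm, add_comm w]
  rw [key d' hd']
  simp only [key _ (hd _)]
  refine Filter.Tendsto.sub_const ?_ _
  exact hΨ.cont_seq hd' hd he fun n x => by simpa using hb n x

/-- Localisation by averaging over a transitive family of symmetries. -/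
theorem abs_mul_QQ_le {Ω : Type*} [TopologicalSpace Ω] [SecondCountableTopology Ω]
    [MeasurableSpace Ω] [BorelSpace Ω] {γ : Measure Ω} [IsProbabilityMeasure γ]
    {A : Ω → E →L[ℝ] E} {S : Set (E ≃ₗᵢ[ℝ] E)} (hA : IsTransitiveFamily γ A S)
    {Φ : (E → ℝ) → ℝ} (hVF : IsVF Φ) (hΦ : Van (Fintype.card ι + 1) Φ)
    (f : ι → DD E) (i : ι) {u η : E → ℝ} (hu : ContDiff ℝ 2 u) (hη : ContDiff ℝ 2 η)
    (hf : (f i : E → ℝ) = HH u) {c δ : ℝ} (hc : ∀ x, ‖x‖ = 1 → ∫ ω, η (A ω x) ∂γ = c)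
    (hδ : ∀ g ∈ S, ∀ d : DD E, (d : E → ℝ) = HH (fun x => η (g x) * u x) →
      |QQ Φ (Function.update f i d)| ≤ δ) : |c * QQ Φ f| ≤ δ := by
  obtain ⟨B, hB⟩ := exists_CB (m := 2) hu
  obtain ⟨C, hC⟩ := exists_CB (m := 2) hη
  set M : ℝ := 2 ^ 2 * (C * B) with hM
  have hg : ∀ g : E ≃ₗᵢ[ℝ] E, ContDiff ℝ 2 (fun x => η (g x)) := fun g =>
    hη.comp g.toContinuousLinearEquiv.contDiff
  have hCB : ∀ g : E ≃ₗᵢ[ℝ] E, CB 2 (fun x => η (g x) * u x) M := fun g =>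
    (hC.comp_isometry g).mul (by exact_mod_cast hg g) (by exact_mod_cast hu) hB
  have hM0 : 0 ≤ M := by have := hB.nonneg; have := hC.nonneg; positivity
  set w : E → ℝ := fun x => 4 * M * ‖x‖ with hw
  have hwS : SubLin w := SubLin.norm.const_smul (by positivity)
  let s : Set C(Metric.sphere (0 : E) 1, ℝ) := {F | SubLin (sphereExt F + w) ∧
    ∀ d : DD E, (d : E → ℝ) = sphereExt F → |QQ Φ (Function.update f i d)| ≤ δ}
  have hsd : ∀ F, SubLin (sphereExt F + w) → sphereExt F ∈ DD E := fun F hF =>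
    ⟨_, _, hF, hwS, by simp⟩
  have hconv : Convex ℝ s := by
    intro F hF G hG a b ha hb hab
    have e : sphereExt (a • F + b • G) = a • sphereExt F + b • sphereExt G := by
      rw [sphereExt_add, sphereExt_smul, sphereExt_smul]
    have e' : sphereExt (a • F + b • G) + w = a • (sphereExt F + w) + b • (sphereExt G + w) := by
      rw [e]
      ext x; simp only [Pi.add_apply, Pi.smul_apply, smul_eq_mul]
      linear_combination (-w x) * hab
    refine ⟨?_, fun d hd => ?_⟩
    · rw [e']; exact (hF.1.const_smul ha).add (hG.1.const_smul hb)
    · have : d = a • (⟨_, hsd F hF.1⟩ : DD E) + b • (⟨_, hsd G hG.1⟩ : DD E) := by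
        apply Subtype.ext; rw [hd, e]; rfl
      rw [this, QQ_update_add hΦ, QQ_update_smul hVF hΦ, QQ_update_smul hVF hΦ]
      have h1 := hF.2 ⟨_, hsd F hF.1⟩ rfl
      have h2 := hG.2 ⟨_, hsd G hG.1⟩ rfl
      rw [abs_le] at *
      constructor <;> nlinarith [h1.1, h1.2, h2.1, h2.2]
  have hclosed : IsClosed s := by
    refine IsSeqClosed.isClosed fun F G hF hFG => ?_
    have hS : SubLin (sphereExt G + w) := by
      refine SubLin.of_tendsto (fun n => (hF n).1) fun x => ?_
      refine Filter.Tendsto.add_const _ ?_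
      rw [tendsto_iff_dist_tendsto_zero]
      refine squeeze_zero (fun _ => dist_nonneg) (fun n => ?_)
        (by simpa using (tendsto_iff_dist_tendsto_zero.1 hFG).mul_const ‖x‖)
      exact abs_sphereExt_sub_le _ _ x
    refine ⟨hS, fun d hd => ?_⟩
    have := QQ_update_tendsto hVF hΦ f i (d := fun n => ⟨_, hsd _ (hF n).1⟩) (d' := d) hwS
      (fun n => (hF n).1) (by rw [hd]; exact hS) (tendsto_iff_dist_tendsto_zero.1 hFG)
      (fun n x => by rw [hd]; exact abs_sphereExt_sub_le _ _ x)
    exact le_of_tendsto' this.abs fun n => (hF n).2 _ rfl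
  let Fm : C(Ω × Metric.sphere (0 : E) 1, ℝ) := ⟨fun p => η (A p.1 p.2) * u p.2, by
    have h1 : Continuous fun p : Ω × Metric.sphere (0 : E) 1 => A p.1 (p.2 : E) :=
      (hA.cont.comp continuous_fst).clm_apply (continuous_subtype_val.comp continuous_snd)
    exact (hη.continuous.comp h1).mul
      (hu.continuous.comp (continuous_subtype_val.comp continuous_snd))⟩
  have hFm : ∀ᵐ ω ∂γ, ∃ g ∈ S, sphereExt (Fm.curry ω) = HH (fun x => η (g x) * u x) := by
    filter_upwards [hA.mem] with ω ⟨g, hgS, hg⟩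
    exact ⟨g, hgS, sphereExt_eq_HH fun x => by simp [Fm, hg]⟩
  have hmem : ∀ᵐ ω ∂γ, Fm.curry ω ∈ s := by
    filter_upwards [hFm] with ω ⟨g, hgS, e⟩
    refine ⟨?_, fun d hd => hδ g hgS d (hd.trans e)⟩
    rw [e, add_comm]
    exact subLin_norm_add_HH ((hg g).mul hu) (hCB g)
  have hint : Integrable (fun ω => Fm.curry ω) γ := by
    refine Integrable.of_bound Fm.curry.continuous.aestronglyMeasurable (C * B) ?_
    filter_upwards [hA.mem] with ω ⟨g, hgS, hg⟩
    rw [ContinuousMap.norm_le _ (mul_nonneg hC.nonneg hB.nonneg)]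
    intro x
    have hx : ‖(x : E)‖ = 1 := by simp
    simp only [Fm, ContinuousMap.curry_apply, ContinuousMap.coe_mk, hg, norm_mul, Real.norm_eq_abs]
    exact mul_le_mul (hC.abs_le (by simp [hx])) (hB.abs_le hx.le) (abs_nonneg _) hC.nonneg
  have hI := hconv.integral_mem hclosed hmem hint
  have e : sphereExt (∫ ω, Fm.curry ω ∂γ) = HH (c • u) := by
    refine sphereExt_eq_HH fun x => ?_
    rw [ContinuousMap.integral_apply hint]
    have hx : ‖(x : E)‖ = 1 := by simp
    simp only [Fm, ContinuousMap.curry_apply, ContinuousMap.coe_mk]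
    rw [integral_mul_const, hc _ hx, Pi.smul_apply, smul_eq_mul]
  have := hI.2 (c • f i) (by rw [e, HH_smul, Submodule.coe_smul, hf])
  rwa [QQ_update_smul hVF hΦ, Function.update_eq_self] at this

end

end Kinematic

namespace Kinematic

open scoped RealInnerProductSpace

variable {E : Type*} [NormedAddCommGroup E] [InnerProductSpace ℝ E] [FiniteDimensional ℝ E]

theorem IsTransitiveFamily.le_integral [MeasurableSpace E] [BorelSpace E]
    {Ω : Type*} [TopologicalSpace Ω] [SecondCountableTopology Ω]
    [MeasurableSpace Ω] [BorelSpace Ω] {γ : Measure Ω} [IsProbabilityMeasure γ]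
    {A : Ω → E →L[ℝ] E} {S : Set (E ≃ₗᵢ[ℝ] E)} (hA : IsTransitiveFamily γ A S) {e : E}
    (he : ‖e‖ = 1) {ε : ℝ} (hε : 0 < ε) (hε1 : ε ≤ 1) {η : E → ℝ} (hη : Continuous η)
    (h0 : ∀ x, 0 ≤ η x) (h1 : ∀ x, η x ≤ 1) (hηe : ∀ x, ‖x - e‖ ≤ ε → η x = 1) {c : ℝ}
    (hc : ∀ x, ‖x‖ = 1 → ∫ ω, η (A ω x) ∂γ = c) :
    ε ^ Module.finrank ℝ E ≤ 4 ^ Module.finrank ℝ E * c := by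
  set n := Module.finrank ℝ E
  let μ : Measure E := volume
  have hball : ∀ (x : E) (r : ℝ), 0 < r →
      μ.real (Metric.ball x r) = r ^ n * μ.real (Metric.ball 0 1) := fun x r hr => by
    rw [Measure.real, Measure.real, Measure.addHaar_ball_of_pos _ _ hr, ENNReal.toReal_mul,
      ENNReal.toReal_ofReal (by positivity)]
  have hc0 : 0 ≤ c := by rw [← hc e he]; exact integral_nonneg fun ω => h0 _
  set B : Set E := Metric.ball 0 2 \ {0} with hB
  have hBm : MeasurableSet B := Metric.isOpen_ball.measurableSet.diff (measurableSet_singleton 0)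
  have hfin : μ (Metric.ball 0 2) < ⊤ := measure_ball_lt_top
  have : IsFiniteMeasure (μ.restrict B) :=
    ⟨by rw [Measure.restrict_apply_univ]; exact (measure_mono Set.sdiff_subset).trans_lt hfin⟩
  have hmN : Measurable fun x : E => ‖x‖⁻¹ • x := by fun_prop
  have hmA : Measurable fun p : Ω × E => η (A p.1 (‖p.2‖⁻¹ • p.2)) := by
    have : Continuous fun p : Ω × E => η (A p.1 p.2) :=
      hη.comp ((hA.cont.comp continuous_fst).clm_apply continuous_snd)
    exact this.measurable.comp (measurable_fst.prodMk (hmN.comp measurable_snd))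
  have hint : Integrable (Function.uncurry fun (ω : Ω) (x : E) => η (A ω (‖x‖⁻¹ • x)))
      (γ.prod (μ.restrict B)) :=
    Integrable.of_bound hmA.aestronglyMeasurable 1 (Filter.Eventually.of_forall fun p => by
      simp only [Function.uncurry, Real.norm_eq_abs, abs_of_nonneg (h0 _)]; exact h1 _)
  have hsw := integral_integral_swap hint
  have hR : ∫ x in B, ∫ ω, η (A ω (‖x‖⁻¹ • x)) ∂γ ∂μ = μ.real B * c := by
    rw [setIntegral_congr_fun hBm (g := fun _ => c), setIntegral_const, smul_eq_mul]
    intro x hx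
    exact hc _ (norm_inv_smul_self (by simpa using hx.2))
  have hL : (ε / 2) ^ n * μ.real (Metric.ball 0 1) ≤
      ∫ ω, ∫ x in B, η (A ω (‖x‖⁻¹ • x)) ∂μ ∂γ := by
    have hconst : ∫ _ω, (ε / 2) ^ n * μ.real (Metric.ball 0 1) ∂γ =
        (ε / 2) ^ n * μ.real (Metric.ball 0 1) := by simp
    rw [← hconst]
    refine integral_mono_ae (integrable_const _) hint.integral_prod_left ?_
    filter_upwards [hA.mem] with ω ⟨g, _, hg⟩
    have hb : Metric.ball (g.symm e) (ε / 2) ⊆ B := by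
      intro x hx
      rw [Metric.mem_ball, dist_eq_norm] at hx
      have hge : ‖g.symm e‖ = 1 := by simpa using he
      have a1 := norm_sub_norm_le x (g.symm e)
      have a2 := norm_sub_norm_le (g.symm e) x
      rw [norm_sub_rev] at a2
      refine ⟨by rw [Metric.mem_ball, dist_zero_right]; linarith, ?_⟩
      rintro rfl
      rw [norm_zero] at a2; linarith
    have hge : ‖g.symm e‖ = 1 := by simpa using he
    have hm : Measurable fun x : E => η (A ω (‖x‖⁻¹ • x)) :=
      (hη.comp (A ω).continuous).measurable.comp hmN
    have hi : Integrable (fun x : E => η (A ω (‖x‖⁻¹ • x))) (μ.restrict B) :=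
      Integrable.of_bound hm.aestronglyMeasurable 1 (Filter.Eventually.of_forall fun p => by
        rw [Real.norm_eq_abs, abs_of_nonneg (h0 _)]; exact h1 _)
    calc (ε / 2) ^ n * μ.real (Metric.ball 0 1) = μ.real (Metric.ball (g.symm e) (ε / 2)) := by
          rw [hball (g.symm e) (ε / 2) (by positivity)]
      _ = ∫ x in Metric.ball (g.symm e) (ε / 2), (1 : ℝ) ∂μ := by simp
      _ = ∫ x in Metric.ball (g.symm e) (ε / 2), η (A ω (‖x‖⁻¹ • x)) ∂μ := by
          refine setIntegral_congr_fun measurableSet_ball fun x hx => ?_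
          refine (hηe _ ?_).symm
          have hx0 : x ≠ 0 := by simpa using (hb hx).2
          rw [Metric.mem_ball, dist_eq_norm] at hx
          have a0 := abs_norm_sub_norm_le x (g.symm e)
          rw [hge] at a0
          have e1 : ‖‖x‖⁻¹ • x - x‖ = |‖x‖ - 1| := by
            have : ‖x‖⁻¹ • x - x = (‖x‖⁻¹ * (1 - ‖x‖)) • x := by
              rw [mul_sub, inv_mul_cancel₀ (norm_ne_zero_iff.2 hx0), sub_smul]; simp
            rw [this, norm_smul, norm_mul, norm_inv, norm_norm, mul_right_comm,
              inv_mul_cancel₀ (norm_ne_zero_iff.2 hx0), one_mul, Real.norm_eq_abs, abs_sub_comm]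
          rw [hg]
          calc ‖g (‖x‖⁻¹ • x) - e‖ = ‖‖x‖⁻¹ • x - g.symm e‖ := by
                rw [← g.norm_map (‖x‖⁻¹ • x - g.symm e), map_sub, g.apply_symm_apply]
            _ = ‖(‖x‖⁻¹ • x - x) + (x - g.symm e)‖ := by rw [sub_add_sub_cancel]
            _ ≤ ε := by
                refine (norm_add_le _ _).trans ?_
                rw [e1]; linarith
      _ ≤ _ := setIntegral_mono_set hi (Filter.Eventually.of_forall fun x => h0 _)
          (Filter.Eventually.of_forall hb)
  rw [hsw, hR] at hL
  have hv : 0 < μ.real (Metric.ball 0 1) :=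
    ENNReal.toReal_pos (Metric.measure_ball_pos _ _ one_pos).ne' measure_ball_lt_top.ne
  have hB2 : μ.real B ≤ 2 ^ n * μ.real (Metric.ball 0 1) := by
    calc μ.real B ≤ μ.real (Metric.ball 0 2) := measureReal_mono Set.sdiff_subset hfin.ne
      _ = _ := hball _ _ two_pos
  have h3 : (ε / 2) ^ n * μ.real (Metric.ball 0 1) ≤ 2 ^ n * c * μ.real (Metric.ball 0 1) := by
    refine hL.trans ((mul_le_mul_of_nonneg_right hB2 hc0).trans_eq ?_)
    ring
  have h4 := le_of_mul_le_mul_right h3 hv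
  rw [div_pow, div_le_iff₀ (by positivity)] at h4
  refine h4.trans_eq ?_
  rw [show (4 : ℝ) = 2 * 2 by norm_num, mul_pow]; ring

end Kinematic

namespace Kinematic

open scoped RealInnerProductSpace

variable {E : Type*} [NormedAddCommGroup E] [InnerProductSpace ℝ E] [FiniteDimensional ℝ E]

/-- Smooth cut-offs at scale `ε` around `e`. -/
theorem exists_cutoff (r : ℝ) (hr : 0 < r) (N : ℕ) : ∃ b : E → ℝ → E → ℝ, ∃ K : ℝ, 0 ≤ K ∧
    ∀ e : E, ∀ ε : ℝ, 0 < ε → ContDiff ℝ N (b e ε) ∧ (∀ x, 0 ≤ b e ε x) ∧ (∀ x, b e ε x ≤ 1) ∧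
      (∀ x, ‖x - e‖ ≤ r * ε → b e ε x = 1) ∧ (∀ x, (r + 1) * ε ≤ ‖x - e‖ → b e ε x = 0) ∧
      ∀ i ≤ N, ∀ x, ‖iteratedFDeriv ℝ i (b e ε) x‖ ≤ K * (ε⁻¹) ^ i := by
  let B : ContDiffBump (0 : E) := ⟨r, r + 1, hr, by linarith⟩
  have hB : ContDiff ℝ N B := B.contDiff
  have hK : ∃ K : ℝ, 0 ≤ K ∧ ∀ i ≤ N, ∀ x, ‖iteratedFDeriv ℝ i B x‖ ≤ K := by
    have : ∀ i ≤ N, ∃ K : ℝ, ∀ x, ‖iteratedFDeriv ℝ i B x‖ ≤ K := fun i hi => by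
      obtain ⟨K, hK⟩ := (B.hasCompactSupport.iteratedFDeriv (𝕜 := ℝ) i).exists_bound_of_continuous
        (hB.continuous_iteratedFDeriv (m := i) (by exact_mod_cast hi))
      exact ⟨K, hK⟩
    choose! K hK using this
    refine ⟨∑ i ∈ Finset.range (N + 1), |K i|, Finset.sum_nonneg fun _ _ => abs_nonneg _,
      fun i hi x => ((hK i hi x).trans (le_abs_self _)).trans ?_⟩
    exact Finset.single_le_sum (f := fun i => |K i|) (fun _ _ => abs_nonneg _)
      (Finset.mem_range.2 (by omega))
  obtain ⟨K, hK0, hK⟩ := hK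
  refine ⟨fun e ε x => B (ε⁻¹ • (x - e)), K, hK0, fun e ε hε => ⟨?_, fun x => B.nonneg,
    fun x => B.le_one, fun x hx => ?_, fun x hx => ?_, fun i hi x => ?_⟩⟩
  · exact hB.comp (contDiff_const.smul (contDiff_id.sub contDiff_const))
  · refine B.one_of_mem_closedBall ?_
    rw [mem_closedBall_zero_iff, norm_smul, norm_inv, Real.norm_of_nonneg hε.le,
      inv_mul_le_iff₀ hε, mul_comm]
    exact hx
  · refine B.zero_of_le_dist ?_
    rw [dist_zero_right, norm_smul, norm_inv, Real.norm_of_nonneg hε.le, le_inv_mul_iff₀ hε,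
      mul_comm]
    exact hx
  · have h1 := iteratedFDeriv_comp_sub (𝕜 := ℝ) (f := fun z => B (ε⁻¹ • z)) i e x
    rw [h1, iteratedFDeriv_comp_const_smul _ (hB.of_le (by exact_mod_cast hi)), norm_smul,
      norm_pow, norm_inv, Real.norm_of_nonneg hε.le, mul_comm]
    gcongr
    exact hK i hi _

end Kinematic

namespace Kinematic

open scoped RealInnerProductSpace

variable {E : Type*} [NormedAddCommGroup E] [InnerProductSpace ℝ E]

theorem CB.add {m : ℕ} {u v : E → ℝ} {B C : ℝ} (hu : ContDiff ℝ m u) (hv : ContDiff ℝ m v)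
    (hB : CB m u B) (hC : CB m v C) : CB m (u + v) (B + C) := by
  intro i hi x hx
  rw [iteratedFDeriv_add_apply (hu.of_le (by exact_mod_cast hi)).contDiffAt
    (hv.of_le (by exact_mod_cast hi)).contDiffAt]
  exact (norm_add_le _ _).trans (add_le_add (hB i hi x hx) (hC i hi x hx))

theorem CB.const_smul {m : ℕ} {u : E → ℝ} {B : ℝ} (hu : ContDiff ℝ m u) (hB : CB m u B) (c : ℝ) :
    CB m (c • u) (|c| * B) := by
  intro i hi x hx
  rw [iteratedFDeriv_const_smul_apply (hu.of_le (by exact_mod_cast hi)).contDiffAt, norm_smul,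
    Real.norm_eq_abs]
  exact mul_le_mul_of_nonneg_left (hB i hi x hx) (abs_nonneg _)

theorem CB.zero (m : ℕ) : CB m (0 : E → ℝ) 0 := by
  intro i hi x hx
  rw [show (0 : E → ℝ) = fun _ => 0 from rfl, iteratedFDeriv_fun_zero]
  simp

theorem CB.sum {m : ℕ} {κ : Type*} (s : Finset κ) {u : κ → E → ℝ} {B : κ → ℝ}
    (hu : ∀ k, ContDiff ℝ m (u k)) (hB : ∀ k, CB m (u k) (B k)) :
    CB m (∑ k ∈ s, u k) (∑ k ∈ s, B k) ∧ ContDiff ℝ m (∑ k ∈ s, u k) := by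
  classical
  induction s using Finset.induction_on with
  | empty => exact ⟨CB.zero m, contDiff_const⟩
  | insert a s ha ih =>
    rw [Finset.sum_insert ha, Finset.sum_insert ha]
    exact ⟨(hB a).add (hu a) ih.2 ih.1, (hu a).add ih.2⟩

/-- Taylor estimate for a function whose jet of order `< N` vanishes at `e`. -/
theorem norm_iteratedFDeriv_le_of_jet_eq_zero {N : ℕ} {r : E → ℝ} {B : ℝ} (hr : ContDiff ℝ N r)
    (hB : CB N r B) {e : E} (he : ‖e‖ ≤ 1) (h0 : ∀ i < N, iteratedFDeriv ℝ i r e = 0) (k : ℕ)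
    (hk : k ≤ N) :
    ∀ x, ‖x‖ ≤ 1 → ‖iteratedFDeriv ℝ (N - k) r x‖ ≤ B * ‖x - e‖ ^ k := by
  induction k with
  | zero =>
    intro x hx
    simpa using hB N le_rfl x (by simpa using hx)
  | succ k ih =>
    intro x hx
    set s : Set E := Metric.closedBall 0 1 ∩ Metric.closedBall e ‖x - e‖
    have hs : Convex ℝ s := (convex_closedBall _ _).inter (convex_closedBall _ _)
    have hxs : x ∈ s := ⟨by simpa using hx, by rw [Metric.mem_closedBall, dist_eq_norm]⟩
    have hes : e ∈ s := ⟨by simpa using he, Metric.mem_closedBall_self (norm_nonneg _)⟩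
    have h1 := hs.norm_image_sub_le_of_norm_fderiv_le (𝕜 := ℝ)
      (f := iteratedFDeriv ℝ (N - (k + 1)) r) (C := B * ‖x - e‖ ^ k)
      (fun y _ => (hr.differentiable_iteratedFDeriv (m := N - (k + 1))
        (by exact_mod_cast (by omega : N - (k + 1) < N))) y) (fun y hy => ?_) hes hxs
    · rw [h0 _ (by omega), sub_zero] at h1
      rw [pow_succ, ← mul_assoc]; exact h1
    · rw [norm_fderiv_iteratedFDeriv, show N - (k + 1) + 1 = N - k by omega]
      refine (ih (by omega) y (by simpa using hy.1)).trans ?_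
      have := hB.nonneg
      have h2 : ‖y - e‖ ≤ ‖x - e‖ := by simpa [dist_eq_norm] using hy.2
      gcongr

/-- Products of a cut-off at scale `ε` with a function whose jet vanishes. -/
theorem CB.cutoff_mul {N : ℕ} (hN : 2 ≤ N) {b r : E → ℝ} {B K ρ ε : ℝ} (hr : ContDiff ℝ N r)
    (hB : CB N r B) {e : E} (he : ‖e‖ ≤ 1) (h0 : ∀ i < N, iteratedFDeriv ℝ i r e = 0)
    (hρ : 1 ≤ ρ) (hε : 0 < ε) (hε1 : ε ≤ 1) (hb : ContDiff ℝ 2 b) (hK : 0 ≤ K)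
    (hbK : ∀ i ≤ 2, ∀ x, ‖iteratedFDeriv ℝ i b x‖ ≤ K * (ε⁻¹) ^ i)
    (hb0 : ∀ x, ρ * ε ≤ ‖x - e‖ → b x = 0) :
    CB 2 (fun x => b x * r x) (2 ^ 2 * (K * B * ρ ^ N) * ε ^ (N - 2)) := by
  intro i hi x hx
  rw [mem_closedBall_zero_iff] at hx
  have hB0 := hB.nonneg
  rcases lt_or_ge (ρ * ε) ‖x - e‖ with h | h
  · have hz : (fun x => b x * r x) =ᶠ[nhds x] fun _ => 0 := by
      have : ∀ᶠ y in nhds x, ρ * ε < ‖y - e‖ :=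
        (continuous_id.sub continuous_const).norm.continuousAt.eventually_const_lt h
      filter_upwards [this] with y hy
      rw [hb0 y hy.le, zero_mul]
    rw [(hz.iteratedFDeriv ℝ i).eq_of_nhds, iteratedFDeriv_fun_zero]
    simp only [Pi.zero_apply, norm_zero]
    positivity
  · refine (norm_iteratedFDeriv_mul_le hb (hr.of_le (by exact_mod_cast hN)) x
      (by exact_mod_cast hi)).trans ?_
    calc _ ≤ ∑ k ∈ Finset.range (i + 1), (i.choose k : ℝ) * (K * B * ρ ^ N * ε ^ (N - 2)) := by
          refine Finset.sum_le_sum fun k hk => ?_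
          rw [Finset.mem_range] at hk
          rw [mul_assoc]
          refine mul_le_mul_of_nonneg_left ?_ (Nat.cast_nonneg _)
          have h1 := hbK k (by omega) x
          have h2 := norm_iteratedFDeriv_le_of_jet_eq_zero hr hB he h0 (N - (i - k)) (by omega) x hx
          rw [show N - (N - (i - k)) = i - k by omega] at h2
          calc _ ≤ K * (ε⁻¹) ^ k * (B * ‖x - e‖ ^ (N - (i - k))) :=
                mul_le_mul h1 h2 (norm_nonneg _) (by positivity)
            _ ≤ K * (ε⁻¹) ^ k * (B * (ρ * ε) ^ (N - (i - k))) := by gcongr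
            _ = K * B * ρ ^ (N - (i - k)) * ((ε⁻¹) ^ k * ε ^ (N - (i - k))) := by
                rw [mul_pow]; ring
            _ = K * B * ρ ^ (N - (i - k)) * ε ^ (N - i) := by
                rw [show N - (i - k) = k + (N - i) by omega, pow_add ε, ← mul_assoc ((ε⁻¹) ^ k),
                  ← mul_pow, inv_mul_cancel₀ hε.ne', one_pow, one_mul]
            _ ≤ K * B * ρ ^ N * ε ^ (N - 2) := by
                refine mul_le_mul ?_ (pow_le_pow_of_le_one hε.le hε1 (by omega)) (by positivity)
                  (by positivity)
                exact mul_le_mul_of_nonneg_left (pow_le_pow_right₀ hρ (by omega)) (by positivity)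
      _ = (∑ k ∈ Finset.range (i + 1), (i.choose k : ℝ)) * (K * B * ρ ^ N * ε ^ (N - 2)) := by
          rw [Finset.sum_mul]
      _ = 2 ^ i * (K * B * ρ ^ N * ε ^ (N - 2)) := by
          rw [← Nat.cast_sum, Nat.sum_range_choose]; norm_num
      _ ≤ 2 ^ 2 * (K * B * ρ ^ N * ε ^ (N - 2)) := by gcongr; norm_num
      _ = _ := by ring

theorem CB.of_cutoff {b : E → ℝ} {K ε : ℝ} (hε : 0 < ε) (hε1 : ε ≤ 1) (hK : 0 ≤ K)
    (hbK : ∀ i ≤ 2, ∀ x, ‖iteratedFDeriv ℝ i b x‖ ≤ K * (ε⁻¹) ^ i) :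
    CB 2 b (K * (ε⁻¹) ^ 2) := fun i hi x _ =>
  (hbK i hi x).trans (mul_le_mul_of_nonneg_left
    (pow_le_pow_right₀ ((one_le_inv₀ hε).2 hε1) hi) hK)

theorem finiteDimensional_continuousMultilinearMap [FiniteDimensional ℝ E] (i : ℕ) :
    FiniteDimensional ℝ (E [×i]→L[ℝ] ℝ) :=
  FiniteDimensional.of_injective
    (ContinuousMultilinearMap.toMultilinearMapLinear :
      (E [×i]→L[ℝ] ℝ) →ₗ[ℝ] MultilinearMap ℝ (fun _ : Fin i => E) ℝ)
    ContinuousMultilinearMap.toMultilinearMap_injective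

theorem exists_bounded_section {U J : Type*} [AddCommGroup U] [Module ℝ U] [NormedAddCommGroup J]
    [NormedSpace ℝ J] [FiniteDimensional ℝ J] (T : U →ₗ[ℝ] J) :
    ∃ (m : ℕ) (s : Fin m → U) (c : Fin m → U → ℝ) (K : Fin m → ℝ),
      (∀ a u, |c a u| ≤ K a * ‖T u‖) ∧ (∀ a, 0 ≤ K a) ∧
      ∀ u, T (∑ a, c a u • s a) = T u := by
  let β := Module.finBasis ℝ (LinearMap.range T)
  have hs : ∀ a, ∃ u, T u = β a := fun a => (β a).2
  choose s hs using hs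
  let c : ∀ a, LinearMap.range T →L[ℝ] ℝ := fun a => LinearMap.toContinuousLinearMap (β.coord a)
  refine ⟨_, s, fun a u => c a (T.rangeRestrict u), fun a => ‖c a‖, fun a u => ?_,
    fun a => norm_nonneg (c a), fun u => ?_⟩
  · exact (c a).le_opNorm (T.rangeRestrict u)
  · have h := congrArg Subtype.val (β.sum_repr (T.rangeRestrict u))
    rw [map_sum]
    simp only [map_smul, hs]
    rw [AddSubmonoidClass.coe_finsetSum] at h
    exact h

/-- A finite-dimensional space of functions realising all jets of order `< N` at `e`. -/
theorem exists_jet_space [FiniteDimensional ℝ E] (N : ℕ) (e : E) (he : ‖e‖ ≤ 1) :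
    ∃ P : Submodule ℝ (E → ℝ), FiniteDimensional ℝ P ∧ (∀ p ∈ P, ContDiff ℝ N p) ∧
      ∃ K : ℝ, 0 ≤ K ∧ ∀ (u : E → ℝ) (B : ℝ), ContDiff ℝ N u → CB N u B →
        ∃ p ∈ P, CB N p (K * B) ∧ ∀ i < N, iteratedFDeriv ℝ i (u - p) e = 0 := by
  have hfin : ∀ i, FiniteDimensional ℝ (E [×i]→L[ℝ] ℝ) := finiteDimensional_continuousMultilinearMap
  let U : Submodule ℝ (E → ℝ) :=
    { carrier := {u | ContDiff ℝ N u}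
      add_mem' := fun ha hb => by
        rw [Set.mem_ofPred_eq] at *; exact ha.add hb
      zero_mem' := by
        rw [Set.mem_ofPred_eq]; exact contDiff_const
      smul_mem' := fun c u hu => by
        rw [Set.mem_ofPred_eq] at *; exact hu.const_smul c }
  have hUc : ∀ u : U, ContDiff ℝ N (u : E → ℝ) := fun u =>
    (Set.mem_ofPred_eq (p := fun u : E → ℝ => ContDiff ℝ N u)).mp u.2
  have hU : ∀ (u : U) (i : Fin N), ContDiffAt ℝ (i : ℕ) (u : E → ℝ) e := fun u i =>
    ((hUc u).of_le (by exact_mod_cast i.2.le)).contDiffAt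
  let T : U →ₗ[ℝ] (∀ i : Fin N, E [×(i : ℕ)]→L[ℝ] ℝ) :=
    { toFun := fun u i => iteratedFDeriv ℝ i (u : E → ℝ) e
      map_add' := fun u v => by
        ext1 i; exact iteratedFDeriv_add_apply (hU u i) (hU v i)
      map_smul' := fun c u => by
        ext1 i; exact iteratedFDeriv_const_smul_apply (hU u i) }
  obtain ⟨m, s, c, K, hc, hK, hT⟩ := exists_bounded_section T
  have hs : ∀ a, ∃ B, CB N (s a : E → ℝ) B := fun a => exists_CB (hUc (s a))
  choose C hC using hs
  refine ⟨Submodule.span ℝ (Set.range fun a => (s a : E → ℝ)),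
    FiniteDimensional.span_of_finite ℝ (Set.finite_range _), fun p hp => ?_,
    ∑ a, K a * C a, Finset.sum_nonneg fun a _ => mul_nonneg (hK a) (hC a).nonneg,
    fun u B hu hB => ?_⟩
  · have : Submodule.span ℝ (Set.range fun a => (s a : E → ℝ)) ≤ U := by
      rw [Submodule.span_le]; rintro _ ⟨a, rfl⟩; exact (s a).2
    exact hUc ⟨p, this hp⟩
  set u' : U := ⟨u, (Set.mem_ofPred_eq (p := fun u : E → ℝ => ContDiff ℝ N u)).mpr hu⟩
  refine ⟨∑ a, c a u' • (s a : E → ℝ), Submodule.sum_mem _ fun a _ => Submodule.smul_mem _ _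
    (Submodule.subset_span ⟨a, rfl⟩), ?_, fun i hi => ?_⟩
  · have hB0 := hB.nonneg
    have hn : ‖T u'‖ ≤ B := by
      rw [pi_norm_le_iff_of_nonneg hB0]
      exact fun i => hB i i.2.le e (by simpa using he)
    have h1 := CB.sum (m := N) Finset.univ (u := fun a => c a u' • (s a : E → ℝ))
      (B := fun a => |c a u'| * C a) (fun a => (hUc (s a)).const_smul (c a u'))
      (fun a => (hC a).const_smul (hUc (s a)) _)
    refine h1.1.mono le_rfl ?_
    rw [Finset.sum_mul]
    refine Finset.sum_le_sum fun a _ => ?_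
    have h4 := (hC a).nonneg
    have h5 := hK a
    calc |c a u'| * C a ≤ (K a * B) * C a := by
          gcongr
          exact (hc a u').trans (by gcongr)
      _ = _ := by ring
  · have h3 := congrFun (hT u') ⟨i, hi⟩
    have h4 : ((∑ a, c a u' • s a : U) : E → ℝ) = ∑ a, c a u' • (s a : E → ℝ) := by
      simp
    rw [iteratedFDeriv_sub_apply (hU u' ⟨i, hi⟩) (h4 ▸ hU (∑ a, c a u' • s a) ⟨i, hi⟩)]
    rw [← h4]
    exact sub_eq_zero.2 h3.symm

end Kinematic

namespace Kinematic

open scoped RealInnerProductSpace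

variable {E : Type*} [NormedAddCommGroup E] [InnerProductSpace ℝ E] [FiniteDimensional ℝ E]

/-- The homogeneous extension of a smooth function as an element of `DD`. -/
def smoothDD (u : E → ℝ) (hu : ContDiff ℝ 2 u) : DD E := ⟨HH u, contDiff_HH_mem_DD hu⟩

theorem smoothDD_coe (u : E → ℝ) (hu : ContDiff ℝ 2 u) : (smoothDD u hu : E → ℝ) = HH u := rfl

section

variable {ι : Type*} [DecidableEq ι] [Fintype ι]

theorem QQ_eq_zero_of_cutoffs {Φ : (E → ℝ) → ℝ} (hVF : IsVF Φ)
    (hΦ : Van (Fintype.card ι + 1) Φ) {f : ι → DD E} {i j : ι} (hij : i ≠ j) {a b v w : E → ℝ}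
    (ha : ContDiff ℝ 2 a) (hb : ContDiff ℝ 2 b) (hv : ContDiff ℝ 2 v) (hw : ContDiff ℝ 2 w)
    (ha0 : ∀ x, 0 ≤ a x) (hb0 : ∀ x, 0 ≤ b x) (hab : ∀ x, a x = 0 ∨ b x = 0)
    (hi : (f i : E → ℝ) = HH (fun x => a x * v x))
    (hj : (f j : E → ℝ) = HH (fun x => b x * w x)) : QQ Φ f = 0 := by
  have hnn : ∀ {a v : E → ℝ}, (∀ x, 0 ≤ a x) → (∀ x, ‖x‖ = 1 → 0 ≤ v x) → ∀ x,
      0 ≤ HH (fun x => a x * v x) x := by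
    intro a v ha hv x
    rcases eq_or_ne x 0 with rfl | hx
    · rw [HH_zero_apply]
    · exact mul_nonneg (norm_nonneg _) (mul_nonneg (ha _) (hv _ (norm_inv_smul_self hx)))
  have hz : ∀ {v w : E → ℝ}, ∀ x, HH (fun x => a x * v x) x = 0 ∨ HH (fun x => b x * w x) x = 0 := by
    intro v w x
    rcases hab (‖x‖⁻¹ • x) with h | h
    · left; simp [HH, h]
    · right; simp [HH, h]
  have hsplit : ∀ {a v : E → ℝ} {B : ℝ}, HH (fun x => a x * v x) =
      HH (fun x => a x * (v x + B)) - HH (fun x => a x * B) := by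
    intro a v B
    rw [← HH_sub]
    congr 1; ext x; simp only [Pi.sub_apply]; ring
  obtain ⟨B, hB⟩ := exists_CB (m := 2) hv
  obtain ⟨C, hC⟩ := exists_CB (m := 2) hw
  have hB' : ∀ x, ‖x‖ = 1 → 0 ≤ v x + B := fun x hx => by
    have := neg_le_of_abs_le (hB.abs_le hx.le); linarith
  have hC' : ∀ x, ‖x‖ = 1 → 0 ≤ w x + C := fun x hx => by
    have := neg_le_of_abs_le (hC.abs_le hx.le); linarith
  have key : ∀ (f : ι → DD E) (v : E → ℝ), (∀ x, ‖x‖ = 1 → 0 ≤ v x) →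
      (f i : E → ℝ) = HH (fun x => a x * v x) →
      (f j : E → ℝ) = HH (fun x => b x * w x) → QQ Φ f = 0 := by
    intro f v hv0 hi hj
    have e : f j = smoothDD (fun x => b x * (w x + C)) (hb.mul (hw.add contDiff_const)) +
        (-1 : ℝ) • smoothDD (fun x => b x * C) (hb.mul contDiff_const) := by
      apply Subtype.ext
      rw [hj, hsplit (B := C)]; ext x
      simp only [Submodule.coe_add, Submodule.coe_smul, smoothDD_coe, Pi.sub_apply, Pi.add_apply,
        Pi.smul_apply, smul_eq_mul]; ring
    rw [← Function.update_eq_self j f, e, QQ_update_add hΦ, QQ_update_smul hVF hΦ]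
    rw [QQ_eq_zero_of_disjoint hVF hΦ hij, QQ_eq_zero_of_disjoint hVF hΦ hij]
    · simp
    all_goals simp only [Function.update_self, Function.update_of_ne hij, smoothDD_coe, hi]
    · exact hnn ha0 hv0
    · exact hnn hb0 fun x _ => hC.nonneg
    · exact hz
    · exact hnn ha0 hv0
    · exact hnn hb0 hC'
    · exact hz
  have e : f i = smoothDD (fun x => a x * (v x + B)) (ha.mul (hv.add contDiff_const)) +
      (-1 : ℝ) • smoothDD (fun x => a x * B) (ha.mul contDiff_const) := by
    apply Subtype.ext
    rw [hi, hsplit (B := B)]; ext x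
    simp only [Submodule.coe_add, Submodule.coe_smul, smoothDD_coe, Pi.sub_apply, Pi.add_apply,
      Pi.smul_apply, smul_eq_mul]; ring
  rw [← Function.update_eq_self i f, e, QQ_update_add hΦ, QQ_update_smul hVF hΦ,
    key _ (fun x => v x + B) hB', key _ (fun _ => B) fun x _ => hB.nonneg]
  · simp
  all_goals simp only [Function.update_self, Function.update_of_ne hij.symm, smoothDD_coe, hj]

theorem QQ_eq_QQ_cutoff {Φ : (E → ℝ) → ℝ} (hVF : IsVF Φ)
    (hΦ : Van (Fintype.card ι + 1) Φ) (i₀ : ι) {η χ : E → ℝ} {v : ι → E → ℝ}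
    (hη : ContDiff ℝ 2 η) (hχ : ContDiff ℝ 2 χ) (hv : ∀ i, ContDiff ℝ 2 (v i))
    (hη0 : ∀ x, 0 ≤ η x) (hχ1 : ∀ x, χ x ≤ 1) (hd : ∀ x, η x = 0 ∨ χ x = 1) {f F : ι → DD E}
    (hf0 : (f i₀ : E → ℝ) = HH (fun x => η x * v i₀ x)) (hF0 : f i₀ = F i₀)
    (hf : ∀ i ≠ i₀, (f i : E → ℝ) = HH (v i))
    (hF : ∀ i ≠ i₀, (F i : E → ℝ) = HH (fun x => χ x * v i x)) : QQ Φ f = QQ Φ F := by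
  have key : ∀ s : Finset ι, QQ Φ f = QQ Φ (s.piecewise F f) := by
    intro s
    induction s using Finset.induction_on with
    | empty => rw [Finset.piecewise_empty]
    | insert i s hi ih =>
      rw [ih, Finset.piecewise_insert]
      rcases eq_or_ne i i₀ with rfl | hii
      · rw [← hF0]
        congr 1
        conv_lhs => rw [← Function.update_eq_self i (s.piecewise F f),
          Finset.piecewise_eq_of_notMem _ _ _ hi]
      · have hc : ContDiff ℝ 2 fun x => 1 - χ x := contDiff_const.sub hχ
        have e : s.piecewise F f i = F i + smoothDD (fun x => (1 - χ x) * v i x) (hc.mul (hv i)) := by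
          rw [Finset.piecewise_eq_of_notMem _ _ _ hi]
          apply Subtype.ext
          rw [hf i hii, Submodule.coe_add, hF i hii, smoothDD_coe, ← HH_add]
          congr 1; ext x; simp only [Pi.add_apply]; ring
        conv_lhs => rw [← Function.update_eq_self i (s.piecewise F f), e]
        rw [QQ_update_add hΦ, add_eq_left]
        refine QQ_eq_zero_of_cutoffs hVF hΦ (i := i₀) (j := i) hii.symm hη hc (hv i₀) (hv i) hη0
          (fun x => by linarith [hχ1 x]) (fun x => (hd x).imp_right fun h => by rw [h, sub_self])
          ?_ (by rw [Function.update_self, smoothDD_coe])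
        rw [Function.update_of_ne hii.symm]
        by_cases h : i₀ ∈ s
        · rw [Finset.piecewise_eq_of_mem _ _ _ h, ← hF0, hf0]
        · rw [Finset.piecewise_eq_of_notMem _ _ _ h, hf0]
  rw [key Finset.univ, Finset.piecewise_univ]

end

end Kinematic

namespace Kinematic

open scoped RealInnerProductSpace

variable {E : Type*} [NormedAddCommGroup E] [InnerProductSpace ℝ E] [FiniteDimensional ℝ E]
variable {ι : Type*} [DecidableEq ι] [Fintype ι]

/-- `C` bounds the multilinear form `QQ Φ` by the `C²` norms of its arguments. -/
def QBound (ι : Type*) [Fintype ι] (Φ : (E → ℝ) → ℝ) (C : ℝ) : Prop :=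
  ∀ (f : ι → DD E) (u : ι → E → ℝ) (M : ι → ℝ), (∀ i, 0 < M i) →
    (∀ i, ContDiff ℝ 2 (u i)) → (∀ i, CB 2 (u i) (M i)) → (∀ i, (f i : E → ℝ) = HH (u i)) →
    |QQ Φ f| ≤ C * ∏ i, M i

theorem CB.sub {m : ℕ} {u v : E → ℝ} {B C : ℝ} (hu : ContDiff ℝ m u) (hv : ContDiff ℝ m v)
    (hB : CB m u B) (hC : CB m v C) : CB m (u - v) (B + C) := by
  have h := hB.add hu (hv.const_smul (-1 : ℝ)) (hC.const_smul hv (-1))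
  have e : u + (-1 : ℝ) • v = u - v := by ext x; simp; ring
  rw [abs_neg, abs_one, one_mul] at h
  rw [← e]
  exact h

/-- Expansion of the multilinear form around a family on which it vanishes. -/
theorem abs_QQ_add_le {Φ : (E → ℝ) → ℝ} (hVF : IsVF Φ) (hΦ : Van (Fintype.card ι + 1) Φ)
    {C : ℝ} (hC0 : 0 ≤ C) (hC : QBound ι Φ C) {a b : ι → DD E} {u v : ι → E → ℝ} {T τ : ℝ}
    (hT : 0 < T) (hτ : 0 < τ) (hτ1 : τ ≤ 1) (hu : ∀ i, ContDiff ℝ 2 (u i))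
    (hv : ∀ i, ContDiff ℝ 2 (v i)) (hBu : ∀ i, CB 2 (u i) (T * τ)) (hBv : ∀ i, CB 2 (v i) T)
    (ha : ∀ i, (a i : E → ℝ) = HH (u i)) (hb : ∀ i, (b i : E → ℝ) = HH (v i))
    (h0 : QQ Φ b = 0) :
    |QQ Φ (a + b)| ≤ 2 ^ Fintype.card ι * (C * (T ^ Fintype.card ι * τ)) := by
  have e := (QM hVF hΦ).map_add_univ a b
  rw [show QQ Φ (a + b) = QM hVF hΦ (a + b) from rfl, e]
  have hcard : (2 : ℝ) ^ Fintype.card ι = (Finset.univ : Finset (Finset ι)).card := by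
    rw [Finset.card_univ, Fintype.card_finset]; norm_num
  rw [hcard, ← nsmul_eq_mul]
  refine (Finset.abs_sum_le_sum_abs _ _).trans (Finset.sum_le_card_nsmul _ _ _ fun s _ => ?_)
  change |QQ Φ (s.piecewise a b)| ≤ _
  rcases s.eq_empty_or_nonempty with rfl | ⟨k, hk⟩
  · rw [Finset.piecewise_empty, h0, abs_zero]; positivity
  · have h := hC (s.piecewise a b) (s.piecewise u v) (fun i => T * if i ∈ s then τ else 1)
      (fun i => by split_ifs <;> positivity)
      (fun i => by
        by_cases hi : i ∈ s
        · simp only [Finset.piecewise_eq_of_mem _ _ _ hi, hu i]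
        · simp only [Finset.piecewise_eq_of_notMem _ _ _ hi, hv i])
      (fun i => by
        by_cases hi : i ∈ s
        · simp only [Finset.piecewise_eq_of_mem _ _ _ hi, if_pos hi, hBu i]
        · simp only [Finset.piecewise_eq_of_notMem _ _ _ hi, if_neg hi, mul_one, hBv i])
      (fun i => by
        by_cases hi : i ∈ s
        · simp only [Finset.piecewise_eq_of_mem _ _ _ hi, ha i]
        · simp only [Finset.piecewise_eq_of_notMem _ _ _ hi, hb i])
    refine h.trans (mul_le_mul_of_nonneg_left ?_ hC0)
    rw [Finset.prod_mul_distrib, Finset.prod_const, Finset.card_univ]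
    refine mul_le_mul_of_nonneg_left ?_ (by positivity)
    rw [← Finset.mul_prod_erase _ _ (Finset.mem_univ k), if_pos hk]
    refine mul_le_of_le_one_right hτ.le (Finset.prod_le_one (fun i _ => ?_) fun i _ => ?_)
    · split_ifs <;> positivity
    · split_ifs <;> linarith

/-- Localization of a jet space: the functions `HH (b * p)` for `p` in `P`. -/
def cutMap {N : ℕ} (hN : 2 ≤ N) (P : Submodule ℝ (E → ℝ)) (hP : ∀ p ∈ P, ContDiff ℝ N p)
    {b : E → ℝ} (hb : ContDiff ℝ N b) : P →ₗ[ℝ] DD E where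
  toFun p := smoothDD (fun x => b x * (p : E → ℝ) x)
    ((hb.mul (hP p p.2)).of_le (by exact_mod_cast hN))
  map_add' p q := by
    apply Subtype.ext
    ext x
    simp only [Submodule.coe_add, smoothDD_coe, Pi.add_apply, HH]
    ring
  map_smul' c p := by
    apply Subtype.ext
    ext x
    simp only [Submodule.coe_smul, smoothDD_coe, Pi.smul_apply, smul_eq_mul, RingHom.id_apply, HH]
    ring

theorem cutMap_coe {N : ℕ} (hN : 2 ≤ N) (P : Submodule ℝ (E → ℝ)) (hP : ∀ p ∈ P, ContDiff ℝ N p)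
    {b : E → ℝ} (hb : ContDiff ℝ N b) (p : P) :
    (cutMap hN P hP hb p : E → ℝ) = HH (fun x => b x * (p : E → ℝ) x) := rfl

/-- An invariant form which vanishes on localized jets at scale `ε` is of order `ε`. -/
theorem exists_localized_jets [MeasurableSpace E] [BorelSpace E]
    {Ω : Type*} [TopologicalSpace Ω] [SecondCountableTopology Ω]
    [MeasurableSpace Ω] [BorelSpace Ω] {γ : Measure Ω} [IsProbabilityMeasure γ]
    {A : Ω → E →L[ℝ] E} {S : Set (E ≃ₗᵢ[ℝ] E)} (hA : IsTransitiveFamily γ A S) (i₀ : ι)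
    {e : E} (he : ‖e‖ = 1) {N : ℕ} (hN : N = Module.finrank ℝ E + 2 * Fintype.card ι + 1) :
    ∃ P : Submodule ℝ (E → ℝ), FiniteDimensional ℝ P ∧
      ∃ L : ℝ → ι → P →ₗ[ℝ] DD E, ∀ B : ℝ, 0 ≤ B → ∃ R : ℝ, ∀ Φ : (E → ℝ) → ℝ, IsVF Φ →
        Van (Fintype.card ι + 1) Φ → (∀ g ∈ S, ∀ h, SubLin h → Φ (fun x => h (g x)) = Φ h) →
        ∀ C, 0 ≤ C → QBound ι Φ C → ∀ ε, 0 < ε → ε ≤ 1 →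
        (∀ t : ι → P, QQ Φ (fun i => L ε i (t i)) = 0) → ∀ f : ι → DD E, ∀ u : ι → E → ℝ,
        (∀ i, ContDiff ℝ N (u i)) → (∀ i, CB N (u i) B) → (∀ i, (f i : E → ℝ) = HH (u i)) →
        |QQ Φ f| ≤ R * C * ε := by
  set n := Module.finrank ℝ E with hn
  set j := Fintype.card ι with hj
  have hj1 : 1 ≤ j := Fintype.card_pos_iff.2 ⟨i₀⟩
  have hN2 : 2 ≤ N := by omega
  obtain ⟨P, hPfin, hP, KP, hKP0, hKP⟩ := exists_jet_space N e he.le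
  obtain ⟨η, K₁, hK₁, hη⟩ := exists_cutoff (E := E) 1 one_pos N
  obtain ⟨χ, K₂, hK₂, hχ⟩ := exists_cutoff (E := E) 2 two_pos N
  set K := max K₁ K₂ with hK
  have hK0 : 0 ≤ K := hK₁.trans (le_max_left _ _)
  let b : ℝ → ι → E → ℝ := fun ε i => if i = i₀ then η e ε else χ e ε
  have hb : ∀ ε i, 0 < ε → ContDiff ℝ N (b ε i) ∧ (∀ x, 3 * ε ≤ ‖x - e‖ → b ε i x = 0) ∧
      ∀ k ≤ N, ∀ x, ‖iteratedFDeriv ℝ k (b ε i) x‖ ≤ K * (ε⁻¹) ^ k := by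
    intro ε i hε
    by_cases hi : i = i₀
    · simp only [b, if_pos hi]
      obtain ⟨h1, -, -, -, h2, h3⟩ := hη e ε hε
      refine ⟨h1, fun x hx => h2 x (by linarith), fun k hk x => (h3 k hk x).trans ?_⟩
      exact mul_le_mul_of_nonneg_right (le_max_left _ _) (by positivity)
    · simp only [b, if_neg hi]
      obtain ⟨h1, -, -, -, h2, h3⟩ := hχ e ε hε
      refine ⟨h1, fun x hx => h2 x (by linarith), fun k hk x => (h3 k hk x).trans ?_⟩
      exact mul_le_mul_of_nonneg_right (le_max_right _ _) (by positivity)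
  refine ⟨P, hPfin, fun ε i => if hε : 0 < ε then cutMap hN2 P hP (hb ε i hε).1 else 0, ?_⟩
  intro B hB
  set T₀ : ℝ := 2 ^ 2 * (K * (B + KP * B) * 3 ^ N) + 1 with hT₀
  have hT₀0 : 0 < T₀ := by positivity
  refine ⟨4 ^ n * (2 ^ j * T₀ ^ j), ?_⟩
  intro Φ hVF hΦ hinv C hC0 hC ε hε hε1 hzero f u hu hBu hf
  simp only [dif_pos hε] at hzero
  obtain ⟨hη1, hη2, hη3, hη4, hη5, hη6⟩ := hη e ε hε
  obtain ⟨hχ1, hχ2, hχ3, hχ4, hχ5, hχ6⟩ := hχ e ε hε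
  have h2N : (2 : WithTop ℕ∞) ≤ N := by exact_mod_cast hN2
  have hc : ∀ x, ‖x‖ = 1 → ∫ ω, η e ε (A ω x) ∂γ = ∫ ω, η e ε (A ω e) ∂γ := fun x hx =>
    hA.inv _ hη1.continuous x e hx he
  have hlow := hA.le_integral he hε hε1 hη1.continuous hη2 hη3
    (fun x hx => hη4 x (by linarith)) hc
  set c := ∫ ω, η e ε (A ω e) ∂γ
  set T : ℝ := T₀ * (ε⁻¹) ^ 2 with hT
  have hT0 : 0 < T := by positivity
  have hmain := abs_mul_QQ_le hA hVF hΦ f i₀ ((hu i₀).of_le h2N) (hη1.of_le h2N) (hf i₀)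
    (δ := 2 ^ j * (C * (T ^ j * ε ^ N))) hc ?_
  · have hεn : 0 < ε ^ n := by positivity
    have e1 : ε ^ n * |QQ Φ f| ≤ 4 ^ n * (2 ^ j * (C * (T ^ j * ε ^ N))) := by
      calc ε ^ n * |QQ Φ f| ≤ (4 ^ n * c) * |QQ Φ f| :=
            mul_le_mul_of_nonneg_right hlow (abs_nonneg _)
        _ ≤ 4 ^ n * |c * QQ Φ f| := by
            rw [abs_mul, mul_assoc]
            gcongr
            exact le_abs_self c
        _ ≤ _ := mul_le_mul_of_nonneg_left hmain (by positivity)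
    have e2 : 4 ^ n * (2 ^ j * (C * (T ^ j * ε ^ N))) =
        ε ^ n * (4 ^ n * (2 ^ j * T₀ ^ j) * C * ε) := by
      have e3 : (ε⁻¹ ^ 2) ^ j * ε ^ (2 * j) = 1 := by
        rw [← pow_mul, ← mul_pow, inv_mul_cancel₀ hε.ne', one_pow]
      rw [hT, hN, mul_pow, pow_add, pow_add]
      linear_combination (4 ^ n * 2 ^ j * C * T₀ ^ j * ε ^ n * ε ^ 1) * e3
    rw [e2] at e1
    exact le_of_mul_le_mul_left e1 hεn
  intro g hg d hd
  have hgs : ∀ h, SubLin h → Φ (fun x => h ((g.symm.toLinearEquiv : E →ₗ[ℝ] E) x)) = Φ h := by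
    intro h hh
    have := hinv g hg _ (hh.comp (g.symm.toLinearEquiv : E →ₗ[ℝ] E))
    rw [← this]
    congr 1; ext x; simp
  set v : ι → E → ℝ := fun i x => u i (g.symm x) with hv
  have hvs : ∀ i, ContDiff ℝ N (v i) := fun i =>
    (hu i).comp g.symm.toContinuousLinearEquiv.contDiff
  have hvB : ∀ i, CB N (v i) B := fun i => (hBu i).comp_isometry g.symm
  choose p hpP hpB hp using fun i => hKP (v i) B (hvs i) (hvB i)
  have hb2 : ∀ i, ContDiff ℝ 2 (b ε i) := fun i => (hb ε i hε).1.of_le h2N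
  have hp2 : ∀ i, ContDiff ℝ 2 (p i) := fun i => (hP _ (hpP i)).of_le h2N
  have hr : ∀ i, ContDiff ℝ N (v i - p i) := fun i => (hvs i).sub (hP _ (hpP i))
  have hrB : ∀ i, CB N (v i - p i) (B + KP * B) := fun i =>
    (hvB i).sub (hvs i) (hP _ (hpP i)) (hpB i)
  rw [← QQ_comp hΦ _ hgs]
  set a : ι → DD E := fun i => smoothDD (fun x => b ε i x * (v i - p i) x)
    ((hb2 i).mul ((hr i).of_le h2N)) with ha
  set q : ι → DD E := fun i => cutMap hN2 P hP (hb ε i hε).1 ⟨p i, hpP i⟩ with hq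
  have haq : ∀ i, ((a + q) i : E → ℝ) = HH (fun x => b ε i x * v i x) := by
    intro i
    rw [Pi.add_apply, Submodule.coe_add, ha, hq, smoothDD_coe, cutMap_coe, ← HH_add]
    congr 1; ext x; simp only [Pi.add_apply, Pi.sub_apply]; ring
  have hcut : QQ Φ (fun i => DD.comp (g.symm.toLinearEquiv : E →ₗ[ℝ] E)
      (Function.update f i₀ d i)) = QQ Φ (a + q) := by
    have hd' : ((DD.comp (g.symm.toLinearEquiv : E →ₗ[ℝ] E)
        (Function.update f i₀ d i₀) : DD E) : E → ℝ) = HH (fun x => η e ε x * v i₀ x) := by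
      rw [Function.update_self]
      change (fun x => (d : E → ℝ) (g.symm x)) = _
      rw [hd, HH_comp_isometry]
      simp [hv]
    refine QQ_eq_QQ_cutoff hVF hΦ i₀ (v := v) (hη1.of_le h2N) (hχ1.of_le h2N)
      (fun i => (hvs i).of_le h2N) hη2 hχ3 (fun x => ?_) hd' ?_ ?_ ?_
    · rcases le_total ‖x - e‖ (2 * ε) with h | h
      · exact Or.inr (hχ4 x h)
      · exact Or.inl (hη5 x (by linarith))
    · apply Subtype.ext
      rw [hd', haq]; simp [b]
    · intro i hi
      rw [Function.update_of_ne hi]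
      change (fun x => (f i : E → ℝ) (g.symm x)) = _
      rw [hf, HH_comp_isometry]
    · intro i hi
      rw [haq]; simp [b, hi]
  rw [hcut]
  have hbK : ∀ i, ∀ k ≤ 2, ∀ x, ‖iteratedFDeriv ℝ k (b ε i) x‖ ≤ K * (ε⁻¹) ^ k := fun i k hk x =>
    (hb ε i hε).2.2 k (hk.trans hN2) x
  have h3N : (1 : ℝ) ≤ 3 ^ N := one_le_pow₀ (by norm_num)
  refine abs_QQ_add_le hVF hΦ hC0 hC hT0 (pow_pos hε N) (pow_le_one₀ hε.le hε1)
    (fun i => (hb2 i).mul ((hr i).of_le h2N)) (fun i => (hb2 i).mul (hp2 i)) (fun i => ?_)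
    (fun i => ?_) (fun i => rfl) (fun i => rfl) (hzero fun i => ⟨p i, hpP i⟩)
  · refine (CB.cutoff_mul hN2 (hr i) (hrB i) he.le (hp i) (by norm_num) hε hε1 (hb2 i) hK0 (hbK i)
      (hb ε i hε).2.1).mono le_rfl ?_
    have e1 : T * ε ^ N = T₀ * ε ^ (N - 2) := by
      have e2 : ε ^ N = ε ^ 2 * ε ^ (N - 2) := by rw [← pow_add]; congr 1; omega
      have e3 : ε⁻¹ ^ 2 * ε ^ 2 = 1 := by rw [← mul_pow, inv_mul_cancel₀ hε.ne', one_pow]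
      rw [hT, e2]
      linear_combination (T₀ * ε ^ (N - 2)) * e3
    rw [e1]
    exact mul_le_mul_of_nonneg_right (by rw [hT₀]; linarith) (by positivity)
  · refine ((CB.of_cutoff hε hε1 hK0 (hbK i)).mul (by exact_mod_cast hb2 i)
      (by exact_mod_cast hp2 i) ((hpB i).mono hN2 le_rfl)).mono le_rfl ?_
    rw [hT, hT₀]
    have e1 : 0 ≤ K * (KP * B) := by positivity
    have e2 : K * (KP * B) ≤ K * (B + KP * B) * 3 ^ N := by
      have : 0 ≤ K * B := by positivity
      nlinarith
    have e3 : (2 : ℝ) ^ 2 * (K * (ε⁻¹) ^ 2 * (KP * B)) = (2 ^ 2 * (K * (KP * B))) * (ε⁻¹) ^ 2 := by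
      ring
    rw [e3]
    exact mul_le_mul_of_nonneg_right (by linarith) (by positivity)

end Kinematic

namespace Kinematic

open scoped RealInnerProductSpace

theorem finiteDimensional_of_relations {V : Type*} [AddCommGroup V] [Module ℝ V]
    {W W' : Submodule ℝ V} [FiniteDimensional ℝ W'] (D : ℕ)
    (H : ∀ φ : Fin (D + 1) → V, (∀ k, φ k ∈ W) →
      ∃ c : Fin (D + 1) → ℝ, c ≠ 0 ∧ ∑ k, c k • φ k ∈ W') : FiniteDimensional ℝ W := by
  have h1 : (W.map W'.mkQ).FG := by
    have : FiniteDimensional ℝ (W.map W'.mkQ) := by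
      refine Module.rank_lt_aleph0_iff.1 (lt_of_le_of_lt (b := (D : Cardinal)) ?_
        (Cardinal.natCast_lt_aleph0))
      refine rank_le fun s hs => ?_
      by_contra! hlt
      obtain ⟨t, hts, ht⟩ := Finset.exists_subset_card_eq (n := D + 1) (s := s) hlt
      let en := (t.equivFinOfCardEq ht).symm
      have hpre : ∀ k, ∃ v ∈ W, W'.mkQ v = ((en k : W.map W'.mkQ) : V ⧸ W') := fun k =>
        Submodule.mem_map.1 (en k : W.map W'.mkQ).2
      choose φ hφ hφe using hpre
      obtain ⟨c, hc0, hc⟩ := H φ hφ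
      have hli : LinearIndependent ℝ (fun k => (en k : W.map W'.mkQ)) := by
        have := hs.comp (fun k => (⟨en k, hts (en k).2⟩ : s)) fun a b hab => by
          have := congrArg (fun x : s => (x : W.map W'.mkQ)) hab
          exact en.injective (Subtype.ext this)
        exact this
      refine hc0 (funext fun k => ?_)
      refine Fintype.linearIndependent_iff.1 hli c ?_ k
      apply Subtype.ext
      rw [Submodule.coe_sum]
      simp only [Submodule.coe_smul, ← hφe, ← map_smul, ← map_sum]
      exact (Submodule.Quotient.mk_eq_zero W').2 hc
    exact (Submodule.fg_iff_finiteDimensional _).2 this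
  have h2 : (W ⊓ LinearMap.ker W'.mkQ).FG := by
    rw [Submodule.ker_mkQ]
    have : FiniteDimensional ℝ (W ⊓ W' : Submodule ℝ V) :=
      Submodule.finiteDimensional_of_le inf_le_right
    exact (Submodule.fg_iff_finiteDimensional _).2 this
  exact (Submodule.fg_iff_finiteDimensional _).1 (Submodule.fg_of_fg_map_of_fg_inf_ker _ h1 h2)

variable {E : Type*} [NormedAddCommGroup E] [InnerProductSpace ℝ E]

theorem md_add_fun (l : List (E → ℝ)) (Φ Ψ : (E → ℝ) → ℝ) : MD l (Φ + Ψ) = MD l Φ + MD l Ψ := by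
  induction l with
  | nil => rfl
  | cons k l ih =>
    simp only [MD, List.foldr_cons] at ih ⊢
    rw [ih]; ext h; simp only [Dif, Pi.add_apply]; ring

theorem md_smul_fun (l : List (E → ℝ)) (c : ℝ) (Φ : (E → ℝ) → ℝ) : MD l (c • Φ) = c • MD l Φ := by
  induction l with
  | nil => rfl
  | cons k l ih =>
    simp only [MD, List.foldr_cons] at ih ⊢
    rw [ih]; ext h; simp only [Dif, Pi.smul_apply, smul_eq_mul]; ring

variable {V : Type*} [AddCommGroup V] [Module ℝ V]

/-- The filtration of a space of valuations by the order of vanishing of mixed differences. -/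
def vanFilt (Λ : V →ₗ[ℝ] ((E → ℝ) → ℝ)) (m : ℕ) : Submodule ℝ V where
  carrier := {φ | Van m (Λ φ)}
  add_mem' := by
    intro a b ha hb
    rw [Set.mem_ofPred_eq] at *
    intro L hL hlen h hh
    rw [map_add, md_add_fun, Pi.add_apply, ha L hL hlen h hh, hb L hL hlen h hh, add_zero]
  zero_mem' := by
    rw [Set.mem_ofPred_eq]
    intro L hL hlen h hh
    rw [map_zero, md_zero]; rfl
  smul_mem' := by
    intro c a ha
    rw [Set.mem_ofPred_eq] at *
    intro L hL hlen h hh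
    rw [map_smul, md_smul_fun, Pi.smul_apply, ha L hL hlen h hh, smul_zero]

theorem mem_vanFilt {Λ : V →ₗ[ℝ] ((E → ℝ) → ℝ)} {m : ℕ} {φ : V} :
    φ ∈ vanFilt Λ m ↔ Van m (Λ φ) := Iff.rfl

theorem QQ_map_sum {ι κ : Type*} [Fintype ι] [Fintype κ] (Λ : V →ₗ[ℝ] ((E → ℝ) → ℝ)) (c : κ → ℝ)
    (φ : κ → V) (f : ι → DD E) :
    QQ (Λ (∑ k, c k • φ k)) f = ∑ k, c k * QQ (Λ (φ k)) f := by
  rw [map_sum]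
  simp only [map_smul]
  exact ev_sum_smul _ _ _ _ _

variable [FiniteDimensional ℝ E]

theorem finiteDimensional_vanFilt_succ [MeasurableSpace E] [BorelSpace E]
    {Ω : Type*} [TopologicalSpace Ω] [SecondCountableTopology Ω]
    [MeasurableSpace Ω] [BorelSpace Ω] {γ : Measure Ω} [IsProbabilityMeasure γ]
    {A : Ω → E →L[ℝ] E} {S : Set (E ≃ₗᵢ[ℝ] E)} (hA : IsTransitiveFamily γ A S)
    {e : E} (he : ‖e‖ = 1) {Λ : V →ₗ[ℝ] ((E → ℝ) → ℝ)} (hVF : ∀ φ, IsVF (Λ φ))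
    (hinv : ∀ φ, ∀ g ∈ S, ∀ h, SubLin h → Λ φ (fun x => h (g x)) = Λ φ h) (j : ℕ)
    [FiniteDimensional ℝ (vanFilt Λ (j + 1))] : FiniteDimensional ℝ (vanFilt Λ (j + 2)) := by
  set N := Module.finrank ℝ E + 2 * Fintype.card (Fin (j + 1)) + 1 with hN
  obtain ⟨P, hPfin, L, hL⟩ := exists_localized_jets hA (0 : Fin (j + 1)) he hN
  set D := Module.finrank ℝ (MultilinearMap ℝ (fun _ : Fin (j + 1) => P) ℝ) with hD
  refine finiteDimensional_of_relations (W' := vanFilt Λ (j + 1)) D fun φ hφ => ?_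
  have hcard : Fintype.card (Fin (j + 1)) + 1 = j + 2 := by simp
  have hmem : ∀ c : Fin (D + 1) → ℝ, ∑ k, c k • φ k ∈ vanFilt Λ (j + 2) := fun c =>
    Submodule.sum_mem _ fun k _ => Submodule.smul_mem _ _ (hφ k)
  have hφ' : ∀ k, Van (Fintype.card (Fin (j + 1)) + 1) (Λ (φ k)) := fun k => by
    rw [hcard]; exact hφ k
  have hex : ∀ ε : ℝ, ∃ c : Fin (D + 1) → ℝ, ‖c‖ = 1 ∧ ∀ t : Fin (j + 1) → P,
      QQ (Λ (∑ k, c k • φ k)) (fun i => L ε i (t i)) = 0 := by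
    intro ε
    have hli : ¬ LinearIndependent ℝ
        (fun k => (QM (hVF (φ k)) (hφ' k)).compLinearMap (fun i => L ε i)) := fun h => by
      have := h.fintype_card_le_finrank
      rw [Fintype.card_fin] at this
      omega
    obtain ⟨c, hc, i, hi⟩ := Fintype.not_linearIndependent_iff.1 hli
    have hc0 : ‖c‖ ≠ 0 := fun h => hi (by rw [norm_eq_zero.1 h]; rfl)
    refine ⟨‖c‖⁻¹ • c, by rw [norm_smul, norm_inv, norm_norm, inv_mul_cancel₀ hc0], fun t => ?_⟩
    have h2 := congrArg (fun m : MultilinearMap ℝ (fun _ : Fin (j + 1) => P) ℝ => m t) hc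
    simp only [_root_.sum_apply, _root_.smul_apply,
      MultilinearMap.compLinearMap_apply, _root_.zero_apply, smul_eq_mul] at h2
    rw [QQ_map_sum]
    simp only [Pi.smul_apply, smul_eq_mul, mul_assoc, ← Finset.mul_sum]
    exact mul_eq_zero_of_right _ h2
  choose c hc1 hc using hex
  let ε : ℕ → ℝ := fun k => ((k : ℝ) + 1)⁻¹
  have hε0 : ∀ k, 0 < ε k := fun k => by positivity
  have hε1 : ∀ k, ε k ≤ 1 := fun k => inv_le_one_of_one_le₀ (by linarith [k.cast_nonneg (α := ℝ)])
  have hεt : Filter.Tendsto ε Filter.atTop (nhds 0) := by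
    simpa [ε, one_div] using tendsto_one_div_add_atTop_nhds_zero_nat (𝕜 := ℝ)
  obtain ⟨a, ha, ψ, hψ, hlim⟩ := (isCompact_sphere (0 : Fin (D + 1) → ℝ) 1).tendsto_subseq
    (x := fun k => c (ε k)) (fun k => by simpa using hc1 (ε k))
  refine ⟨a, fun h => by simp [h] at ha, ?_⟩
  rw [mem_vanFilt]
  refine van_of_QQ_smo (N := N) (hVF _) (hmem a) fun f hf => ?_
  choose u hu hfu using hf
  choose B hB using fun i => exists_CB (m := N) (hu i)
  have hB0 : ∀ i, 0 ≤ B i := fun i => (hB i).nonneg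
  obtain ⟨R, hR⟩ := hL (∑ i, B i) (Finset.sum_nonneg fun i _ => hB0 i)
  choose C hC0 hC using fun k => exists_QQ_bound (hVF (φ k)) (hφ' k)
  have hle : ∀ k, |QQ (Λ (∑ i, c (ε k) i • φ i)) f| ≤ R * (∑ i, C i) * ε k := by
    intro k
    refine hR _ (hVF _) (by rw [hcard]; exact hmem _) (hinv _) _
      (Finset.sum_nonneg fun i _ => hC0 i) ?_ (ε k) (hε0 k) (hε1 k) (hc (ε k)) f u hu
      (fun i => (hB i).mono le_rfl (Finset.single_le_sum (fun i _ => hB0 i) (Finset.mem_univ i)))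
      hfu
    intro f u M hM hu hB hf
    rw [QQ_map_sum, Finset.sum_mul]
    refine (Finset.abs_sum_le_sum_abs _ _).trans (Finset.sum_le_sum fun i _ => ?_)
    rw [abs_mul]
    have h1 : |c (ε k) i| ≤ 1 := by
      rw [← Real.norm_eq_abs, ← hc1 (ε k)]; exact norm_le_pi_norm _ _
    exact (mul_le_of_le_one_left (abs_nonneg _) h1).trans (hC i f u M hM hu hB hf)
  have hcont : Continuous fun c : Fin (D + 1) → ℝ => |QQ (Λ (∑ i, c i • φ i)) f| := by
    simp only [QQ_map_sum]
    fun_prop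
  have h1 := (hcont.tendsto a).comp hlim
  have h2 : Filter.Tendsto (fun k => R * (∑ i, C i) * ε (ψ k)) Filter.atTop (nhds 0) := by
    simpa using (hεt.comp hψ.tendsto_atTop).const_mul (R * ∑ i, C i)
  have h3 := le_of_tendsto_of_tendsto' h1 h2 fun k => hle (ψ k)
  exact abs_eq_zero.1 (le_antisymm h3 (abs_nonneg _))

/-- Spaces of invariant valuations are finite-dimensional. -/
theorem finiteDimensional_of_isVF [MeasurableSpace E] [BorelSpace E]
    {Ω : Type*} [TopologicalSpace Ω] [SecondCountableTopology Ω]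
    [MeasurableSpace Ω] [BorelSpace Ω] {γ : Measure Ω} [IsProbabilityMeasure γ]
    {A : Ω → E →L[ℝ] E} {S : Set (E ≃ₗᵢ[ℝ] E)} (hA : IsTransitiveFamily γ A S)
    {e : E} (he : ‖e‖ = 1) {Λ : V →ₗ[ℝ] ((E → ℝ) → ℝ)} (hVF : ∀ φ, IsVF (Λ φ))
    (hinv : ∀ φ, ∀ g ∈ S, ∀ h, SubLin h → Λ φ (fun x => h (g x)) = Λ φ h)
    (hinj : ∀ φ, (∀ h, SubLin h → Λ φ h = 0) → φ = 0) : FiniteDimensional ℝ V := by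
  have key : ∀ j, FiniteDimensional ℝ (vanFilt Λ (j + 1)) := by
    intro j
    induction j with
    | zero =>
      let T : vanFilt Λ 1 →ₗ[ℝ] ℝ :=
        (LinearMap.proj (R := ℝ) (φ := fun _ : E → ℝ => ℝ) 0).comp (Λ.comp (vanFilt Λ 1).subtype)
      refine FiniteDimensional.of_injective T ((injective_iff_map_eq_zero T).2 fun φ hφ => ?_)
      refine Subtype.ext (hinj φ fun h hh => ?_)
      have h1 : Λ φ (0 + h) - Λ φ 0 = 0 := φ.2 [h] (by simpa using hh) rfl 0 SubLin.zero
      have h2 : Λ φ 0 = 0 := hφ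
      rwa [h2, sub_zero, zero_add] at h1
    | succ j ih =>
      exact finiteDimensional_vanFilt_succ hA he hVF hinv j
  have htop : vanFilt Λ (Module.finrank ℝ E + 1 + 1) = ⊤ := by
    rw [eq_top_iff]
    intro φ _
    rw [mem_vanFilt]
    intro l hl hlen h hh
    exact (hVF φ).md_eq_zero l hl (by omega) hh
  have := key (Module.finrank ℝ E + 1)
  rw [htop] at this
  exact Module.Finite.equiv (Submodule.topEquiv : (⊤ : Submodule ℝ V) ≃ₗ[ℝ] V)

end Kinematic

namespace Kinematic

open scoped RealInnerProductSpace

variable {E : Type*} [NormedAddCommGroup E] [InnerProductSpace ℝ E] [FiniteDimensional ℝ E]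

/-- The convex body with a given support function. -/
def body (h : E → ℝ) (hh : SubLin h) : ConvexBody E where
  carrier := {v | ∀ x, ⟪v, x⟫ ≤ h x}
  convex' := by
    intro v hv w hw a b ha hb hab
    rw [Set.mem_ofPred_eq] at *
    intro x
    rw [inner_add_left, inner_smul_left, inner_smul_left]
    have h1 := mul_le_mul_of_nonneg_left (hv x) ha
    have h2 := mul_le_mul_of_nonneg_left (hw x) hb
    calc _ ≤ a * h x + b * h x := add_le_add h1 h2
      _ = h x := by rw [← add_mul, hab, one_mul]
  isCompact' := by
    obtain ⟨C, hC0, hC⟩ := hh.abs_le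
    refine Metric.isCompact_of_isClosed_isBounded ?_
      ((Metric.isBounded_closedBall (x := (0 : E)) (r := C)).subset fun v hv => ?_)
    · rw [Set.ofPred_forall]
      exact isClosed_iInter fun x =>
        isClosed_le (continuous_id.inner continuous_const) continuous_const
    · rw [mem_closedBall_zero_iff]
      have h1 := ((Set.mem_ofPred_eq (p := fun v : E => ∀ x, ⟪v, x⟫ ≤ h x)).mp hv) v
      rw [real_inner_self_eq_norm_sq] at h1
      have h2 := (le_abs_self _).trans (hC v)
      nlinarith [norm_nonneg v]
  nonempty' := by
    obtain ⟨v, hv, -⟩ := hh.exists_support 0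
    exact ⟨v, hv⟩

theorem mem_body {h : E → ℝ} {hh : SubLin h} {v : E} :
    v ∈ (body h hh : Set E) ↔ ∀ x, ⟪v, x⟫ ≤ h x := Iff.rfl

/-- The support function of a convex body. -/
def supp (K : ConvexBody E) (x : E) : ℝ := sSup ((fun v => ⟪v, x⟫) '' (K : Set E))

theorem exists_mem_supp (K : ConvexBody E) (x : E) :
    ∃ v ∈ (K : Set E), ⟪v, x⟫ = supp K x ∧ ∀ w ∈ (K : Set E), ⟪w, x⟫ ≤ ⟪v, x⟫ := by
  obtain ⟨v, hv, h1, h2⟩ := K.isCompact.exists_sSup_image_eq_and_ge K.nonempty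
    (f := fun v => ⟪v, x⟫) (continuous_id.inner continuous_const).continuousOn
  exact ⟨v, hv, h1.symm, h2⟩

theorem inner_le_supp {K : ConvexBody E} {v : E} (hv : v ∈ (K : Set E)) (x : E) :
    ⟪v, x⟫ ≤ supp K x := by
  obtain ⟨w, -, h1, h2⟩ := exists_mem_supp K x
  exact h1 ▸ h2 v hv

theorem subLin_supp (K : ConvexBody E) : SubLin (supp K) where
  add_le x y := by
    obtain ⟨w, hw, h1, -⟩ := exists_mem_supp K (x + y)
    rw [← h1, inner_add_right]
    exact add_le_add (inner_le_supp hw x) (inner_le_supp hw y)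
  smul t ht x := by
    obtain ⟨v, hv, h1, -⟩ := exists_mem_supp K (t • x)
    obtain ⟨w, hw, h3, -⟩ := exists_mem_supp K x
    refine le_antisymm ?_ ?_
    · rw [← h1, inner_smul_right]
      exact mul_le_mul_of_nonneg_left (inner_le_supp hv x) ht
    · rw [← h3, ← inner_smul_right]
      exact inner_le_supp hw _

/-- Nearest point projections onto convex bodies. -/
theorem exists_nearest (K : ConvexBody E) (v : E) :
    ∃ w ∈ (K : Set E), ∀ u ∈ (K : Set E), ⟪u, v - w⟫ ≤ ⟪w, v - w⟫ := by
  obtain ⟨w, hw, h⟩ := exists_norm_eq_iInf_of_complete_convex K.nonempty K.isCompact.isComplete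
    K.convex v
  refine ⟨w, hw, fun u hu => ?_⟩
  have := (norm_eq_iInf_iff_real_inner_le_zero K.convex hw).1 h u hu
  rw [inner_sub_right, real_inner_comm, real_inner_comm w] at this
  linarith

theorem exists_mem_dist_le {K : ConvexBody E} {δ : ℝ} (hδ : 0 ≤ δ) {v : E}
    (hv : ∀ x, ⟪v, x⟫ ≤ supp K x + δ * ‖x‖) : ∃ w ∈ (K : Set E), dist v w ≤ δ := by
  obtain ⟨w, hw, h⟩ := exists_nearest K v
  refine ⟨w, hw, ?_⟩
  obtain ⟨u, hu, h1, -⟩ := exists_mem_supp K (v - w)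
  have h2 := hv (v - w)
  rw [← h1] at h2
  have h3 := h u hu
  have h4 : ⟪v - w, v - w⟫ = ⟪v, v - w⟫ - ⟪w, v - w⟫ := inner_sub_left _ _ _
  rw [real_inner_self_eq_norm_sq] at h4
  rw [dist_eq_norm]
  by_contra! hlt
  have h5 : ‖v - w‖ * ‖v - w‖ ≤ δ * ‖v - w‖ := by nlinarith
  exact absurd (le_of_mul_le_mul_right h5 (hδ.trans_lt hlt)) hlt.not_ge

theorem body_supp (K : ConvexBody E) : body (supp K) (subLin_supp K) = K := by
  refine ConvexBody.ext (Set.Subset.antisymm (fun v hv => ?_) fun v hv => ?_)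
  · obtain ⟨w, hw, h⟩ := exists_mem_dist_le (K := K) le_rfl (v := v)
      (fun x => by simpa using mem_body.1 hv x)
    rwa [dist_le_zero.1 h]
  · exact mem_body.2 fun x => inner_le_supp hv x

theorem supp_body (h : E → ℝ) (hh : SubLin h) : supp (body h hh) = h := by
  ext x
  obtain ⟨v, hv, h1, -⟩ := exists_mem_supp (body h hh) x
  obtain ⟨w, hw, hwe⟩ := hh.exists_support x
  refine le_antisymm (h1 ▸ mem_body.1 hv x) (hwe ▸ inner_le_supp (mem_body.2 hw) x)

theorem dist_body_le {h k : E → ℝ} (hh : SubLin h) (hk : SubLin k) {δ : ℝ} (hδ : 0 ≤ δ)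
    (H : ∀ x, |k x - h x| ≤ δ * ‖x‖) : dist (body k hk) (body h hh) ≤ δ := by
  rw [← ConvexBody.hausdorffDist_coe]
  refine Metric.hausdorffDist_le_of_mem_dist hδ (fun v hv => ?_) fun v hv => ?_
  · refine exists_mem_dist_le hδ fun x => ?_
    rw [supp_body]
    linarith [mem_body.1 hv x, (abs_le.1 (H x)).2]
  · refine exists_mem_dist_le hδ fun x => ?_
    rw [supp_body]
    linarith [mem_body.1 hv x, (abs_le.1 (H x)).1]

theorem body_inf {h k : E → ℝ} (hh : SubLin h) (hk : SubLin k) (hi : SubLin (h ⊓ k)) :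
    (body (h ⊓ k) hi : Set E) = (body h hh : Set E) ∩ body k hk := by
  ext v
  simp only [mem_body, Set.mem_inter_iff, Pi.inf_apply, le_inf_iff, forall_and]

theorem body_sup {h k : E → ℝ} (hh : SubLin h) (hk : SubLin k) (hi : SubLin (h ⊓ k)) :
    (body (h ⊔ k) (hh.sup hk) : Set E) = (body h hh : Set E) ∪ body k hk := by
  ext v
  simp only [mem_body, Set.mem_union, Pi.sup_apply, le_sup_iff]
  refine ⟨fun H => ?_, fun H x => H.imp (fun h => h x) fun h => h x⟩
  by_contra! hcon
  obtain ⟨⟨x, hx⟩, y, hy⟩ := hcon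
  let p : ℝ → E := fun t => (1 - t) • x + t • y
  have hp : Continuous p := by fun_prop
  have hU : IsOpen {t | h (p t) < ⟪v, p t⟫} :=
    isOpen_lt (hh.continuous.comp hp) (continuous_const.inner hp)
  have hV : IsOpen {t | k (p t) < ⟪v, p t⟫} :=
    isOpen_lt (hk.continuous.comp hp) (continuous_const.inner hp)
  have hmx : (h ⊓ k) x < ⟪v, x⟫ := (inf_le_left (a := h x)).trans_lt hx
  have hmy : (h ⊓ k) y < ⟪v, y⟫ := (inf_le_right (a := h y)).trans_lt hy
  have hcov : Set.Icc (0 : ℝ) 1 ⊆ {t | h (p t) < ⟪v, p t⟫} ∪ {t | k (p t) < ⟪v, p t⟫} := by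
    intro t ht
    have h1 : (h ⊓ k) (p t) < ⟪v, p t⟫ := by
      refine (hi.add_le _ _).trans_lt ?_
      rw [hi.smul _ (by linarith [ht.2]), hi.smul _ ht.1]
      simp only [p, inner_add_right, inner_smul_right]
      rcases ht.1.eq_or_lt with h0 | h0
      · rw [← h0]; simpa using hmx
      · have := mul_le_mul_of_nonneg_left hmx.le (show 0 ≤ 1 - t by linarith [ht.2])
        have := mul_lt_mul_of_pos_left hmy h0
        linarith
    rcases inf_lt_iff.1 h1 with h1 | h1
    · exact Or.inl ((Set.mem_ofPred_eq (p := fun t => h (p t) < ⟪v, p t⟫)).mpr h1)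
    · exact Or.inr ((Set.mem_ofPred_eq (p := fun t => k (p t) < ⟪v, p t⟫)).mpr h1)
  obtain ⟨t, -, ht1, ht2⟩ := isPreconnected_Icc (a := (0 : ℝ)) (b := 1) _ _ hU hV hcov
    ⟨0, by simp, by
      refine (Set.mem_ofPred_eq (p := fun t => h (p t) < ⟪v, p t⟫)).mpr ?_
      simpa [p] using hx⟩
    ⟨1, by simp, by
      refine (Set.mem_ofPred_eq (p := fun t => k (p t) < ⟪v, p t⟫)).mpr ?_
      simpa [p] using hy⟩
  have h1 := (Set.mem_ofPred_eq (p := fun t => h (p t) < ⟪v, p t⟫)).mp ht1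
  have h2 := (Set.mem_ofPred_eq (p := fun t => k (p t) < ⟪v, p t⟫)).mp ht2
  exact (H (p t)).elim h1.not_ge h2.not_ge

theorem body_add_linear {h : E → ℝ} (hh : SubLin h) (v : E) :
    body (h + fun x => ⟪v, x⟫) (hh.add (SubLin.linear v)) = (body h hh).translate v := by
  refine ConvexBody.ext ?_
  change _ = (body h hh : Set E) + {v}
  ext w
  rw [Set.add_singleton, Set.mem_image, mem_body]
  constructor
  · intro H
    refine ⟨w - v, mem_body.2 fun x => ?_, sub_add_cancel _ _⟩
    have := H x
    rw [Pi.add_apply] at this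
    rw [inner_sub_left]
    linarith
  · rintro ⟨u, hu, rfl⟩ x
    rw [inner_add_left, Pi.add_apply]
    linarith [mem_body.1 hu x]

open scoped Classical in
/-- The functional on support functions associated with a functional on convex bodies. -/
def toVF : (ConvexBody E → ℝ) →ₗ[ℝ] ((E → ℝ) → ℝ) where
  toFun φ h := if hh : SubLin h then φ (body h hh) else 0
  map_add' φ ψ := by
    ext h
    simp only [Pi.add_apply]
    split_ifs <;> simp
  map_smul' c φ := by
    ext h
    simp only [Pi.smul_apply, RingHom.id_apply]
    split_ifs <;> simp

theorem toVF_apply (φ : ConvexBody E → ℝ) {h : E → ℝ} (hh : SubLin h) :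
    toVF φ h = φ (body h hh) := dif_pos hh

theorem toVF_supp (φ : ConvexBody E → ℝ) (K : ConvexBody E) : toVF φ (supp K) = φ K := by
  rw [toVF_apply φ (subLin_supp K), body_supp]

theorem isVF_toVF {φ : ConvexBody E → ℝ} (hval : IsValuation φ) (hcont : Continuous φ)
    (htr : TransInv φ) : IsVF (toVF φ) where
  val h k hh hk hi := by
    rw [toVF_apply φ hh, toVF_apply φ hk, toVF_apply φ hi, toVF_apply φ (hh.sup hk)]
    exact hval _ _ _ _ (body_sup hh hk hi) (body_inf hh hk hi)
  trans h hh v := by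
    rw [toVF_apply φ hh, toVF_apply φ (hh.add (SubLin.linear v)), body_add_linear hh v, htr]
  cont h hh ε hε := by
    obtain ⟨δ, hδ, H⟩ := Metric.continuous_iff.1 hcont (body h hh) ε hε
    refine ⟨δ / 2, by positivity, fun k hk hkh => ?_⟩
    rw [toVF_apply φ hh, toVF_apply φ hk]
    exact (H _ ((dist_body_le hh hk (by positivity) hkh).trans_lt (by linarith))).le

end Kinematic

namespace Kinematic

open scoped RealInnerProductSpace

section

variable {E : Type*} [NormedAddCommGroup E] [InnerProductSpace ℝ E] [FiniteDimensional ℝ E]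

theorem md_replicate (k : E → ℝ) (Φ : (E → ℝ) → ℝ) (i : ℕ) :
    (fwdDiff k)^[i] Φ = MD (List.replicate i k) Φ := by
  induction i with
  | zero => rfl
  | succ i ih => rw [Function.iterate_succ_apply', ih]; rfl

theorem IsVF.exists_bound {Φ : (E → ℝ) → ℝ} (hΦ : IsVF Φ) (R : ℝ) :
    ∃ C, ∀ h, SubLin h → (∀ x, |h x| ≤ R * ‖x‖) → |Φ h| ≤ C := by
  obtain ⟨δ, hδ, hc⟩ := hΦ.cont 0 SubLin.zero 1 one_pos
  set n := Module.finrank ℝ E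
  obtain ⟨M, hM⟩ := exists_nat_gt (((n : ℝ) + 1) * |R| / δ)
  have hM0 : (0 : ℝ) < M := lt_of_le_of_lt (by positivity) hM
  rw [div_lt_iff₀ hδ] at hM
  refine ⟨∑ i ∈ Finset.range (M + 1), (M.choose i : ℝ) *
    ∑ j ∈ Finset.range (i + 1), (i.choose j : ℝ) * (|Φ 0| + 1), fun h hh hR => ?_⟩
  set k : E → ℝ := (M : ℝ)⁻¹ • h with hk
  have hkS : SubLin k := hh.const_smul (by positivity)
  have e : h = 0 + M • k := by
    ext x; simp [hk, hM0.ne']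
  rw [e, shift_eq_sum_fwdDiff_iter k Φ M 0]
  refine (Finset.abs_sum_le_sum_abs _ _).trans (Finset.sum_le_sum fun i _ => ?_)
  rw [nsmul_eq_mul, abs_mul, Nat.abs_cast]
  refine mul_le_mul_of_nonneg_left ?_ (Nat.cast_nonneg _)
  rcases le_or_gt i (n + 1) with hi | hi
  · rw [fwdDiff_iter_eq_sum_shift k Φ i 0]
    refine (Finset.abs_sum_le_sum_abs _ _).trans (Finset.sum_le_sum fun j hj => ?_)
    rw [zsmul_eq_mul, abs_mul]
    have h1 : |(((-1 : ℤ) ^ (i - j) * (i.choose j : ℤ) : ℤ) : ℝ)| = i.choose j := by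
      push_cast
      rw [abs_mul, abs_pow, abs_neg, abs_one, one_pow, one_mul, Nat.abs_cast]
    rw [h1]
    refine mul_le_mul_of_nonneg_left ?_ (Nat.cast_nonneg _)
    have hjS : SubLin (0 + j • k) := by
      rw [zero_add, ← Nat.cast_smul_eq_nsmul ℝ]
      exact hkS.const_smul (Nat.cast_nonneg _)
    have h2 := hc (0 + j • k) hjS fun x => by
      have h3 : ((0 + j • k) x - (0 : E → ℝ) x) = (j : ℝ) * ((M : ℝ)⁻¹ * h x) := by
        simp [hk]
        ring
      have hj' : (j : ℝ) ≤ n + 1 := by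
        have := Finset.mem_range.1 hj
        exact_mod_cast (show j ≤ n + 1 by omega)
      rw [h3, abs_mul, abs_mul, Nat.abs_cast, abs_inv, Nat.abs_cast]
      have h4 : |h x| ≤ |R| * ‖x‖ :=
        (hR x).trans (mul_le_mul_of_nonneg_right (le_abs_self R) (norm_nonneg x))
      calc (j : ℝ) * ((M : ℝ)⁻¹ * |h x|) ≤ (n + 1) * ((M : ℝ)⁻¹ * (|R| * ‖x‖)) := by gcongr
        _ = ((n + 1) * |R|) * (M : ℝ)⁻¹ * ‖x‖ := by ring
        _ ≤ (M * δ) * (M : ℝ)⁻¹ * ‖x‖ := by gcongr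
        _ = δ * ‖x‖ := by field_simp
    have h5 := abs_sub_abs_le_abs_sub (Φ (0 + j • k)) (Φ 0)
    linarith
  · rw [md_replicate, hΦ.md_eq_zero _ (fun l hl => by rw [List.eq_of_mem_replicate hl]; exact hkS)
      (by simpa using hi) SubLin.zero, abs_zero]
    positivity

/-- Valuations are bounded on the convex bodies contained in a ball. -/
theorem exists_bound_of_isVF {φ : ConvexBody E → ℝ} (hφ : IsVF (toVF φ)) (R : ℝ) :
    ∃ C, ∀ K : ConvexBody E, (∀ v ∈ (K : Set E), ‖v‖ ≤ R) → |φ K| ≤ C := by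
  obtain ⟨C, hC⟩ := hφ.exists_bound R
  refine ⟨C, fun K hK => ?_⟩
  rw [← toVF_supp φ K]
  refine hC _ (subLin_supp K) fun x => ?_
  obtain ⟨v, hv, h1, -⟩ := exists_mem_supp K x
  rw [← h1]
  exact (abs_real_inner_le_norm _ _).trans (mul_le_mul_of_nonneg_right (hK v hv) (norm_nonneg _))

end

end Kinematic

namespace Kinematic

open scoped RealInnerProductSpace

variable {n : ℕ}

/-- The product of two matrices, viewed as points of the function space `Mat n`. -/
def matMul (B A : Mat n) : Mat n := Matrix.of.symm (Matrix.of B * Matrix.of A)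

/-- The transpose of a matrix, viewed as a point of the function space `Mat n`. -/
def matT (A : Mat n) : Mat n := Matrix.of.symm (Matrix.of A).transpose

theorem matT_matT (A : Mat n) : matT (matT A) = A := rfl

theorem matT_matMul (A B : Mat n) : matT (matMul A B) = matMul (matT B) (matT A) := by
  simp [matT, matMul, Matrix.transpose_mul]

theorem continuous_matMul : Continuous fun p : Mat n × Mat n => matMul p.1 p.2 := by
  refine continuous_pi fun i => continuous_pi fun j => ?_
  change Continuous fun p : Mat n × Mat n => ∑ k, p.1 i k * p.2 k j
  fun_prop

theorem continuous_matT : Continuous (matT : Mat n → Mat n) := by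
  refine continuous_pi fun i => continuous_pi fun j => ?_
  change Continuous fun p : Mat n => p j i
  fun_prop

/-- A probability measure concentrated on a closed subgroup of `O(n)` and invariant under left
translations. -/
structure IsHaarOn (G : Set (Matrix (Fin n) (Fin n) ℝ)) (γ : Measure (Mat n)) : Prop where
  subgroup : IsClosedSubgroupO G
  prob : IsProbabilityMeasure γ
  ae_mem : ∀ᵐ A ∂γ, Matrix.of A ∈ G
  map_left : ∀ B : Mat n, Matrix.of B ∈ G → Measure.map (matMul B) γ = γ

theorem of_matT_mem {G : Set (Matrix (Fin n) (Fin n) ℝ)} (hG : IsClosedSubgroupO G) {A : Mat n}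
    (hA : Matrix.of A ∈ G) : Matrix.of (matT A) ∈ G := by
  have h1 : (Matrix.of A) * (Matrix.of A).transpose = 1 := by
    have := (Matrix.mem_orthogonalGroup_iff (Fin n) ℝ).1 (hG.1 _ hA)
    simpa [Matrix.star_eq_conjTranspose] using this
  have h2 : (Matrix.of A)⁻¹ = (Matrix.of A).transpose := Matrix.inv_eq_right_inv h1
  have h3 := hG.2.2.2.1 _ hA
  rw [h2] at h3
  exact h3

namespace IsHaarOn

variable {G : Set (Matrix (Fin n) (Fin n) ℝ)} {γ : Measure (Mat n)}

theorem lintegral_left (h : IsHaarOn G γ) {B : Mat n} (hB : Matrix.of B ∈ G) {f : Mat n → ℝ≥0∞}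
    (hf : Measurable f) : ∫⁻ A, f (matMul B A) ∂γ = ∫⁻ A, f A ∂γ := by
  conv_rhs => rw [← h.map_left B hB]
  rw [lintegral_map hf]
  exact (continuous_matMul.comp (Continuous.prodMk_right B)).measurable

theorem lintegral_transpose (h : IsHaarOn G γ) {f : Mat n → ℝ≥0∞} (hf : Measurable f) :
    ∫⁻ A, f (matT A) ∂γ = ∫⁻ A, f A ∂γ := by
  have : IsProbabilityMeasure γ := h.prob
  have h1 : ∫⁻ B, ∫⁻ A, f (matMul (matT B) A) ∂γ ∂γ = ∫⁻ A, f A ∂γ := by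
    rw [lintegral_congr_ae (g := fun _ => ∫⁻ A, f A ∂γ)]
    · simp
    · filter_upwards [h.ae_mem] with B hB
      exact h.lintegral_left (of_matT_mem h.subgroup hB) hf
  have h2 : ∫⁻ A, ∫⁻ B, f (matMul (matT B) A) ∂γ ∂γ = ∫⁻ A, f (matT A) ∂γ := by
    rw [lintegral_congr_ae (g := fun _ => ∫⁻ A, f (matT A) ∂γ)]
    · simp
    · filter_upwards [h.ae_mem] with A hA
      have h3 := h.lintegral_left (of_matT_mem h.subgroup hA)
        (f := fun B => f (matT B)) (hf.comp continuous_matT.measurable)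
      simpa only [matT_matMul, matT_matT] using h3
  rw [← h1, ← h2]
  refine lintegral_lintegral_swap (Measurable.aemeasurable ?_)
  exact hf.comp (continuous_matMul.comp ((continuous_matT.comp continuous_snd).prodMk
    continuous_fst)).measurable

theorem map_right (h : IsHaarOn G γ) {B : Mat n} (hB : Matrix.of B ∈ G) :
    Measure.map (fun A => matMul A B) γ = γ := by
  have hm : Measurable fun A : Mat n => matMul A B :=
    (continuous_matMul.comp (Continuous.prodMk_left B)).measurable
  refine Measure.ext_of_lintegral _ fun f hf => ?_
  rw [lintegral_map hf hm]
  have hf' : Measurable fun A => f (matT A) := hf.comp continuous_matT.measurable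
  have h1 := h.lintegral_transpose (hf'.comp
    (continuous_matMul.comp (Continuous.prodMk_right (matT B))).measurable)
  simp only [Function.comp_def, matT_matMul, matT_matT] at h1
  rw [h1]
  have h2 := h.lintegral_left (of_matT_mem h.subgroup hB) hf'
  simp only [matT_matMul, matT_matT] at h2
  rw [h2, h.lintegral_transpose hf]

end IsHaarOn

/-- The continuous linear map of `ℝⁿ` given by a matrix. -/
def matCLM (A : Mat n) : Eucl n →L[ℝ] Eucl n :=
  LinearMap.toContinuousLinearMap (Matrix.toEuclideanLin (Matrix.of A))

theorem matCLM_apply (A : Mat n) (x : Eucl n) :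
    matCLM A x = Matrix.toEuclideanLin (Matrix.of A) x := rfl

theorem continuous_matCLM : Continuous (matCLM : Mat n → Eucl n →L[ℝ] Eucl n) := by
  let T : Mat n →ₗ[ℝ] (Eucl n →L[ℝ] Eucl n) :=
    { toFun := matCLM
      map_add' := fun A B => by
        ext x : 1
        change Matrix.toEuclideanLin (Matrix.of A + Matrix.of B) x = _
        rw [map_add]; rfl
      map_smul' := fun c A => by
        ext x : 1
        change Matrix.toEuclideanLin (c • Matrix.of A) x = _
        rw [map_smul]; rfl }
  exact T.continuous_of_finiteDimensional

theorem matCLM_matMul (A B : Mat n) (x : Eucl n) :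
    matCLM (matMul A B) x = matCLM A (matCLM B x) := by
  simp only [matCLM_apply, matMul, Equiv.apply_symm_apply]
  exact LinearMap.congr_fun (Matrix.toLpLin_mul_same (p := 2) (Matrix.of A) (Matrix.of B)) x

theorem norm_toEuclideanLin {A : Matrix (Fin n) (Fin n) ℝ}
    (hA : A ∈ Matrix.orthogonalGroup (Fin n) ℝ) (x : Eucl n) :
    ‖Matrix.toEuclideanLin A x‖ = ‖x‖ := by
  have h1 : A.conjTranspose * A = 1 := by
    have := (Matrix.mem_orthogonalGroup_iff' (Fin n) ℝ).1 hA
    simpa [Matrix.star_eq_conjTranspose] using this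
  have h2 : Matrix.toEuclideanLin A.conjTranspose (Matrix.toEuclideanLin A x) = x := by
    rw [← LinearMap.comp_apply, ← Matrix.toLpLin_mul_same, h1]
    simp
  have h3 : ⟪Matrix.toEuclideanLin A x, Matrix.toEuclideanLin A x⟫ = ⟪x, x⟫ := by
    rw [← LinearMap.adjoint_inner_left, ← Matrix.toEuclideanLin_conjTranspose_eq_adjoint, h2]
  rw [real_inner_self_eq_norm_sq, real_inner_self_eq_norm_sq] at h3
  exact (sq_eq_sq₀ (norm_nonneg _) (norm_nonneg _)).1 h3

/-- The linear isometries of `ℝⁿ` given by a set of matrices. -/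
def isomSet (G : Set (Matrix (Fin n) (Fin n) ℝ)) : Set (Eucl n ≃ₗᵢ[ℝ] Eucl n) :=
  {g | ∃ A ∈ G, ∀ x, g x = Matrix.toEuclideanLin A x}

theorem exists_mem_isomSet {G : Set (Matrix (Fin n) (Fin n) ℝ)} (hG : IsClosedSubgroupO G)
    {A : Matrix (Fin n) (Fin n) ℝ} (hA : A ∈ G) :
    ∃ g ∈ isomSet G, ∀ x, Matrix.toEuclideanLin A x = g x := by
  let f : Eucl n →ₗᵢ[ℝ] Eucl n := ⟨Matrix.toEuclideanLin A, norm_toEuclideanLin (hG.1 A hA)⟩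
  exact ⟨f.toLinearIsometryEquiv rfl, ⟨A, hA, fun x => rfl⟩, fun x => rfl⟩

theorem IsHaarOn.isTransitiveFamily {G : Set (Matrix (Fin n) (Fin n) ℝ)} {γ : Measure (Mat n)}
    (h : IsHaarOn G γ) (htrans : ActsTransitively G) :
    IsTransitiveFamily γ matCLM (isomSet G) where
  cont := continuous_matCLM
  mem := by
    filter_upwards [h.ae_mem] with A hA using exists_mem_isomSet h.subgroup hA
  inv η hη x y hx hy := by
    obtain ⟨B, hB, rfl⟩ := htrans x y hx hy
    have h1 := h.map_right (B := Matrix.of.symm B) hB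
    have hm : Measurable fun A : Mat n => matMul A (Matrix.of.symm B) :=
      (continuous_matMul.comp (Continuous.prodMk_left _)).measurable
    have h2 : Continuous fun A : Mat n => η (matCLM A x) :=
      hη.comp (continuous_matCLM.clm_apply continuous_const)
    conv_lhs => rw [← h1]
    rw [integral_map hm.aemeasurable h2.aestronglyMeasurable]
    simp only [matCLM_matMul]
    rfl

/-- The space of continuous translation invariant `G`-invariant valuations. -/
def ValG (G : Set (Matrix (Fin n) (Fin n) ℝ)) : Submodule ℝ (ConvexBody (Eucl n) → ℝ) where
  carrier := {μ | IsValuation μ ∧ Continuous μ ∧ TransInv μ ∧ GInv G μ}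
  add_mem' := by
    rintro μ ν ⟨h1, h2, h3, h4⟩ ⟨k1, k2, k3, k4⟩
    refine ⟨fun K L M I hM hI => ?_, h2.add k2, fun K x => ?_, fun A hA K => ?_⟩
    · have := h1 K L M I hM hI
      have := k1 K L M I hM hI
      simp only [Pi.add_apply]
      linarith
    · simp only [Pi.add_apply, h3 K x, k3 K x]
    · simp only [Pi.add_apply, h4 A hA K, k4 A hA K]
  zero_mem' := ⟨fun K L M I hM hI => by simp, continuous_zero, fun K x => rfl, fun A hA K => rfl⟩
  smul_mem' := by
    rintro c μ ⟨h1, h2, h3, h4⟩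
    refine ⟨fun K L M I hM hI => ?_, h2.const_smul c, fun K x => ?_, fun A hA K => ?_⟩
    · have := h1 K L M I hM hI
      simp only [Pi.smul_apply, smul_eq_mul, ← mul_add, this]
    · simp only [Pi.smul_apply, h3 K x]
    · simp only [Pi.smul_apply, h4 A hA K]

theorem finiteDimensional_ValG (hn : 1 ≤ n) {G : Set (Matrix (Fin n) (Fin n) ℝ)}
    {γ : Measure (Mat n)} (h : IsHaarOn G γ) (htrans : ActsTransitively G) :
    FiniteDimensional ℝ (ValG G) := by
  have : IsProbabilityMeasure γ := h.prob
  refine finiteDimensional_of_isVF (h.isTransitiveFamily htrans)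
    (e := EuclideanSpace.single (⟨0, hn⟩ : Fin n) (1 : ℝ)) (by simp)
    (Λ := toVF.comp (ValG G).subtype) (fun φ => isVF_toVF φ.2.1 φ.2.2.1 φ.2.2.2.1) ?_ ?_
  · rintro ⟨φ, hφ⟩ g ⟨A, hA, hg⟩ k hk
    have hkg : SubLin fun x => k (g x) :=
      ⟨fun x y => by rw [map_add]; exact hk.add_le _ _,
        fun t ht x => by rw [map_smul]; exact hk.smul t ht _⟩
    change toVF φ _ = toVF φ k
    rw [toVF_apply φ hk, toVF_apply φ hkg, ← hφ.2.2.2 A hA (body _ hkg)]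
    congr 1
    refine ConvexBody.ext ?_
    change Matrix.toEuclideanLin A '' (body _ hkg : Set (Eucl n)) = _
    ext v
    rw [Set.mem_image, mem_body]
    constructor
    · rintro ⟨w, hw, rfl⟩ x
      rw [mem_body] at hw
      have := hw (g.symm x)
      rwa [g.apply_symm_apply, ← g.inner_map_map, g.apply_symm_apply, hg] at this
    · intro hv
      refine ⟨g.symm v, mem_body.2 fun x => ?_, by rw [← hg, g.apply_symm_apply]⟩
      rw [← g.inner_map_map, g.apply_symm_apply]
      exact hv _
  · rintro φ hφ
    refine Subtype.ext (funext fun K => ?_)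
    have := hφ _ (subLin_supp K)
    rw [← toVF_supp φ.1 K]
    exact this

end Kinematic

namespace Kinematic

open scoped RealInnerProductSpace

section Intersections

variable {E : Type*} [NormedAddCommGroup E] [InnerProductSpace ℝ E] [FiniteDimensional ℝ E]

/-- The convex body `K - L`. -/
def diffBody (K L : ConvexBody E) : ConvexBody E :=
  ⟨(K : Set E) - (L : Set E), K.convex.sub L.convex, by
    rw [sub_eq_add_neg]; exact K.isCompact.add L.isCompact.neg,
    K.nonempty.sub L.nonempty⟩

theorem coe_diffBody (K L : ConvexBody E) : (diffBody K L : Set E) = (K : Set E) - (L : Set E) :=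
  rfl

theorem exists_dist_le_dist (K L : ConvexBody E) {x : E} (hx : x ∈ (K : Set E)) :
    ∃ y ∈ (L : Set E), dist x y ≤ dist K L := by
  obtain ⟨y, hy, h⟩ := L.isCompact.exists_infDist_eq_dist L.nonempty x
  refine ⟨y, hy, ?_⟩
  rw [← h, ← ConvexBody.hausdorffDist_coe]
  exact Metric.infDist_le_hausdorffDist_of_mem hx ConvexBody.hausdorffEDist_ne_top

theorem exists_mem_inter_dist_le {K L : Set E} (hK : Convex ℝ K) (hL : Convex ℝ L) {r : ℝ}
    (hr : 0 < r) (hball : Metric.closedBall 0 r ⊆ K - L) {D : ℝ}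
    (hD : ∀ u ∈ K, ∀ v ∈ K, dist u v ≤ D) {δ : ℝ} {y k l : E} (hk : k ∈ K) (hl : l ∈ L)
    (hyk : dist y k ≤ δ) (hyl : dist y l ≤ δ) :
    ∃ m ∈ K ∩ L, dist y m ≤ δ + 2 * δ / r * D := by
  set w := k - l with hw
  have hD0 : 0 ≤ D := by simpa using hD k hk k hk
  have hwδ : ‖w‖ ≤ 2 * δ := by
    rw [hw, ← dist_eq_norm]
    have := dist_triangle_left k l y
    linarith
  have hu : (-(r / ‖w‖)) • w ∈ Metric.closedBall (0 : E) r := by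
    rw [mem_closedBall_zero_iff, norm_smul, norm_neg, norm_div, norm_norm, Real.norm_eq_abs,
      abs_of_pos hr]
    rcases eq_or_ne ‖w‖ 0 with h | h
    · rw [h, mul_zero]; exact hr.le
    · rw [div_mul_cancel₀ _ h]
  obtain ⟨k0, hk0, l0, hl0, e⟩ := hball hu
  change k0 - l0 = _ at e
  have hpos : 0 < r + ‖w‖ := by positivity
  set t := ‖w‖ / (r + ‖w‖) with ht
  have ht0 : 0 ≤ t := by positivity
  have ht1 : 0 ≤ 1 - t := by
    rw [sub_nonneg, ht, div_le_one hpos]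
    linarith
  have hm : (1 - t) • k + t • k0 = (1 - t) • l + t • l0 := by
    rw [← sub_eq_zero]
    have h1 : (1 - t) • k + t • k0 - ((1 - t) • l + t • l0) = (1 - t) • w + t • (k0 - l0) := by
      rw [hw]; module
    rw [h1, e]
    rcases eq_or_ne w 0 with h | h
    · simp [h]
    · have h' : ‖w‖ ≠ 0 := norm_ne_zero_iff.2 h
      rw [smul_smul, ← add_smul]
      have : 1 - t + t * -(r / ‖w‖) = 0 := by
        rw [ht]; field_simp; ring
      rw [this, zero_smul]
  refine ⟨(1 - t) • k + t • k0, ⟨hK hk hk0 ht1 ht0 (by ring), ?_⟩, ?_⟩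
  · rw [hm]; exact hL hl hl0 ht1 ht0 (by ring)
  · have h1 : dist k ((1 - t) • k + t • k0) = t * dist k k0 := by
      rw [dist_eq_norm, dist_eq_norm, show k - ((1 - t) • k + t • k0) = t • (k - k0) by module,
        norm_smul, Real.norm_of_nonneg ht0]
    have h2 : t ≤ 2 * δ / r := by
      rw [ht]
      exact div_le_div₀ ((norm_nonneg _).trans hwδ) hwδ hr (by linarith [norm_nonneg w])
    calc dist y _ ≤ dist y k + dist k _ := dist_triangle _ _ _
      _ ≤ δ + t * D := by
          rw [h1]
          exact add_le_add hyk (mul_le_mul_of_nonneg_left (hD _ hk _ hk0) ht0)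
      _ ≤ _ := by gcongr

theorem closedBall_subset_sub {K L K' L' : ConvexBody E} {r δ : ℝ} (hr : 0 ≤ r)
    (hball : Metric.closedBall 0 r ⊆ (K : Set E) - (L : Set E)) (hK : dist K K' ≤ δ)
    (hL : dist L L' ≤ δ) :
    Metric.closedBall 0 (r - 2 * δ) ⊆ (K' : Set E) - (L' : Set E) := by
  intro v hv
  rw [mem_closedBall_zero_iff] at hv
  rw [← coe_diffBody, ← body_supp (diffBody K' L'), mem_body]
  intro x
  have hp : (r / ‖x‖) • x ∈ Metric.closedBall (0 : E) r := by
    rw [mem_closedBall_zero_iff, norm_smul, norm_div, norm_norm, Real.norm_eq_abs,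
      abs_of_nonneg hr]
    rcases eq_or_ne ‖x‖ 0 with h | h
    · rw [h, mul_zero]; exact hr
    · rw [div_mul_cancel₀ _ h]
  obtain ⟨k, hk, l, hl, e⟩ := hball hp
  change k - l = _ at e
  obtain ⟨k', hk', h1⟩ := exists_dist_le_dist K K' hk
  obtain ⟨l', hl', h2⟩ := exists_dist_le_dist L L' hl
  have h3 := inner_le_supp (K := diffBody K' L') (Set.sub_mem_sub hk' hl') x
  refine le_trans ?_ h3
  have h4 : ⟪k - l, x⟫ = r * ‖x‖ := by
    rw [e, inner_smul_left, real_inner_self_eq_norm_sq]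
    rcases eq_or_ne ‖x‖ 0 with h | h
    · simp [h]
    · simp only [conj_trivial]; field_simp
  have h5 : ⟪(k - l) - (k' - l'), x⟫ ≤ 2 * δ * ‖x‖ := by
    refine (real_inner_le_norm _ _).trans (mul_le_mul_of_nonneg_right ?_ (norm_nonneg _))
    rw [show (k - l) - (k' - l') = (k - k') - (l - l') by abel]
    refine (norm_sub_le _ _).trans ?_
    rw [← dist_eq_norm, ← dist_eq_norm]
    linarith
  rw [inner_sub_left, h4] at h5
  have h6 := (real_inner_le_norm v x).trans (mul_le_mul_of_nonneg_right hv (norm_nonneg x))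
  linarith

/-- The intersection of two convex bodies which meet. -/
def interBody (K L : ConvexBody E) (h : ((K : Set E) ∩ L).Nonempty) : ConvexBody E :=
  ⟨(K : Set E) ∩ L, K.convex.inter L.convex, K.isCompact.inter L.isCompact, h⟩

theorem exists_closedBall_subset {K L : ConvexBody E}
    (h : (0 : E) ∈ interior ((K : Set E) - (L : Set E))) :
    ∃ r > 0, Metric.closedBall 0 r ⊆ (K : Set E) - (L : Set E) := by
  obtain ⟨r, hr, h1⟩ := Metric.nhds_basis_closedBall.mem_iff.1 (mem_interior_iff_mem_nhds.1 h)
  exact ⟨r, hr, h1⟩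

theorem nonempty_inter_iff {K L : Set E} : (K ∩ L).Nonempty ↔ (0 : E) ∈ K - L := by
  rw [Set.mem_sub]
  constructor
  · rintro ⟨x, h1, h2⟩
    exact ⟨x, h1, x, h2, sub_self x⟩
  · rintro ⟨x, h1, y, h2, h3⟩
    rw [sub_eq_zero] at h3
    exact ⟨x, h1, h3 ▸ h2⟩

theorem eventually_mem_interior {K L : ConvexBody E}
    (h : (0 : E) ∈ interior ((K : Set E) - (L : Set E))) :
    ∀ᶠ p in nhds (K, L), (0 : E) ∈ interior ((p.1 : Set E) - (p.2 : Set E)) := by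
  obtain ⟨r, hr, hb⟩ := exists_closedBall_subset h
  filter_upwards [Metric.ball_mem_nhds (K, L) (show (0 : ℝ) < r / 4 by positivity)] with p hp
  rw [Metric.mem_ball, Prod.dist_eq, max_lt_iff, dist_comm, dist_comm p.2] at hp
  have := closedBall_subset_sub hr.le hb hp.1.le hp.2.le
  exact mem_interior_iff_mem_nhds.2
    (Filter.mem_of_superset (Metric.closedBall_mem_nhds 0 (by linarith)) this)

theorem eventually_notMem_sub {K L : ConvexBody E} (h : (0 : E) ∉ (K : Set E) - (L : Set E)) :
    ∀ᶠ p in nhds (K, L), (0 : E) ∉ (p.1 : Set E) - (p.2 : Set E) := by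
  have hc : IsClosed ((K : Set E) - (L : Set E)) := (diffBody K L).isCompact.isClosed
  obtain ⟨ρ, hρ, hb⟩ := Metric.nhds_basis_ball.mem_iff.1 (hc.isOpen_compl.mem_nhds h)
  filter_upwards [Metric.ball_mem_nhds (K, L) (show (0 : ℝ) < ρ / 2 by positivity)] with p hp hm
  rw [Metric.mem_ball, Prod.dist_eq, max_lt_iff] at hp
  obtain ⟨y, h1, h2⟩ := nonempty_inter_iff.2 hm
  obtain ⟨k, hk, hk'⟩ := exists_dist_le_dist p.1 K h1
  obtain ⟨l, hl, hl'⟩ := exists_dist_le_dist p.2 L h2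
  refine hb (?_ : k - l ∈ _) (Set.sub_mem_sub hk hl)
  rw [mem_ball_zero_iff, ← dist_eq_norm]
  have := dist_triangle_left k l y
  linarith [hp.1, hp.2]

/-- Convex bodies in general position: either disjoint, or with intersecting interiors in the
sense that `0` is interior to the difference body. -/
theorem isOpen_notMem_frontier :
    IsOpen {p : ConvexBody E × ConvexBody E |
      (0 : E) ∉ frontier ((p.1 : Set E) - (p.2 : Set E))} := by
  rw [isOpen_iff_mem_nhds]
  rintro ⟨K, L⟩ h
  rw [Set.mem_ofPred_eq] at h
  by_cases h0 : (0 : E) ∈ interior ((K : Set E) - (L : Set E))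
  · filter_upwards [eventually_mem_interior h0] with p hp
    exact fun h' => h'.2 hp
  · have h1 : (0 : E) ∉ (K : Set E) - (L : Set E) := fun h' => h ⟨subset_closure h', h0⟩
    filter_upwards [eventually_notMem_sub h1] with p hp
    intro h'
    have h2 := h'.1
    rw [← coe_diffBody, (diffBody p.1 p.2).isCompact.isClosed.closure_eq] at h2
    exact hp h2

theorem eventually_dist_interBody_lt {K L : ConvexBody E}
    (h : (0 : E) ∈ interior ((K : Set E) - (L : Set E))) (hne : ((K : Set E) ∩ L).Nonempty)
    {η : ℝ} (hη : 0 < η) : ∀ᶠ p in nhds (K, L), ∃ hp : ((p.1 : Set E) ∩ p.2).Nonempty,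
      dist (interBody p.1 p.2 hp) (interBody K L hne) < η := by
  obtain ⟨r, hr, hb⟩ := exists_closedBall_subset h
  obtain ⟨D, hD⟩ := K.isCompact.isBounded.exists_norm_le
  have hD0 : 0 ≤ D := (norm_nonneg _).trans (hD _ K.nonempty.some_mem)
  obtain ⟨δ, hδ, hδ1, hδr, hδη⟩ : ∃ δ : ℝ, 0 < δ ∧ δ ≤ 1 ∧ δ ≤ r / 4 ∧
      δ + 2 * δ / (r / 2) * (2 * D + 2) < η := by
    have h1 : Filter.Tendsto (fun δ : ℝ => δ + 2 * δ / (r / 2) * (2 * D + 2))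
        (nhdsWithin 0 (Set.Ioi 0)) (nhds 0) := by
      have : Continuous fun δ : ℝ => δ + 2 * δ / (r / 2) * (2 * D + 2) := by fun_prop
      have := (this.tendsto 0).mono_left (nhdsWithin_le_nhds (s := Set.Ioi 0))
      simpa using this
    have h2 : ∀ᶠ δ in nhdsWithin (0 : ℝ) (Set.Ioi 0), 0 < δ := self_mem_nhdsWithin
    have h3 : ∀ᶠ δ in nhdsWithin (0 : ℝ) (Set.Ioi 0), δ ≤ 1 :=
      nhdsWithin_le_nhds (Iic_mem_nhds one_pos)
    have h4 : ∀ᶠ δ in nhdsWithin (0 : ℝ) (Set.Ioi 0), δ ≤ r / 4 :=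
      nhdsWithin_le_nhds (Iic_mem_nhds (by positivity))
    obtain ⟨δ, h⟩ := (h2.and (h3.and (h4.and (h1.eventually (gt_mem_nhds hη))))).exists
    exact ⟨δ, h⟩
  filter_upwards [Metric.ball_mem_nhds (K, L) hδ] with p hp
  rw [Metric.mem_ball, Prod.dist_eq, max_lt_iff] at hp
  have hp1 : dist K p.1 ≤ δ := by rw [dist_comm]; exact hp.1.le
  have hp2 : dist L p.2 ≤ δ := by rw [dist_comm]; exact hp.2.le
  have hb' : Metric.closedBall 0 (r / 2) ⊆ (p.1 : Set E) - (p.2 : Set E) :=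
    (Metric.closedBall_subset_closedBall (by linarith)).trans
      (closedBall_subset_sub hr.le hb hp1 hp2)
  have hbK : Metric.closedBall 0 (r / 2) ⊆ (K : Set E) - (L : Set E) :=
    (Metric.closedBall_subset_closedBall (by linarith)).trans hb
  have hDK : ∀ u ∈ (K : Set E), ∀ v ∈ (K : Set E), dist u v ≤ 2 * D + 2 := by
    intro u hu v hv
    rw [dist_eq_norm]
    linarith [norm_sub_le u v, hD u hu, hD v hv]
  have hDp : ∀ u ∈ (p.1 : Set E), ∀ v ∈ (p.1 : Set E), dist u v ≤ 2 * D + 2 := by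
    intro u hu v hv
    obtain ⟨u', hu', h1⟩ := exists_dist_le_dist p.1 K hu
    obtain ⟨v', hv', h2⟩ := exists_dist_le_dist p.1 K hv
    have h3 : dist u' v' ≤ 2 * D := by
      rw [dist_eq_norm]; linarith [norm_sub_le u' v', hD u' hu', hD v' hv']
    have h4 := dist_triangle4 u u' v' v
    rw [dist_comm v' v] at h4
    linarith [hp.1]
  have hr2 : 0 < r / 2 := by positivity
  refine ⟨nonempty_inter_iff.2 (hb' (Metric.mem_closedBall_self hr2.le)),
    lt_of_le_of_lt ?_ hδη⟩
  rw [← ConvexBody.hausdorffDist_coe]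
  refine Metric.hausdorffDist_le_of_mem_dist (by positivity) ?_ ?_
  · rintro y ⟨h1, h2⟩
    obtain ⟨k, hk, hk'⟩ := exists_dist_le_dist p.1 K h1
    obtain ⟨l, hl, hl'⟩ := exists_dist_le_dist p.2 L h2
    exact exists_mem_inter_dist_le K.convex L.convex hr2 hbK hDK hk hl (hk'.trans hp.1.le)
      (hl'.trans hp.2.le)
  · rintro y ⟨h1, h2⟩
    obtain ⟨k, hk, hk'⟩ := exists_dist_le_dist K p.1 h1
    obtain ⟨l, hl, hl'⟩ := exists_dist_le_dist L p.2 h2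
    exact exists_mem_inter_dist_le p.1.convex p.2.convex hr2 hb' hDp hk hl (hk'.trans hp1)
      (hl'.trans hp2)

theorem inter_eq_empty_or (K L : ConvexBody E) :
    (K : Set E) ∩ L = ∅ ∨ ∃ I : ConvexBody E, (I : Set E) = (K : Set E) ∩ L := by
  rcases Set.eq_empty_or_nonempty ((K : Set E) ∩ L) with h | h
  · exact Or.inl h
  · exact Or.inr ⟨interBody K L h, rfl⟩

end Intersections

end Kinematic

namespace Kinematic

open scoped RealInnerProductSpace

section ExtendVal

variable {n : ℕ} {φ : ConvexBody (Eucl n) → ℝ}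

theorem extendVal_coe (φ : ConvexBody (Eucl n) → ℝ) (B : ConvexBody (Eucl n)) :
    extendVal φ (B : Set (Eucl n)) = φ B := by
  have h : ∃ C : ConvexBody (Eucl n), (C : Set (Eucl n)) = B := ⟨B, rfl⟩
  rw [extendVal, dif_pos h]
  exact congrArg φ (ConvexBody.ext h.choose_spec)

theorem extendVal_empty (φ : ConvexBody (Eucl n) → ℝ) : extendVal φ ∅ = 0 := by
  refine dif_neg ?_
  rintro ⟨C, hC⟩
  exact C.nonempty.ne_empty hC

theorem extendVal_inter (φ : ConvexBody (Eucl n) → ℝ) {K L : ConvexBody (Eucl n)}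
    (h : ((K : Set (Eucl n)) ∩ L).Nonempty) :
    extendVal φ ((K : Set (Eucl n)) ∩ L) = φ (interBody K L h) :=
  extendVal_coe φ (interBody K L h)

theorem continuousAt_extendVal_inter (hφ : Continuous φ) {K L : ConvexBody (Eucl n)}
    (h : (0 : Eucl n) ∉ frontier ((K : Set (Eucl n)) - (L : Set (Eucl n)))) :
    ContinuousAt (fun p : ConvexBody (Eucl n) × ConvexBody (Eucl n) =>
      extendVal φ ((p.1 : Set (Eucl n)) ∩ p.2)) (K, L) := by
  by_cases h0 : (0 : Eucl n) ∈ interior ((K : Set (Eucl n)) - (L : Set (Eucl n)))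
  · have hne := nonempty_inter_iff.2 (interior_subset h0)
    rw [ContinuousAt, Metric.tendsto_nhds]
    intro ε hε
    obtain ⟨η, hη, hη'⟩ := Metric.continuousAt_iff.1 (hφ.continuousAt (x := interBody K L hne)) ε hε
    filter_upwards [eventually_dist_interBody_lt h0 hne hη] with p hp
    obtain ⟨hp1, hp2⟩ := hp
    rw [extendVal_inter φ hp1, extendVal_inter φ hne]
    exact hη' hp2
  · have h1 : (0 : Eucl n) ∉ (K : Set (Eucl n)) - (L : Set (Eucl n)) :=
      fun h' => h ⟨subset_closure h', h0⟩
    have h2 : ∀ {K L : ConvexBody (Eucl n)}, (0 : Eucl n) ∉ (K : Set (Eucl n)) - (L : Set (Eucl n))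
        → extendVal φ ((K : Set (Eucl n)) ∩ L) = 0 := by
      intro K L h
      rw [Set.not_nonempty_iff_eq_empty.1 (fun h' => h (nonempty_inter_iff.1 h')), extendVal_empty]
    refine (continuousAt_const (y := (0 : ℝ))).congr ?_
    filter_upwards [eventually_notMem_sub h1] with p hp
    exact (h2 hp).symm

theorem extendVal_inter_add (hφ : IsValuation φ) {K L M I : ConvexBody (Eucl n)}
    (hM : (M : Set (Eucl n)) = (K : Set (Eucl n)) ∪ L)
    (hI : (I : Set (Eucl n)) = (K : Set (Eucl n)) ∩ L) (B : ConvexBody (Eucl n)) :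
    extendVal φ ((M : Set (Eucl n)) ∩ B) + extendVal φ ((I : Set (Eucl n)) ∩ B) =
      extendVal φ ((K : Set (Eucl n)) ∩ B) + extendVal φ ((L : Set (Eucl n)) ∩ B) := by
  have e1 : (M : Set (Eucl n)) ∩ B = ((K : Set (Eucl n)) ∩ B) ∪ ((L : Set (Eucl n)) ∩ B) := by
    rw [hM, Set.union_inter_distrib_right]
  have e2 : (I : Set (Eucl n)) ∩ B = ((K : Set (Eucl n)) ∩ B) ∩ ((L : Set (Eucl n)) ∩ B) := by
    rw [hI, Set.inter_inter_distrib_right]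
  rcases Set.eq_empty_or_nonempty ((K : Set (Eucl n)) ∩ B) with hK | hK
  · rw [e1, e2, hK, Set.empty_union, Set.empty_inter, extendVal_empty]
    ring
  rcases Set.eq_empty_or_nonempty ((L : Set (Eucl n)) ∩ B) with hL | hL
  · rw [e1, e2, hL, Set.union_empty, Set.inter_empty, extendVal_empty]
  have hMne : ((M : Set (Eucl n)) ∩ B).Nonempty := by
    rw [e1]; exact hK.inl
  have hIne : ((I : Set (Eucl n)) ∩ B).Nonempty := by
    have hc : IsPreconnected ((M : Set (Eucl n)) ∩ B) := (M.convex.inter B.convex).isPreconnected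
    have h1 := isPreconnected_closed_iff.1 hc K L K.isCompact.isClosed L.isCompact.isClosed
      (by rw [hM]; exact Set.inter_subset_left)
      (by rw [e1]; exact hK.mono fun x hx => ⟨Or.inl hx, hx.1⟩)
      (by rw [e1]; exact hL.mono fun x hx => ⟨Or.inr hx, hx.1⟩)
    refine h1.mono fun x hx => ⟨?_, hx.1.2⟩
    rw [hI]; exact hx.2
  rw [extendVal_inter φ hMne, extendVal_inter φ hIne, extendVal_inter φ hK, extendVal_inter φ hL]
  exact hφ _ _ _ _ e1 e2

theorem extendVal_translate (hφ : TransInv φ) (K L : ConvexBody (Eucl n)) (v : Eucl n) :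
    extendVal φ ((fun y => y + v) '' ((K : Set (Eucl n)) ∩ L)) =
      extendVal φ ((K : Set (Eucl n)) ∩ L) := by
  rcases inter_eq_empty_or K L with h | ⟨I, h⟩
  · rw [h, Set.image_empty]
  · rw [← h, extendVal_coe, ← hφ I v, ← extendVal_coe φ (I.translate v)]
    congr 1
    exact Set.add_singleton.symm

theorem extendVal_matBody {G : Set (Matrix (Fin n) (Fin n) ℝ)} (hφ : GInv G φ)
    {A : Matrix (Fin n) (Fin n) ℝ} (hA : A ∈ G) (K L : ConvexBody (Eucl n)) :
    extendVal φ (Matrix.toEuclideanLin A '' ((K : Set (Eucl n)) ∩ L)) =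
      extendVal φ ((K : Set (Eucl n)) ∩ L) := by
  rcases inter_eq_empty_or K L with h | ⟨I, h⟩
  · rw [h, Set.image_empty]
  · rw [← h, extendVal_coe, ← hφ A hA I, ← extendVal_coe φ (matBody A I)]
    rfl

/-- The image `A L + x` of a convex body under an affine map. -/
def moveBody (A : Mat n) (x : Eucl n) (L : ConvexBody (Eucl n)) : ConvexBody (Eucl n) :=
  (matBody (Matrix.of A) L).translate x

theorem coe_moveBody (A : Mat n) (x : Eucl n) (L : ConvexBody (Eucl n)) :
    (moveBody A x L : Set (Eucl n)) =
      (fun y => Matrix.toEuclideanLin (Matrix.of A) y + x) '' (L : Set (Eucl n)) := by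
  change Matrix.toEuclideanLin (Matrix.of A) '' (L : Set (Eucl n)) + {x} = _
  rw [Set.add_singleton, Set.image_image]

theorem coe_moveBody' (A : Mat n) (x : Eucl n) (L : ConvexBody (Eucl n)) :
    (moveBody A x L : Set (Eucl n)) = (fun y => matCLM A y + x) '' (L : Set (Eucl n)) :=
  coe_moveBody A x L

theorem dist_moveBody_le (A A' : Mat n) (x x' : Eucl n) {L L' : ConvexBody (Eucl n)} {R : ℝ}
    (hR : ∀ y ∈ (L : Set (Eucl n)), ‖y‖ ≤ R) :
    dist (moveBody A x L) (moveBody A' x' L') ≤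
      ‖matCLM A - matCLM A'‖ * R + ‖matCLM A'‖ * dist L L' + dist x x' := by
  have hR0 : 0 ≤ R := (norm_nonneg _).trans (hR _ L.nonempty.some_mem)
  have key : ∀ y ∈ (L : Set (Eucl n)), ∀ y', dist y y' ≤ dist L L' →
      dist (matCLM A y + x) (matCLM A' y' + x') ≤
        ‖matCLM A - matCLM A'‖ * R + ‖matCLM A'‖ * dist L L' + dist x x' := by
    intro y hy y' h
    rw [dist_eq_norm, dist_eq_norm x x', show matCLM A y + x - (matCLM A' y' + x') =
      (matCLM A - matCLM A') y + matCLM A' (y - y') + (x - x') by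
        rw [_root_.sub_apply, map_sub]; abel]
    refine (norm_add₃_le).trans ?_
    gcongr
    · exact ((matCLM A - matCLM A').le_opNorm y).trans
        (mul_le_mul_of_nonneg_left (hR y hy) (norm_nonneg _))
    · rw [dist_eq_norm] at h
      exact ((matCLM A').le_opNorm _).trans (mul_le_mul_of_nonneg_left h (norm_nonneg _))
  rw [← ConvexBody.hausdorffDist_coe, coe_moveBody', coe_moveBody']
  refine Metric.hausdorffDist_le_of_mem_dist (by positivity) ?_ ?_
  · rintro _ ⟨y, hy, rfl⟩
    obtain ⟨y', hy', h⟩ := exists_dist_le_dist L L' hy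
    exact ⟨_, ⟨y', hy', rfl⟩, key y hy y' h⟩
  · rintro _ ⟨y', hy', rfl⟩
    obtain ⟨y, hy, h⟩ := exists_dist_le_dist L' L hy'
    rw [dist_comm, dist_comm L'] at h
    refine ⟨_, ⟨y, hy, rfl⟩, ?_⟩
    rw [dist_comm]
    exact key y hy y' h

theorem continuous_moveBody :
    Continuous fun p : (Mat n × Eucl n) × ConvexBody (Eucl n) => moveBody p.1.1 p.1.2 p.2 := by
  rw [continuous_iff_continuousAt]
  rintro ⟨⟨A, x⟩, L⟩
  obtain ⟨R, hR⟩ := L.isCompact.isBounded.exists_norm_le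
  rw [ContinuousAt, tendsto_iff_dist_tendsto_zero]
  refine squeeze_zero (fun _ => dist_nonneg) (fun p => ?_) (g := fun p =>
    ‖matCLM A - matCLM p.1.1‖ * R + ‖matCLM p.1.1‖ * dist L p.2 + dist x p.1.2) ?_
  · rw [dist_comm]
    exact dist_moveBody_le A p.1.1 x p.1.2 hR
  · have h1 : Continuous fun p : (Mat n × Eucl n) × ConvexBody (Eucl n) => matCLM p.1.1 :=
      continuous_matCLM.comp (continuous_fst.comp continuous_fst)
    have h2 : Continuous fun p : (Mat n × Eucl n) × ConvexBody (Eucl n) =>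
        ‖matCLM A - matCLM p.1.1‖ * R + ‖matCLM p.1.1‖ * dist L p.2 + dist x p.1.2 :=
      (((continuous_const.sub h1).norm.mul continuous_const).add
        (h1.norm.mul (continuous_const.dist continuous_snd))).add
        (continuous_const.dist (continuous_snd.comp continuous_fst))
    have := h2.tendsto ((A, x), L)
    simpa using this

theorem norm_le_of_mem_moveBody {A : Mat n} (hA : Matrix.of A ∈ Matrix.orthogonalGroup (Fin n) ℝ)
    {K L : ConvexBody (Eucl n)} {R R' : ℝ} (hK : ∀ y ∈ (K : Set (Eucl n)), ‖y‖ ≤ R)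
    (hL : ∀ y ∈ (L : Set (Eucl n)), ‖y‖ ≤ R') {x : Eucl n}
    (h : ((K : Set (Eucl n)) ∩ moveBody A x L).Nonempty) : ‖x‖ ≤ R + R' := by
  rw [coe_moveBody] at h
  obtain ⟨_, hy, z, hz, rfl⟩ := h
  have h1 := hK _ hy
  have h2 := hL _ hz
  rw [← norm_toEuclideanLin hA] at h2
  have h3 := norm_sub_le (Matrix.toEuclideanLin (Matrix.of A) z + x)
    (Matrix.toEuclideanLin (Matrix.of A) z)
  rw [add_sub_cancel_left] at h3
  linarith

end ExtendVal

end Kinematic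

namespace Kinematic

open scoped RealInnerProductSpace

section KinInt

variable {n : ℕ} {φ : ConvexBody (Eucl n) → ℝ} {G : Set (Matrix (Fin n) (Fin n) ℝ)}
  {γ : Measure (Mat n)}

/-- The integrand `φ (K ∩ (g L + x))` of the kinematic formula. -/
def kinFun (φ : ConvexBody (Eucl n) → ℝ) (K L : ConvexBody (Eucl n)) (p : Mat n × Eucl n) : ℝ :=
  extendVal φ ((K : Set (Eucl n)) ∩ moveBody p.1 p.2 L)

/-- The rigid motions which put `L` in general position with respect to `K`. -/
def generalPos (K L : ConvexBody (Eucl n)) : Set (Mat n × Eucl n) :=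
  {p | (0 : Eucl n) ∉ frontier ((K : Set (Eucl n)) - (moveBody p.1 p.2 L : Set (Eucl n)))}

theorem continuous_pair_moveBody : Continuous
    fun q : (ConvexBody (Eucl n) × ConvexBody (Eucl n)) × (Mat n × Eucl n) =>
      (q.1.1, moveBody q.2.1 q.2.2 q.1.2) := by
  refine Continuous.prodMk (continuous_fst.comp continuous_fst) ?_
  have h : Continuous fun q : (ConvexBody (Eucl n) × ConvexBody (Eucl n)) × (Mat n × Eucl n) =>
      (q.2, q.1.2) := continuous_snd.prodMk (continuous_snd.comp continuous_fst)
  have hc := (continuous_moveBody (n := n)).comp h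
  exact hc

theorem isOpen_generalPos (K L : ConvexBody (Eucl n)) : IsOpen (generalPos K L) := by
  have h : Continuous fun p : Mat n × Eucl n => (K, moveBody p.1 p.2 L) := by
    refine continuous_const.prodMk ?_
    have h1 : Continuous fun p : Mat n × Eucl n => (p, L) := Continuous.prodMk_left L
    have hc := (continuous_moveBody (n := n)).comp h1
    exact hc
  have e : generalPos K L = (fun p : Mat n × Eucl n => (K, moveBody p.1 p.2 L)) ⁻¹'
      {q : ConvexBody (Eucl n) × ConvexBody (Eucl n) |
        (0 : Eucl n) ∉ frontier ((q.1 : Set (Eucl n)) - (q.2 : Set (Eucl n)))} := by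
    ext p
    rw [Set.mem_preimage, Set.mem_ofPred_eq, generalPos, Set.mem_ofPred_eq]
  rw [e]
  exact IsOpen.preimage h isOpen_notMem_frontier

theorem continuousAt_kinFun (hφ : Continuous φ) {K L : ConvexBody (Eucl n)} {p : Mat n × Eucl n}
    (hp : p ∈ generalPos K L) : ContinuousAt
      (fun q : (ConvexBody (Eucl n) × ConvexBody (Eucl n)) × (Mat n × Eucl n) =>
        kinFun φ q.1.1 q.1.2 q.2) ((K, L), p) := by
  have h0 : (0 : Eucl n) ∉ frontier ((K : Set (Eucl n)) - (moveBody p.1 p.2 L : Set (Eucl n))) := hp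
  have h1 := continuousAt_extendVal_inter hφ h0
  have h2 := (continuous_pair_moveBody (n := n)).tendsto ((K, L), p)
  exact h1.tendsto.comp h2

theorem ae_mem_generalPos [SFinite γ] (K L : ConvexBody (Eucl n)) :
    ∀ᵐ p ∂γ.prod volume, p ∈ generalPos K L := by
  change (γ.prod volume) (generalPos K L)ᶜ = 0
  rw [Measure.measure_prod_null (isOpen_generalPos K L).isClosed_compl.measurableSet]
  refine Filter.Eventually.of_forall fun A => ?_
  change volume (Prod.mk A ⁻¹' (generalPos K L)ᶜ) = 0
  have hc : Convex ℝ ((K : Set (Eucl n)) - (moveBody A 0 L : Set (Eucl n))) :=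
    (diffBody K (moveBody A 0 L)).convex
  refine measure_mono_null (fun x hx => ?_) (hc.addHaar_frontier volume)
  rw [Set.mem_preimage, Set.mem_compl_iff, generalPos, Set.mem_ofPred_eq, not_not] at hx
  have e : (K : Set (Eucl n)) - (moveBody A x L : Set (Eucl n)) =
      (Homeomorph.addRight (-x)) '' ((K : Set (Eucl n)) - (moveBody A 0 L : Set (Eucl n))) := by
    rw [coe_moveBody', coe_moveBody']
    ext v
    simp only [Set.mem_sub, Set.mem_image, Homeomorph.coe_addRight, add_zero, exists_exists_and_eq_and]
    constructor
    · rintro ⟨k, hk, l, hl, rfl⟩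
      exact ⟨_, ⟨k, hk, l, hl, rfl⟩, by abel⟩
    · rintro ⟨_, ⟨k, hk, l, hl, rfl⟩, rfl⟩
      exact ⟨k, hk, l, hl, by abel⟩
  simp only at hx
  rw [e, ← Homeomorph.image_frontier] at hx
  obtain ⟨y, hy, h0⟩ := hx
  rw [Homeomorph.coe_addRight, add_neg_eq_zero] at h0
  exact h0 ▸ hy

theorem aestronglyMeasurable_kinFun [SFinite γ] (hφ : Continuous φ) (K L : ConvexBody (Eucl n)) :
    AEStronglyMeasurable (kinFun φ K L) (γ.prod volume) := by
  have h1 : ContinuousOn (kinFun φ K L) (generalPos K L) := fun p hp =>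
    (ContinuousAt.comp (g := fun q : (ConvexBody (Eucl n) × ConvexBody (Eucl n)) ×
        (Mat n × Eucl n) => kinFun φ q.1.1 q.1.2 q.2) (f := fun p => ((K, L), p))
      (continuousAt_kinFun hφ hp) (Continuous.prodMk_right (K, L)).continuousAt).continuousWithinAt
  have h2 := h1.aestronglyMeasurable (μ := γ.prod volume) (isOpen_generalPos K L).measurableSet
  rwa [Measure.restrict_eq_self_of_ae_mem (ae_mem_generalPos K L)] at h2

theorem exists_bound_kinFun (hφ : IsVF (toVF φ)) (hG : IsClosedSubgroupO G) (R : ℝ) :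
    ∃ C, ∀ K L : ConvexBody (Eucl n), (∀ v ∈ (K : Set (Eucl n)), ‖v‖ ≤ R) →
      (∀ v ∈ (L : Set (Eucl n)), ‖v‖ ≤ R) → ∀ p : Mat n × Eucl n, Matrix.of p.1 ∈ G →
      ‖kinFun φ K L p‖ ≤ (Metric.closedBall (0 : Eucl n) (R + R)).indicator (fun _ => C) p.2 := by
  obtain ⟨C, hC⟩ := exists_bound_of_isVF hφ R
  refine ⟨C, fun K L hK hL p hp => ?_⟩
  have hC0 : 0 ≤ C := (abs_nonneg _).trans (hC K hK)
  rcases Set.eq_empty_or_nonempty ((K : Set (Eucl n)) ∩ moveBody p.1 p.2 L) with h | h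
  · rw [kinFun, h, extendVal_empty, norm_zero]
    exact Set.indicator_nonneg (fun _ _ => hC0) _
  · rw [Set.indicator_of_mem]
    · rw [kinFun, extendVal_inter φ h]
      exact hC _ fun v hv => hK v hv.1
    · rw [mem_closedBall_zero_iff]
      exact norm_le_of_mem_moveBody (hG.1 _ hp) hK hL h

theorem integrable_bound [IsProbabilityMeasure γ] (R C : ℝ) :
    Integrable (fun p : Mat n × Eucl n =>
      (Metric.closedBall (0 : Eucl n) R).indicator (fun _ => C) p.2) (γ.prod volume) := by
  have h : Integrable ((Metric.closedBall (0 : Eucl n) R).indicator (fun _ => C)) volume :=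
    (integrable_indicator_iff Metric.isClosed_closedBall.measurableSet).2
      (integrableOn_const (isCompact_closedBall (0 : Eucl n) R).measure_lt_top.ne)
  exact h.comp_snd γ

theorem IsHaarOn.ae_fst_mem (h : IsHaarOn G γ) :
    ∀ᵐ p ∂γ.prod (volume : Measure (Eucl n)), Matrix.of p.1 ∈ G :=
  Measure.quasiMeasurePreserving_fst.ae h.ae_mem

theorem integrable_kinFun (h : IsHaarOn G γ) (hφ : φ ∈ ValG G) (K L : ConvexBody (Eucl n)) :
    Integrable (kinFun φ K L) (γ.prod volume) := by
  have : IsProbabilityMeasure γ := h.prob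
  obtain ⟨R, hR⟩ := K.isCompact.isBounded.exists_norm_le
  obtain ⟨R', hR'⟩ := L.isCompact.isBounded.exists_norm_le
  obtain ⟨C, hC⟩ := exists_bound_kinFun (isVF_toVF hφ.1 hφ.2.1 hφ.2.2.1) h.subgroup (max R R')
  refine (integrable_bound (max R R' + max R R') C).mono'
    (aestronglyMeasurable_kinFun hφ.2.1 K L) ?_
  filter_upwards [h.ae_fst_mem] with p hp
  exact hC K L (fun v hv => (hR v hv).trans (le_max_left _ _))
    (fun v hv => (hR' v hv).trans (le_max_right _ _)) p hp

/-- The kinematic integral of a valuation. -/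
def kinInt (γ : Measure (Mat n)) (φ : ConvexBody (Eucl n) → ℝ) (K L : ConvexBody (Eucl n)) : ℝ :=
  ∫ p, kinFun φ K L p ∂γ.prod volume

theorem kinInt_eq (h : IsHaarOn G γ) (hφ : φ ∈ ValG G) (K L : ConvexBody (Eucl n)) :
    kinInt γ φ K L = ∫ A, (∫ x, kinFun φ K L (A, x)) ∂γ := by
  have : IsProbabilityMeasure γ := h.prob
  exact integral_prod _ (integrable_kinFun h hφ K L)

theorem exists_bound_nhds (K : ConvexBody (Eucl n)) :
    ∃ R, ∀ K' : ConvexBody (Eucl n), dist K' K < 1 → ∀ v ∈ (K' : Set (Eucl n)), ‖v‖ ≤ R := by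
  obtain ⟨R, hR⟩ := K.isCompact.isBounded.exists_norm_le
  refine ⟨R + 1, fun K' h v hv => ?_⟩
  obtain ⟨w, hw, hvw⟩ := exists_dist_le_dist K' K hv
  have := hR w hw
  rw [dist_eq_norm] at hvw
  linarith [norm_sub_norm_le v w]

theorem continuous_kinInt (h : IsHaarOn G γ) (hφ : φ ∈ ValG G) :
    Continuous fun q : ConvexBody (Eucl n) × ConvexBody (Eucl n) => kinInt γ φ q.1 q.2 := by
  have : IsProbabilityMeasure γ := h.prob
  rw [continuous_iff_continuousAt]
  rintro ⟨K, L⟩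
  obtain ⟨R, hR⟩ := exists_bound_nhds K
  obtain ⟨R', hR'⟩ := exists_bound_nhds L
  obtain ⟨C, hC⟩ := exists_bound_kinFun (isVF_toVF hφ.1 hφ.2.1 hφ.2.2.1) h.subgroup (max R R')
  refine tendsto_integral_filter_of_dominated_convergence _
    (Filter.Eventually.of_forall fun q => aestronglyMeasurable_kinFun hφ.2.1 q.1 q.2) ?_
    (integrable_bound (max R R' + max R R') C) ?_
  · filter_upwards [Metric.ball_mem_nhds (K, L) one_pos] with q hq
    rw [Metric.mem_ball, Prod.dist_eq, max_lt_iff] at hq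
    filter_upwards [h.ae_fst_mem] with p hp
    exact hC q.1 q.2 (fun v hv => (hR _ hq.1 v hv).trans (le_max_left _ _))
      (fun v hv => (hR' _ hq.2 v hv).trans (le_max_right _ _)) p hp
  · filter_upwards [ae_mem_generalPos (γ := γ) K L] with p hp
    exact ContinuousAt.comp (g := fun q : (ConvexBody (Eucl n) × ConvexBody (Eucl n)) ×
        (Mat n × Eucl n) => kinFun φ q.1.1 q.1.2 q.2) (f := fun q => (q, p))
      (continuousAt_kinFun hφ.2.1 hp) (Continuous.prodMk_left p).continuousAt

end KinInt

end Kinematic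

namespace Kinematic

open scoped RealInnerProductSpace

section Kinematics

variable {n : ℕ} {φ : ConvexBody (Eucl n) → ℝ} {G : Set (Matrix (Fin n) (Fin n) ℝ)}
  {γ : Measure (Mat n)}

theorem coe_translate (K : ConvexBody (Eucl n)) (v : Eucl n) :
    (K.translate v : Set (Eucl n)) = (fun y => y + v) '' (K : Set (Eucl n)) := by
  change (K : Set (Eucl n)) + {v} = _
  rw [Set.add_singleton]

theorem coe_matBody (B : Mat n) (K : ConvexBody (Eucl n)) :
    (matBody (Matrix.of B) K : Set (Eucl n)) = matCLM B '' (K : Set (Eucl n)) := rfl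

theorem kinFun_translate_left (hφ : TransInv φ) (K L : ConvexBody (Eucl n)) (v : Eucl n)
    (A : Mat n) (x : Eucl n) : kinFun φ (K.translate v) L (A, x) = kinFun φ K L (A, x - v) := by
  have h := extendVal_translate hφ K (moveBody A (x - v) L) v
  rw [Set.image_inter (add_left_injective v), coe_moveBody', Set.image_image] at h
  simp only [add_assoc, sub_add_cancel] at h
  simp only [kinFun]
  rw [coe_translate, coe_moveBody', coe_moveBody', ← h]

theorem moveBody_translate (A : Mat n) (x v : Eucl n) (L : ConvexBody (Eucl n)) :
    moveBody A x (L.translate v) = moveBody A (x + matCLM A v) L := by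
  refine ConvexBody.ext ?_
  rw [coe_moveBody', coe_moveBody', coe_translate, Set.image_image]
  refine Set.image_congr fun y _ => ?_
  rw [map_add]
  abel

theorem kinFun_matBody_left (hφ : GInv G φ) (hG : IsClosedSubgroupO G) {B : Mat n}
    (hB : Matrix.of B ∈ G) (K L : ConvexBody (Eucl n)) (A : Mat n) (x : Eucl n) :
    kinFun φ (matBody (Matrix.of B) K) L (matMul B A, matCLM B x) = kinFun φ K L (A, x) := by
  obtain ⟨g, -, hg⟩ := exists_mem_isomSet hG hB
  have hinj : Function.Injective (matCLM B) := fun y z h => by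
    rw [matCLM_apply, matCLM_apply, hg, hg] at h
    exact g.injective h
  have h := extendVal_matBody hφ hB K (moveBody A x L)
  change extendVal φ (matCLM B '' _) = _ at h
  rw [Set.image_inter hinj] at h
  simp only [kinFun]
  rw [← h, coe_matBody, coe_moveBody', coe_moveBody', Set.image_image]
  simp only [matCLM_matMul, map_add]

theorem moveBody_matBody (A B : Mat n) (x : Eucl n) (L : ConvexBody (Eucl n)) :
    moveBody A x (matBody (Matrix.of B) L) = moveBody (matMul A B) x L := by
  refine ConvexBody.ext ?_
  rw [coe_moveBody', coe_moveBody', coe_matBody, Set.image_image]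
  simp only [matCLM_matMul]

theorem kinFun_add_left (hφ : IsValuation φ) {K L M I : ConvexBody (Eucl n)}
    (hM : (M : Set (Eucl n)) = (K : Set (Eucl n)) ∪ L)
    (hI : (I : Set (Eucl n)) = (K : Set (Eucl n)) ∩ L) (B : ConvexBody (Eucl n))
    (p : Mat n × Eucl n) :
    kinFun φ M B p + kinFun φ I B p = kinFun φ K B p + kinFun φ L B p :=
  extendVal_inter_add hφ hM hI _

theorem kinFun_add_right (hφ : IsValuation φ) (hG : IsClosedSubgroupO G)
    {K L M I : ConvexBody (Eucl n)}
    (hM : (M : Set (Eucl n)) = (K : Set (Eucl n)) ∪ L)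
    (hI : (I : Set (Eucl n)) = (K : Set (Eucl n)) ∩ L) (B : ConvexBody (Eucl n))
    {p : Mat n × Eucl n} (hp : Matrix.of p.1 ∈ G) :
    kinFun φ B M p + kinFun φ B I p = kinFun φ B K p + kinFun φ B L p := by
  obtain ⟨g, -, hg⟩ := exists_mem_isomSet hG hp
  have hinj : Function.Injective fun y => matCLM p.1 y + p.2 := fun y z h => by
    have h := add_right_cancel h
    rw [matCLM_apply, matCLM_apply, hg, hg] at h
    exact g.injective h
  simp only [kinFun, Set.inter_comm (B : Set (Eucl n))]
  refine extendVal_inter_add hφ ?_ ?_ B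
  · rw [coe_moveBody', coe_moveBody', coe_moveBody', hM, Set.image_union]
  · rw [coe_moveBody', coe_moveBody', coe_moveBody', hI, Set.image_inter hinj]

theorem kinInt_left_mem (h : IsHaarOn G γ) (hφ : φ ∈ ValG G) (L : ConvexBody (Eucl n)) :
    (fun K => kinInt γ φ K L) ∈ ValG G := by
  have hp : IsProbabilityMeasure γ := h.prob
  refine ⟨fun K K' M I hM hI => ?_, ?_, fun K v => ?_, fun A hA K => ?_⟩
  · simp only [kinInt]
    rw [← integral_add (integrable_kinFun h hφ _ _) (integrable_kinFun h hφ _ _),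
      ← integral_add (integrable_kinFun h hφ _ _) (integrable_kinFun h hφ _ _)]
    exact integral_congr_ae (Filter.Eventually.of_forall fun p =>
      kinFun_add_left hφ.1 hM hI L p)
  · exact (continuous_kinInt h hφ).comp (Continuous.prodMk_left L)
  · simp only [kinInt_eq h hφ]
    refine integral_congr_ae (Filter.Eventually.of_forall fun A => ?_)
    simp only [kinFun_translate_left hφ.2.2.1]
    exact integral_sub_right_eq_self (fun x => kinFun φ K L (A, x)) v
  · simp only [kinInt_eq h hφ]
    obtain ⟨B, rfl⟩ : ∃ B : Mat n, Matrix.of B = A := ⟨Matrix.of.symm A, rfl⟩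
    obtain ⟨g, -, hg⟩ := exists_mem_isomSet h.subgroup hA
    have hm : Measurable (matMul B) :=
      (continuous_matMul.comp (Continuous.prodMk_right B)).measurable
    have h1 := (integrable_kinFun h hφ (matBody (Matrix.of B) K) L).integral_prod_left
    conv_lhs => rw [← h.map_left B hA]
    rw [integral_map hm.aemeasurable (by rw [h.map_left B hA]; exact h1.aestronglyMeasurable)]
    refine integral_congr_ae (Filter.Eventually.of_forall fun A => ?_)
    have h2 := g.measurePreserving.integral_comp g.toHomeomorph.measurableEmbedding
      (fun x => kinFun φ (matBody (Matrix.of B) K) L (matMul B A, x))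
    simp only
    rw [← h2]
    refine integral_congr_ae (Filter.Eventually.of_forall fun x => ?_)
    have h3 := kinFun_matBody_left hφ.2.2.2 h.subgroup hA K L A x
    rw [matCLM_apply, hg] at h3
    exact h3

theorem kinInt_right_mem (h : IsHaarOn G γ) (hφ : φ ∈ ValG G) (K : ConvexBody (Eucl n)) :
    (fun L => kinInt γ φ K L) ∈ ValG G := by
  have hp : IsProbabilityMeasure γ := h.prob
  refine ⟨fun L L' M I hM hI => ?_, ?_, fun L v => ?_, fun A hA L => ?_⟩
  · simp only [kinInt]
    rw [← integral_add (integrable_kinFun h hφ _ _) (integrable_kinFun h hφ _ _),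
      ← integral_add (integrable_kinFun h hφ _ _) (integrable_kinFun h hφ _ _)]
    refine integral_congr_ae ?_
    filter_upwards [h.ae_fst_mem] with p hp
    exact kinFun_add_right hφ.1 h.subgroup hM hI K hp
  · exact (continuous_kinInt h hφ).comp (Continuous.prodMk_right K)
  · simp only [kinInt_eq h hφ]
    refine integral_congr_ae (Filter.Eventually.of_forall fun A => ?_)
    simp only [kinFun, moveBody_translate]
    exact integral_add_right_eq_self (fun x => kinFun φ K L (A, x)) (matCLM A v)
  · simp only [kinInt_eq h hφ]
    obtain ⟨B, rfl⟩ : ∃ B : Mat n, Matrix.of B = A := ⟨Matrix.of.symm A, rfl⟩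
    have hm : Measurable fun A : Mat n => matMul A B :=
      (continuous_matMul.comp (Continuous.prodMk_left B)).measurable
    have h1 := (integrable_kinFun h hφ K L).integral_prod_left
    conv_rhs => rw [← h.map_right hA]
    rw [integral_map hm.aemeasurable (by rw [h.map_right hA]; exact h1.aestronglyMeasurable)]
    simp only [kinFun, moveBody_matBody]

/-- A function of two variables whose sections lie in a finite dimensional space of functions is
a finite sum of products of elements of this space. -/
theorem exists_sum_mul_of_sections {X : Type*} (V : Submodule ℝ (X → ℝ)) [FiniteDimensional ℝ V]
    {k : X → X → ℝ} (hl : ∀ L, (fun K => k K L) ∈ V) (hr : ∀ K, (fun L => k K L) ∈ V) :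
    ∃ (N : ℕ) (ψ ρ : Fin N → X → ℝ), (∀ i, ψ i ∈ V) ∧ (∀ i, ρ i ∈ V) ∧
      ∀ K L, k K L = ∑ i, ψ i K * ρ i L := by
  let ev : X → Module.Dual ℝ V := fun K => (LinearMap.proj K).comp V.subtype
  let W : Submodule ℝ (Module.Dual ℝ V) := Submodule.span ℝ (Set.range ev)
  have hW : W = ⊤ := by
    rw [← Subspace.dualCoannihilator_dualAnnihilator_eq (W := W),
      show W.dualCoannihilator = ⊥ from ?_, Submodule.dualAnnihilator_bot]
    refine (Submodule.eq_bot_iff _).2 fun v hv => Subtype.ext (funext fun K => ?_)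
    exact (Submodule.mem_dualCoannihilator v).1 hv (ev K) (Submodule.subset_span ⟨K, rfl⟩)
  have key : ∀ l : Module.Dual ℝ V, (fun L => l ⟨_, hl L⟩) ∈ V := by
    intro l
    have hlW : l ∈ W := hW ▸ Submodule.mem_top
    induction hlW using Submodule.span_induction with
    | mem l h =>
      obtain ⟨K, rfl⟩ := h
      exact hr K
    | zero => exact V.zero_mem
    | add l m _ _ h1 h2 => exact V.add_mem h1 h2
    | smul c l _ h => exact V.smul_mem c h
  let b := Module.finBasis ℝ V
  refine ⟨_, fun i => (b i : X → ℝ), fun i L => b.coord i ⟨_, hl L⟩, fun i => (b i).2,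
    fun i => key (b.coord i), fun K L => ?_⟩
  have h1 := congrArg (fun v : V => (v : X → ℝ) K) (b.sum_repr ⟨_, hl L⟩)
  simp only [Submodule.coe_sum, Finset.sum_apply, Submodule.coe_smul, Pi.smul_apply,
    smul_eq_mul] at h1
  rw [← h1]
  exact Finset.sum_congr rfl fun i _ => mul_comm _ _

end Kinematics

end Kinematic

/-- **Existence of global kinematic formulas.** Let `G ≤ O(n)` be a closed subgroup acting
transitively on the unit sphere, `γ` the Haar probability measure on `G` and `λ` the
Lebesgue measure on `ℝⁿ`. For every `φ ∈ Val^G` (extended by `φ(∅) = 0`) there are finitely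
many `ψ_1, …, ψ_N, ρ_1, …, ρ_N ∈ Val^G` such that for all convex bodies `K, L` the function
`(g,x) ↦ φ(K ∩ (gL + x))` is `γ ⊗ λ`-integrable and
`∫_G ∫_{ℝⁿ} φ(K ∩ (gL + x)) dλ(x) dγ(g) = ∑ᵢ ψᵢ(K) ρᵢ(L)`. -/
theorem exists_kinematic_formula (n : ℕ) (hn : 1 ≤ n)
    (G : Set (Matrix (Fin n) (Fin n) ℝ)) (hG : IsClosedSubgroupO G)
    (htrans : ActsTransitively G)
    (γ : Measure (Mat n)) (hγprob : IsProbabilityMeasure γ)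
    (hγsupp : γ {A : Mat n | Matrix.of A ∉ G} = 0)
    (hγinv : ∀ B : Mat n, Matrix.of B ∈ G →
      Measure.map (fun A : Mat n => Matrix.of.symm (Matrix.of B * Matrix.of A)) γ = γ)
    (φ : ConvexBody (Eucl n) → ℝ)
    (hval : IsValuation φ) (hcont : Continuous φ) (htrans' : TransInv φ) (hGinv : GInv G φ) :
    ∃ (N : ℕ) (ψ ρ : Fin N → ConvexBody (Eucl n) → ℝ),
      (∀ i, IsValuation (ψ i) ∧ Continuous (ψ i) ∧ TransInv (ψ i) ∧ GInv G (ψ i)) ∧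
      (∀ i, IsValuation (ρ i) ∧ Continuous (ρ i) ∧ TransInv (ρ i) ∧ GInv G (ρ i)) ∧
      ∀ K L : ConvexBody (Eucl n),
        Integrable (fun p : Mat n × Eucl n => extendVal φ ((K : Set (Eucl n)) ∩
            ((fun y => Matrix.toEuclideanLin (Matrix.of p.1) y + p.2) '' (L : Set (Eucl n)))))
          (γ.prod volume) ∧
        (∫ g : Mat n, ∫ x : Eucl n, extendVal φ ((K : Set (Eucl n)) ∩
            ((fun y => Matrix.toEuclideanLin (Matrix.of g) y + x) '' (L : Set (Eucl n))))
            ∂(volume) ∂γ)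
          = ∑ i, ψ i K * ρ i L := by
  have h : Kinematic.IsHaarOn G γ := ⟨hG, hγprob, hγsupp, hγinv⟩
  have hφ : φ ∈ Kinematic.ValG G := ⟨hval, hcont, htrans', hGinv⟩
  have := Kinematic.finiteDimensional_ValG hn h htrans
  obtain ⟨N, ψ, ρ, hψ, hρ, hk⟩ := Kinematic.exists_sum_mul_of_sections (Kinematic.ValG G)
    (Kinematic.kinInt_left_mem h hφ) (Kinematic.kinInt_right_mem h hφ)
  refine ⟨N, ψ, ρ, hψ, hρ, fun K L => ⟨?_, ?_⟩⟩
  · have hint := Kinematic.integrable_kinFun h hφ K L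
    unfold Kinematic.kinFun at hint
    simpa only [Kinematic.coe_moveBody] using hint
  · rw [← hk, Kinematic.kinInt_eq h hφ]
    simp only [Kinematic.kinFun, Kinematic.coe_moveBody]
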